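/- There exists a universal constant c > 0 such that for every N ≥ 1, every normalized N-electron wave function Ψ, every divergence-free A ∈ C_c^∞(ℝ³,ℝ³), and every γ > 0: Σ_{j=1}^N t_A^{(j)}[Ψ] ≥ c ∫_{ℝ³} min{ ρ_Ψ(x)^{5/3}, γ·ρ_Ψ(x)^{4/3} } dx − γ ∫_{ℝ³} |∇×A|². -/

import Mathlib

open MeasureTheory

noncomputable section

/-- Euclidean norm on ℝ³ (encoded as `Fin 3 → ℝ`). -/
def enorm3 (x : Fin 3 → ℝ) : ℝ := Real.sqrt (∑ k, x k ^ 2)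

/-- The Pauli matrices σ₁, σ₂, σ₃. -/
def pauli : Fin 3 → Matrix (Fin 2) (Fin 2) ℂ :=
  ![!![0, 1; 1, 0], !![0, -Complex.I; Complex.I, 0], !![1, 0; 0, -1]]

/-- The partial derivative ∂ᵢ Aⱼ of a vector field on ℝ³. -/
def pdVec (A : (Fin 3 → ℝ) → Fin 3 → ℝ) (i j : Fin 3) (x : Fin 3 → ℝ) : ℝ :=
  fderiv ℝ A x (Pi.single i 1) j

/-- The curl ∇×A of a vector field on ℝ³. -/
def curl3 (A : (Fin 3 → ℝ) → Fin 3 → ℝ) (x : Fin 3 → ℝ) : Fin 3 → ℝ :=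
  ![pdVec A 1 2 x - pdVec A 2 1 x, pdVec A 2 0 x - pdVec A 0 2 x,
    pdVec A 0 1 x - pdVec A 1 0 x]

/-- |∇×A|²(x). -/
def curlSq (A : (Fin 3 → ℝ) → Fin 3 → ℝ) (x : Fin 3 → ℝ) : ℝ :=
  ∑ k, (curl3 A x k) ^ 2

/-- |∇⊗A|²(x) = Σᵢⱼ |∂ᵢAⱼ|². -/
def gradSq (A : (Fin 3 → ℝ) → Fin 3 → ℝ) (x : Fin 3 → ℝ) : ℝ :=
  ∑ i, ∑ j, (pdVec A i j x) ^ 2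

/-- A divergence-free smooth compactly supported vector potential. -/
def IsVecPot (A : (Fin 3 → ℝ) → Fin 3 → ℝ) : Prop :=
  ContDiff ℝ (⊤ : ℕ∞) A ∧ HasCompactSupport A ∧ ∀ x, ∑ k, pdVec A k k x = 0

/-- The unit basis vector of the configuration space (ℝ³)^N in direction
(particle j, coordinate k). -/
def eVec (N : ℕ) (j : Fin N) (k : Fin 3) : Fin N → Fin 3 → ℝ :=
  Pi.single j (Pi.single k 1)

/-- A normalized `N`-electron wave function: smooth, compactly supported,
antisymmetric under simultaneous permutation of position-spin pairs, L²-normalized. -/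
structure IsWaveFun (N : ℕ) (Ψ : (Fin N → Fin 3 → ℝ) → (Fin N → Fin 2) → ℂ) : Prop where
  smooth : ∀ s, ContDiff ℝ (⊤ : ℕ∞) fun x => Ψ x s
  compactSupport : ∀ s, HasCompactSupport fun x => Ψ x s
  antisymm : ∀ (π : Equiv.Perm (Fin N)) (x : Fin N → Fin 3 → ℝ) (s : Fin N → Fin 2),
    Ψ (fun i => x (π i)) (fun i => s (π i)) = ((Equiv.Perm.sign π : ℤ) : ℂ) * Ψ x s
  normalized : ∑ s : Fin N → Fin 2, ∫ x : Fin N → Fin 3 → ℝ, ‖Ψ x s‖ ^ 2 = 1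

/-- The expectation ∫ W |Ψ|² of a multiplication operator, including spin summation. -/
def potInt (N : ℕ) (W : (Fin N → Fin 3 → ℝ) → ℝ)
    (Ψ : (Fin N → Fin 3 → ℝ) → (Fin N → Fin 2) → ℂ) : ℝ :=
  ∑ s : Fin N → Fin 2, ∫ x : Fin N → Fin 3 → ℝ, W x * ‖Ψ x s‖ ^ 2

/-- The Pauli kinetic form t_A^{(j)}[Ψ] = ‖σ^{(j)}·(−i∇_{x_j} + A(x_j))Ψ‖². -/
def pauliKin (N : ℕ) (A : (Fin 3 → ℝ) → Fin 3 → ℝ) (j : Fin N)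
    (Ψ : (Fin N → Fin 3 → ℝ) → (Fin N → Fin 2) → ℂ) : ℝ :=
  ∑ s : Fin N → Fin 2, ∫ x : Fin N → Fin 3 → ℝ,
    ‖∑ k : Fin 3, ∑ t : Fin 2, pauli k (s j) t *
      (-Complex.I * fderiv ℝ (fun y => Ψ y (Function.update s j t)) x (eVec N j k)
        + (A (x j) k : ℂ) * Ψ x (Function.update s j t))‖ ^ 2

/-- The one-particle density ρ_Ψ of an (N+1)-electron wave function. -/
def oneDensity (N : ℕ) (Ψ : (Fin (N + 1) → Fin 3 → ℝ) → (Fin (N + 1) → Fin 2) → ℂ)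
    (x : Fin 3 → ℝ) : ℝ :=
  (N + 1) * ∑ s : Fin (N + 1) → Fin 2,
    ∫ y : Fin N → Fin 3 → ℝ, ‖Ψ (Fin.cons x y) s‖ ^ 2

open scoped ENNReal NNReal

lemma integrable_norm_sq_of_hasCompactSupport {X F : Type*} [TopologicalSpace X]
    [MeasurableSpace X] [OpensMeasurableSpace X] {μ : Measure X} [IsFiniteMeasureOnCompacts μ]
    [NormedAddCommGroup F] {u : X → F} (hu : Continuous u) (hc : HasCompactSupport u) :
    Integrable (fun x => ‖u x‖ ^ 2) μ := by
  have h : HasCompactSupport fun x => ‖u x‖ * ‖u x‖ := hc.norm.mul_right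
  simp only [← sq] at h
  exact (hu.norm.pow 2).integrable_of_hasCompactSupport h

/-- Three-dimensional space. -/
abbrev E3 := Fin 3 → ℝ

section Calculus

variable {F : Type*} [NormedAddCommGroup F] [NormedSpace ℝ F]

/-- The partial derivative in direction `k`. -/
def pd (k : Fin 3) (u : E3 → F) (x : E3) : F := fderiv ℝ u x (Pi.single k 1)

lemma ContDiff.pd {u : E3 → F} (hu : ContDiff ℝ (⊤ : ℕ∞) u) (k : Fin 3) :
    ContDiff ℝ (⊤ : ℕ∞) (pd k u) :=
  (hu.fderiv_right (m := (⊤ : ℕ∞)) (by simp)).clm_apply contDiff_const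

lemma HasCompactSupport.pd {u : E3 → F} (hu : HasCompactSupport u) (k : Fin 3) :
    HasCompactSupport (pd k u) :=
  hu.fderiv_apply ℝ _

lemma pd_comm {u : E3 → F} (hu : ContDiff ℝ (⊤ : ℕ∞) u) (j k : Fin 3) (x : E3) :
    pd j (pd k u) x = pd k (pd j u) x := by
  have hs : IsSymmSndFDerivAt ℝ u x := hu.contDiffAt.isSymmSndFDerivAt (by
    simpa using (by exact_mod_cast le_top : ((2 : ℕ∞) : WithTop ℕ∞) ≤ (⊤ : ℕ∞)))
  have hd : DifferentiableAt ℝ (fderiv ℝ u) x :=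
    ((hu.fderiv_right (m := (⊤ : ℕ∞)) (by simp)).differentiable (by simp)) x
  have key : ∀ v w : E3, fderiv ℝ (fun y => fderiv ℝ u y v) x w = fderiv ℝ (fderiv ℝ u) x w v := by
    intro v w
    rw [fderiv_clm_apply hd (differentiableAt_const _)]
    simp
  simp only [_root_.pd]
  erw [key, key]
  exact hs _ _

lemma pd_mul {u v : E3 → ℂ} (hu : Differentiable ℝ u) (hv : Differentiable ℝ v) (k : Fin 3)
    (x : E3) : pd k (fun y => u y * v y) x = u x * pd k v x + pd k u x * v x := by
  simp only [pd]
  rw [fderiv_fun_mul (hu x) (hv x)]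
  simp
  ring

lemma pd_conj {u : E3 → ℂ} (hu : Differentiable ℝ u) (k : Fin 3) (x : E3) :
    pd k (fun y => (starRingEnd ℂ) (u y)) x = (starRingEnd ℂ) (pd k u x) := by
  have h := (Complex.conjCLE.toContinuousLinearMap.hasFDerivAt (x := u x)).comp x (hu x).hasFDerivAt
  have h2 : fderiv ℝ (fun y => (starRingEnd ℂ) (u y)) x = _ := h.fderiv
  simp [pd, h2]

lemma ContDiff.conj {u : E3 → ℂ} (hu : ContDiff ℝ (⊤ : ℕ∞) u) :
    ContDiff ℝ (⊤ : ℕ∞) fun y => (starRingEnd ℂ) (u y) :=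
  Complex.conjCLE.contDiff.comp hu

lemma integral_pd_mul_pd_comm {𝕜 : Type*} [RCLike 𝕜] {g h : E3 → 𝕜}
    (hg : ContDiff ℝ (⊤ : ℕ∞) g) (hh : ContDiff ℝ (⊤ : ℕ∞) h) (hc : HasCompactSupport g)
    (j k : Fin 3) : ∫ x, pd j g x * pd k h x = ∫ x, pd k g x * pd j h x := by
  have gd : Differentiable ℝ g := hg.differentiable (by simp)
  have main : ∀ j k : Fin 3, ∫ x, g x * pd j (pd k h) x = - ∫ x, pd j g x * pd k h x := by
    intro j k
    refine integral_mul_fderiv_eq_neg_fderiv_mul_of_integrable (f := g) (g := pd k h)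
      (v := Pi.single j 1) ?_ ?_ ?_ (fun x _ => gd x)
      (fun x _ => (hh.pd k).differentiable (by simp) x)
    · exact ((hg.pd j).continuous.mul (hh.pd k).continuous).integrable_of_hasCompactSupport
        ((hc.pd j).mul_right)
    · exact (hg.continuous.mul ((hh.pd k).pd j).continuous).integrable_of_hasCompactSupport
        hc.mul_right
    · exact (hg.continuous.mul (hh.pd k).continuous).integrable_of_hasCompactSupport hc.mul_right
  have h1 := main j k
  have h2 := main k j
  simp_rw [pd_comm hh j k] at h1
  rw [h1] at h2
  exact neg_injective h2

/-- The operator `σ·∇`. -/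
def pauliGrad (f : Fin 2 → E3 → ℂ) (s : Fin 2) (x : E3) : ℂ :=
  ∑ k : Fin 3, ∑ t : Fin 2, pauli k s t * pd k (f t) x

lemma pauli_sum (v : Fin 3 → Fin 2 → ℂ) :
    (∑ k : Fin 3, ∑ t : Fin 2, pauli k 0 t * v k t) = v 0 1 - Complex.I * v 1 1 + v 2 0 ∧
    (∑ k : Fin 3, ∑ t : Fin 2, pauli k 1 t * v k t) = v 0 0 + Complex.I * v 1 0 - v 2 1 := by
  constructor <;> simp [pauli, Fin.sum_univ_three, Fin.sum_univ_two] <;> ring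

lemma integral_normSq_pauliGrad {f : Fin 2 → E3 → ℂ} (hf : ∀ s, ContDiff ℝ (⊤ : ℕ∞) (f s))
    (hc : ∀ s, HasCompactSupport (f s)) :
    ∫ x, ∑ s, ‖pauliGrad f s x‖ ^ 2 = ∫ x, ∑ s, ∑ k, ‖pd k (f s) x‖ ^ 2 := by
  have hd : ∀ s, Differentiable ℝ (f s) := fun s => (hf s).differentiable (by simp)
  set W : Fin 3 → Fin 3 → Fin 2 → Fin 2 → E3 → ℂ := fun j k s t x =>
    pd j (f s) x * (starRingEnd ℂ) (pd k (f t) x) -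
      pd k (f s) x * (starRingEnd ℂ) (pd j (f t) x) with hW
  have hInt : ∀ j k s t, Integrable fun x => pd j (f s) x * (starRingEnd ℂ) (pd k (f t) x) := by
    intro j k s t
    exact (((hf s).pd j).continuous.mul
      (Complex.continuous_conj.comp ((hf t).pd k).continuous)).integrable_of_hasCompactSupport
        ((hc s).pd j).mul_right
  have hWi : ∀ j k s t, Integrable (W j k s t) := fun j k s t => (hInt j k s t).sub (hInt k j s t)
  have hW0 : ∀ j k s t, ∫ x, W j k s t x = 0 := by
    intro j k s t
    rw [hW]
    simp only
    rw [integral_sub (hInt j k s t) (hInt k j s t), sub_eq_zero]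
    have := integral_pd_mul_pd_comm (hf s) (hf t).conj (hc s) j k
    simpa only [pd_conj (hd t)] using this
  set Z : E3 → ℂ := fun x => Complex.I * W 0 1 1 1 x + 2 * W 0 2 1 0 x
    - 2 * Complex.I * W 1 2 1 0 x - Complex.I * W 0 1 0 0 x with hZ
  have i1 : Integrable fun x => Complex.I * W 0 1 1 1 x := (hWi 0 1 1 1).const_mul _
  have i2 : Integrable fun x => 2 * W 0 2 1 0 x := (hWi 0 2 1 0).const_mul _
  have i3 : Integrable fun x => 2 * Complex.I * W 1 2 1 0 x := (hWi 1 2 1 0).const_mul _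
  have i4 : Integrable fun x => Complex.I * W 0 1 0 0 x := (hWi 0 1 0 0).const_mul _
  have i12 : Integrable fun x => Complex.I * W 0 1 1 1 x + 2 * W 0 2 1 0 x := i1.add i2
  have i123 : Integrable fun x => Complex.I * W 0 1 1 1 x + 2 * W 0 2 1 0 x
    - 2 * Complex.I * W 1 2 1 0 x := i12.sub i3
  have hZi : Integrable Z := i123.sub i4
  have hZ0 : ∫ x, Z x = 0 := by
    simp only [hZ]
    rw [integral_sub i123 i4, integral_sub i12 i3, integral_add i1 i2]
    simp only [integral_const_mul, hW0]
    simp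
  have hpt : ∀ x, ∑ s, ‖pauliGrad f s x‖ ^ 2 = (∑ s, ∑ k, ‖pd k (f s) x‖ ^ 2) + (Z x).re := by
    intro x
    simp only [Fin.sum_univ_two, Fin.sum_univ_three, pauliGrad]
    have h := pauli_sum (fun k t => pd k (f t) x)
    simp only [Fin.sum_univ_two, Fin.sum_univ_three] at h
    rw [h.1, h.2, hZ, hW]
    simp only [Complex.sq_norm, Complex.normSq_apply, Complex.add_re, Complex.sub_re,
      Complex.mul_re, Complex.add_im, Complex.sub_im, Complex.mul_im, Complex.I_re, Complex.I_im,
      Complex.conj_re, Complex.conj_im, Complex.re_ofNat, Complex.im_ofNat]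
    ring
  have hG : Integrable fun x => ∑ s, ∑ k, ‖pd k (f s) x‖ ^ 2 := by
    refine integrable_finsetSum _ fun s _ => integrable_finsetSum _ fun k _ => ?_
    exact integrable_norm_sq_of_hasCompactSupport ((hf s).pd k).continuous ((hc s).pd k)
  clear hZ i1 i2 i3 i4 i12 i123
  clear_value Z
  simp_rw [hpt]
  have hZre : Integrable fun x => (Z x).re := Complex.reCLM.integrable_comp hZi
  rw [integral_add hG hZre]
  have : ∫ x, (Z x).re = 0 := by
    have h := Complex.reCLM.integral_comp_comm hZi
    rw [hZ0] at h
    simpa using h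
  rw [this, add_zero]

end Calculus

section Estimates

variable {F : Type*} [NormedAddCommGroup F] [NormedSpace ℝ F]

lemma sq_lintegral_mul_le {α : Type*} [MeasurableSpace α] {μ : Measure α} {f g : α → ℝ≥0∞}
    (hf : AEMeasurable f μ) (hg : AEMeasurable g μ) :
    (∫⁻ a, f a * g a ∂μ) ^ 2 ≤ (∫⁻ a, f a ^ 2 ∂μ) * ∫⁻ a, g a ^ 2 ∂μ := by
  have h := ENNReal.lintegral_mul_norm_pow_le (μ := μ) (hf.pow_const 2) (hg.pow_const 2)
    (p := 1 / 2) (q := 1 / 2) (by norm_num) (by norm_num) (by norm_num)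
  have e : ∀ x : ℝ≥0∞, (x ^ 2) ^ (1 / 2 : ℝ) = x := by
    intro x
    rw [← ENNReal.rpow_natCast, ← ENNReal.rpow_mul]; norm_num
  have e' : ∀ x : ℝ≥0∞, (x ^ (1 / 2 : ℝ)) ^ 2 = x := by
    intro x
    rw [← ENNReal.rpow_natCast, ← ENNReal.rpow_mul]; norm_num
  simp only [e] at h
  calc _ ≤ _ := pow_le_pow_left' h 2
    _ = _ := by rw [mul_pow, e', e']

lemma sq_lintegral_le {α : Type*} [MeasurableSpace α] {μ : Measure α} {f : α → ℝ≥0∞}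
    (hf : AEMeasurable f μ) :
    (∫⁻ a, f a ∂μ) ^ 2 ≤ μ Set.univ * ∫⁻ a, f a ^ 2 ∂μ := by
  have := sq_lintegral_mul_le (μ := μ) (f := fun _ => 1) (g := f) aemeasurable_const hf
  simpa using this

lemma enorm_sub_sq_le_lintegral {g : E3 → F} (hg : ContDiff ℝ 1 g) (x w : E3) [CompleteSpace F] :
    ‖g (x + w) - g x‖ₑ ^ 2 ≤
      ‖w‖ₑ ^ 2 * ∫⁻ t in Set.Icc (0 : ℝ) 1, ‖fderiv ℝ g (x + t • w)‖ₑ ^ 2 := by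
  have hfc : Continuous (fderiv ℝ g) := hg.continuous_fderiv (by simp)
  have hcont : Continuous fun t : ℝ => fderiv ℝ g (x + t • w) := by fun_prop
  have hderiv : ∀ t : ℝ, HasDerivAt (fun t : ℝ => g (x + t • w)) (fderiv ℝ g (x + t • w) w) t := by
    intro t
    have h1 : HasDerivAt (fun t : ℝ => x + t • w) w t := by
      simpa using ((hasDerivAt_id t).smul_const w).const_add x
    exact ((hg.differentiable (by simp)) (x + t • w)).hasFDerivAt.comp_hasDerivAt t h1
  have hInt := intervalIntegral.integral_eq_sub_of_hasDerivAt (a := 0) (b := 1)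
    (fun t _ => hderiv t) ((hcont.clm_apply continuous_const).intervalIntegrable _ _)
  simp only [one_smul, zero_smul, add_zero] at hInt
  rw [← hInt, intervalIntegral.integral_of_le zero_le_one, ← integral_Icc_eq_integral_Ioc]
  have h1 : ‖∫ t in Set.Icc (0 : ℝ) 1, fderiv ℝ g (x + t • w) w‖ₑ ≤
      ∫⁻ t in Set.Icc (0 : ℝ) 1, ‖fderiv ℝ g (x + t • w)‖ₑ * ‖w‖ₑ :=
    (enorm_integral_le_lintegral_enorm _).trans
      (lintegral_mono fun t => (fderiv ℝ g (x + t • w)).le_opENorm w)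
  have hm : Measurable fun t : ℝ => ‖fderiv ℝ g (x + t • w)‖ₑ := hcont.enorm.measurable
  calc _ ≤ _ := pow_le_pow_left' h1 2
    _ ≤ _ := sq_lintegral_le (hm.mul_const _).aemeasurable
    _ = _ := by
      simp only [mul_pow, MeasurableSet.univ, Measure.restrict_apply, Set.univ_inter,
        Real.volume_Icc, sub_zero, ENNReal.ofReal_one, one_mul]
      rw [lintegral_mul_const _ (hm.pow_const 2), mul_comm]

lemma lintegral_comp_smul_add (f : E3 → ℝ≥0∞) (hf : Measurable f) {c : ℝ} (hc : 0 < c) (v : E3) :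
    ∫⁻ w, f (c • w + v) = ENNReal.ofReal ((c ^ 3)⁻¹) * ∫⁻ w, f w := by
  have h1 := lintegral_map (μ := (volume : Measure E3)) (f := fun w => f (w + v))
    (g := fun w => c • w) (hf.comp (measurable_id.add_const v)) (measurable_const_smul c)
  rw [← h1, Measure.map_addHaar_smul _ hc.ne', lintegral_smul_measure,
    lintegral_add_right_eq_self (μ := (volume : Measure E3)) f v]
  simp [abs_of_pos hc]

lemma setLIntegral_ball_comp_le {f : E3 → ℝ≥0∞} (hf : Measurable f) {x z : E3} {r c : ℝ}
    (hz : z ∈ Metric.ball x r) (hc : 1 / 2 ≤ c) (hc1 : c ≤ 1) :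
    ∫⁻ w in Metric.ball x r, f (c • w + (1 - c) • z) ≤ 8 * ∫⁻ w in Metric.ball x r, f w := by
  have hb : MeasurableSet (Metric.ball x r) := Metric.isOpen_ball.measurableSet
  rw [← lintegral_indicator hb, ← lintegral_indicator hb]
  calc _ ≤ ∫⁻ w, (Metric.ball x r).indicator f (c • w + (1 - c) • z) := by
        refine lintegral_mono fun w => ?_
        by_cases hw : w ∈ Metric.ball x r
        · have : c • w + (1 - c) • z ∈ Metric.ball x r :=
            convex_ball x r hw hz (by linarith) (by linarith) (by ring)
          simp [Set.indicator_of_mem, hw, this]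
        · simp [hw]
    _ = _ := lintegral_comp_smul_add _ (hf.indicator hb) (by linarith) _
    _ ≤ _ := by
      gcongr
      rw [← ENNReal.ofReal_ofNat]
      apply ENNReal.ofReal_le_ofReal
      rw [inv_le_comm₀ (by positivity) (by norm_num)]
      calc (8 : ℝ)⁻¹ = (1 / 2) ^ 3 := by norm_num
        _ ≤ c ^ 3 := by gcongr

/-- Poincaré inequality on a ball, with the average replaced by a suitable constant. -/
lemma exists_poincare [CompleteSpace F] {g : E3 → F} (hg : ContDiff ℝ 1 g) (x : E3) {r : ℝ}
    (hr : 0 < r) :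
    ∃ a : F, ∫⁻ w in Metric.ball x r, ‖g w - a‖ₑ ^ 2 ≤
      ENNReal.ofReal (32 * r ^ 2) * ∫⁻ w in Metric.ball x r, ‖fderiv ℝ g w‖ₑ ^ 2 := by
  set B := Metric.ball x r with hB
  have hBm : MeasurableSet B := Metric.isOpen_ball.measurableSet
  set h : E3 → ℝ≥0∞ := fun w => ‖fderiv ℝ g w‖ₑ ^ 2 with hh
  have hfc : Continuous (fderiv ℝ g) := hg.continuous_fderiv (by simp)
  have hhc : Continuous h := (ENNReal.continuous_pow 2).comp hfc.enorm
  set H := ∫⁻ w in B, h w with hH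
  have hpair : ∀ t ∈ Set.Icc (0 : ℝ) 1, ∫⁻ z in B, ∫⁻ w in B, h (z + t • (w - z)) ≤
      8 * volume B * H := by
    intro t ht
    by_cases ht2 : 1 / 2 ≤ t
    · calc _ ≤ ∫⁻ z in B, 8 * H := by
            refine setLIntegral_mono' hBm fun z hz => ?_
            have := setLIntegral_ball_comp_le hhc.measurable hz ht2 ht.2
            convert this using 4 with w
            module
        _ = _ := by simp; ring
    · rw [lintegral_lintegral_swap]
      · calc _ ≤ ∫⁻ w in B, 8 * H := by
              refine setLIntegral_mono' hBm fun w hw => ?_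
              have := setLIntegral_ball_comp_le hhc.measurable hw (c := 1 - t)
                (by linarith) (by linarith [ht.1])
              convert this using 4 with z
              module
          _ = _ := by simp; ring
      · exact Continuous.aemeasurable (by unfold Function.uncurry; fun_prop)
  have hdouble : ∫⁻ z in B, ∫⁻ w in B, ‖g w - g z‖ₑ ^ 2 ≤
      volume B * (ENNReal.ofReal (32 * r ^ 2) * H) := by
    calc _ ≤ ∫⁻ z in B, ∫⁻ w in B, ENNReal.ofReal (4 * r ^ 2) *
          ∫⁻ t in Set.Icc (0 : ℝ) 1, h (z + t • (w - z)) := by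
          refine setLIntegral_mono' hBm fun z hz => setLIntegral_mono' hBm fun w hw => ?_
          have h1 := enorm_sub_sq_le_lintegral hg z (w - z)
          rw [add_sub_cancel] at h1
          refine h1.trans ?_
          gcongr
          rw [← ofReal_norm, ← ENNReal.ofReal_pow (norm_nonneg _)]
          apply ENNReal.ofReal_le_ofReal
          have : ‖w - z‖ ≤ 2 * r := by
            have h2 := Metric.mem_ball.1 hz
            have h3 := Metric.mem_ball.1 hw
            rw [← dist_eq_norm]
            linarith [dist_triangle_right w z x]
          calc ‖w - z‖ ^ 2 ≤ (2 * r) ^ 2 := by gcongr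
            _ = _ := by ring
      _ = ENNReal.ofReal (4 * r ^ 2) *
          ∫⁻ t in Set.Icc (0 : ℝ) 1, ∫⁻ z in B, ∫⁻ w in B, h (z + t • (w - z)) := by
          have c1 : Continuous fun p : (E3 × ℝ) × E3 => h (p.1.1 + p.1.2 • (p.2 - p.1.1)) := by
            fun_prop
          have c2 : Continuous fun p : (E3 × E3) × ℝ => h (p.1.1 + p.2 • (p.1.2 - p.1.1)) := by
            fun_prop
          have e1 : ∀ z, ∫⁻ w in B, ENNReal.ofReal (4 * r ^ 2) *
              ∫⁻ t in Set.Icc (0 : ℝ) 1, h (z + t • (w - z)) = ENNReal.ofReal (4 * r ^ 2) *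
              ∫⁻ t in Set.Icc (0 : ℝ) 1, ∫⁻ w in B, h (z + t • (w - z)) := by
            intro z
            rw [lintegral_const_mul]
            · congr 1
              exact lintegral_lintegral_swap
                (Continuous.aemeasurable (by unfold Function.uncurry; fun_prop))
            · exact (c2.measurable.comp (g := fun p : (E3 × E3) × ℝ => _) (f := fun p : E3 × ℝ =>
                ((z, p.1), p.2)) (by fun_prop)).lintegral_prod_right'
          simp_rw [e1]
          rw [lintegral_const_mul]
          · congr 1
            refine lintegral_lintegral_swap ?_
            exact (c1.measurable.lintegral_prod_right').aemeasurable
          · exact (c1.measurable.lintegral_prod_right').lintegral_prod_right'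
      _ ≤ ENNReal.ofReal (4 * r ^ 2) * ∫⁻ t in Set.Icc (0 : ℝ) 1, 8 * volume B * H := by
          exact mul_le_mul' le_rfl (setLIntegral_mono' measurableSet_Icc hpair)
      _ = _ := by
          rw [show 32 * r ^ 2 = 4 * r ^ 2 * 8 by ring,
            ENNReal.ofReal_mul (p := 4 * r ^ 2) (by positivity), ENNReal.ofReal_ofNat]
          generalize ENNReal.ofReal (4 * r ^ 2) = q
          simp; ring
  have hB0 : volume B ≠ 0 := (Metric.measure_ball_pos volume x hr).ne'
  have hBt : volume B ≠ ∞ := measure_ball_lt_top.ne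
  obtain ⟨z, -, hz⟩ := exists_le_setLAverage (μ := volume) (s := B)
    (f := fun z => ∫⁻ w in B, ‖g w - g z‖ₑ ^ 2) hB0 hBt (by
      have c3 : Continuous fun p : E3 × E3 => ‖g p.2 - g p.1‖ₑ ^ 2 := by
        have := hg.continuous
        exact (ENNReal.continuous_pow 2).comp (Continuous.enorm (by fun_prop))
      exact (c3.measurable.lintegral_prod_right').aemeasurable)
  refine ⟨g z, hz.trans ?_⟩
  rw [setLAverage_eq]
  exact ENNReal.div_le_of_le_mul' hdouble

end Estimates

section Sobolev

variable {F : Type*} [NormedAddCommGroup F] [NormedSpace ℝ F]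

/-- The squared length of the gradient, as an extended nonnegative real. -/
def gradNormSq (u : E3 → F) (x : E3) : ℝ≥0∞ := ∑ k, ‖pd k u x‖ₑ ^ 2

lemma sq_sum_le_card_mul {ι : Type*} [Fintype ι] (a : ι → ℝ≥0∞) :
    (∑ i, a i) ^ 2 ≤ Fintype.card ι * ∑ i, a i ^ 2 := by
  let _ : MeasurableSpace ι := ⊤
  have h := sq_lintegral_le (μ := Measure.count) (f := a) (measurable_of_finite a).aemeasurable
  simpa [lintegral_count, tsum_fintype, Measure.count_univ] using h

lemma enorm_fderiv_sq_le (u : E3 → F) (x : E3) :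
    ‖fderiv ℝ u x‖ₑ ^ 2 ≤ 3 * gradNormSq u x := by
  have h1 : ‖fderiv ℝ u x‖ₑ ≤ ∑ k, ‖pd k u x‖ₑ := by
    have h : ‖fderiv ℝ u x‖ ≤ ∑ k, ‖pd k u x‖ := by
      refine ContinuousLinearMap.opNorm_le_bound _ (by positivity) fun v => ?_
      have hv : v = ∑ k, v k • (Pi.single k (1 : ℝ) : E3) := by
        ext i; simp [Finset.sum_apply, Pi.single_apply]
      conv_lhs => rw [hv, map_sum]
      calc _ ≤ ∑ k, ‖fderiv ℝ u x (v k • (Pi.single k (1 : ℝ) : E3))‖ := norm_sum_le _ _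
        _ ≤ ∑ k, ‖pd k u x‖ * ‖v‖ := by
          refine Finset.sum_le_sum fun k _ => ?_
          rw [map_smul, norm_smul, mul_comm]
          exact mul_le_mul_of_nonneg_left (norm_le_pi_norm v k) (norm_nonneg _)
        _ = _ := by rw [Finset.sum_mul]
    have h2 := ENNReal.ofReal_le_ofReal h
    rw [ENNReal.ofReal_sum_of_nonneg (fun _ _ => norm_nonneg _)] at h2
    simpa only [ofReal_norm] using h2
  calc _ ≤ (∑ k, ‖pd k u x‖ₑ) ^ 2 := pow_le_pow_left' h1 2
    _ ≤ _ := by simpa [gradNormSq] using sq_sum_le_card_mul fun k => ‖pd k u x‖ₑ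

lemma exists_sobolev (F : Type*) [NormedAddCommGroup F] [NormedSpace ℝ F]
    [FiniteDimensional ℝ F] :
    ∃ K : ℝ≥0, ∀ u : E3 → F, ContDiff ℝ 1 u → HasCompactSupport u →
      (∫⁻ x, ‖u x‖ₑ ^ 6) ^ (1 / 6 : ℝ) ≤ K * (∫⁻ x, ‖fderiv ℝ u x‖ₑ ^ 2) ^ (1 / 2 : ℝ) := by
  refine ⟨SNormLESNormFDerivOfEqConst F (volume : Measure E3) (2 : ℝ≥0), fun u hu hc => ?_⟩
  have h := eLpNorm_le_eLpNorm_fderiv_of_eq (μ := (volume : Measure E3)) (F := F) hu hc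
    (p := 2) (p' := 6) (by norm_num) (by simp) (by simp; norm_num)
  rw [eLpNorm_nnreal_eq_lintegral (by norm_num), eLpNorm_nnreal_eq_lintegral (by norm_num)] at h
  have e6 : ∀ x : ℝ≥0∞, x ^ (((6 : ℝ≥0) : ℝ)) = x ^ 6 := fun x => by
    rw [← ENNReal.rpow_natCast]; norm_num
  have e2 : ∀ x : ℝ≥0∞, x ^ (((2 : ℝ≥0) : ℝ)) = x ^ 2 := fun x => by
    rw [← ENNReal.rpow_natCast]; norm_num
  simp only [e6, e2] at h
  simpa using h

lemma exists_sobolev_gradNormSq (F : Type*) [NormedAddCommGroup F] [NormedSpace ℝ F]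
    [FiniteDimensional ℝ F] :
    ∃ K : ℝ≥0, ∀ u : E3 → F, ContDiff ℝ 1 u → HasCompactSupport u →
      (∫⁻ x, ‖u x‖ₑ ^ 6) ^ (1 / 6 : ℝ) ≤ K * (∫⁻ x, gradNormSq u x) ^ (1 / 2 : ℝ) := by
  obtain ⟨K, hK⟩ := exists_sobolev F
  refine ⟨K * 3 ^ (1 / 2 : ℝ), fun u hu hc => (hK u hu hc).trans ?_⟩
  have hle : ∫⁻ x, ‖fderiv ℝ u x‖ₑ ^ 2 ≤ 3 * ∫⁻ x, gradNormSq u x := by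
    rw [← lintegral_const_mul' _ _ (by simp)]
    exact lintegral_mono fun x => enorm_fderiv_sq_le u x
  calc _ ≤ K * (3 * ∫⁻ x, gradNormSq u x) ^ (1 / 2 : ℝ) := by gcongr
    _ = _ := by
      rw [ENNReal.mul_rpow_of_nonneg _ _ (by norm_num), ← mul_assoc]
      congr 2
      rw [ENNReal.coe_mul, ENNReal.coe_rpow_of_nonneg _ (by norm_num)]
      simp

lemma rpow_mul_sq_aux (x : ℝ≥0∞) : (x ^ 2) ^ (1 / 2 : ℝ) * (x ^ 6) ^ (1 / 6 : ℝ) = x ^ 2 := by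
  rw [← ENNReal.rpow_natCast, ← ENNReal.rpow_natCast, ← ENNReal.rpow_mul, ← ENNReal.rpow_mul]
  norm_num
  rw [sq]

/-- Interpolated weighted Sobolev inequality with a weight in `L³`. -/
lemma lintegral_rpow_third_mul_le {K : ℝ≥0} {Q : E3 → ℝ≥0∞} (hQ : Measurable Q)
    {u : E3 → ℂ} (hu : ContDiff ℝ 1 u)
    (hK : (∫⁻ x, ‖u x‖ₑ ^ 6) ^ (1 / 6 : ℝ) ≤ K * (∫⁻ x, gradNormSq u x) ^ (1 / 2 : ℝ)) :
    ∫⁻ x, Q x ^ (1 / 3 : ℝ) * ‖u x‖ₑ ^ 2 ≤ K * (∫⁻ x, Q x) ^ (1 / 3 : ℝ) *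
      ((∫⁻ x, ‖u x‖ₑ ^ 2) ^ (1 / 2 : ℝ) * (∫⁻ x, gradNormSq u x) ^ (1 / 2 : ℝ)) := by
  have hm : Measurable fun x => ‖u x‖ₑ := hu.continuous.enorm.measurable
  have h := ENNReal.lintegral_prod_norm_pow_le (μ := (volume : Measure E3)) Finset.univ
    (f := ![Q, fun x => ‖u x‖ₑ ^ 2, fun x => ‖u x‖ₑ ^ 6]) (p := ![1 / 3, 1 / 2, 1 / 6])
    (by
      intro i _
      fin_cases i
      · exact hQ.aemeasurable
      · exact (hm.pow_const 2).aemeasurable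
      · exact (hm.pow_const 6).aemeasurable)
    (by simp [Fin.sum_univ_three]; norm_num)
    (by intro i _; fin_cases i <;> norm_num)
  simp only [Fin.prod_univ_three, Matrix.cons_val_zero, Matrix.cons_val_one, Matrix.cons_val,
    mul_assoc, rpow_mul_sq_aux] at h
  refine h.trans ?_
  calc _ ≤ (∫⁻ x, Q x) ^ (1 / 3 : ℝ) * ((∫⁻ x, ‖u x‖ₑ ^ 2) ^ (1 / 2 : ℝ) *
        (K * (∫⁻ x, gradNormSq u x) ^ (1 / 2 : ℝ))) := by gcongr
    _ = _ := by ring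

/-- Weighted Sobolev inequality with a weight in `L^{3/2}`. -/
lemma lintegral_rpow_two_thirds_mul_le {K : ℝ≥0} {Q : E3 → ℝ≥0∞} (hQ : Measurable Q)
    {u : E3 → ℂ} (hu : ContDiff ℝ 1 u)
    (hK : (∫⁻ x, ‖u x‖ₑ ^ 6) ^ (1 / 6 : ℝ) ≤ K * (∫⁻ x, gradNormSq u x) ^ (1 / 2 : ℝ)) :
    ∫⁻ x, Q x ^ (2 / 3 : ℝ) * ‖u x‖ₑ ^ 2 ≤ K ^ 2 * (∫⁻ x, Q x) ^ (2 / 3 : ℝ) *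
      ∫⁻ x, gradNormSq u x := by
  have hm : Measurable fun x => ‖u x‖ₑ := hu.continuous.enorm.measurable
  have h := ENNReal.lintegral_mul_norm_pow_le (μ := (volume : Measure E3)) hQ.aemeasurable
    (hm.pow_const 6).aemeasurable (p := 2 / 3) (q := 1 / 3) (by norm_num) (by norm_num)
    (by norm_num)
  have e : ∀ x : ℝ≥0∞, (x ^ 6) ^ (1 / 3 : ℝ) = x ^ 2 := fun x => by
    rw [← ENNReal.rpow_natCast, ← ENNReal.rpow_natCast, ← ENNReal.rpow_mul]; norm_num
  have e' : ∀ x : ℝ≥0∞, x ^ (1 / 3 : ℝ) = (x ^ (1 / 6 : ℝ)) ^ 2 := fun x => by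
    rw [← ENNReal.rpow_natCast, ← ENNReal.rpow_mul]; norm_num
  have e'' : ∀ x : ℝ≥0∞, (x ^ (1 / 2 : ℝ)) ^ 2 = x := fun x => by
    rw [← ENNReal.rpow_natCast, ← ENNReal.rpow_mul]; norm_num
  simp only [e] at h
  refine h.trans ?_
  rw [e']
  calc _ ≤ (∫⁻ x, Q x) ^ (2 / 3 : ℝ) * (K * (∫⁻ x, gradNormSq u x) ^ (1 / 2 : ℝ)) ^ 2 := by gcongr
    _ = _ := by rw [mul_pow, e'']; ring

end Sobolev

section Family

variable {Y : Type*} [MeasurableSpace Y] {μ : Measure Y}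

/-- Weighted Sobolev inequality for a measurable family of functions. -/
lemma lintegral_family_rpow_third_mul_le {K : ℝ≥0}
    (hK : ∀ u : E3 → ℂ, ContDiff ℝ 1 u → HasCompactSupport u →
      (∫⁻ x, ‖u x‖ₑ ^ 6) ^ (1 / 6 : ℝ) ≤ K * (∫⁻ x, gradNormSq u x) ^ (1 / 2 : ℝ))
    {Q : E3 → ℝ≥0∞} (hQ : Measurable Q) {f : Y → E3 → ℂ}
    (hf : ∀ y, ContDiff ℝ 1 (f y)) (hc : ∀ y, HasCompactSupport (f y))
    (hm : Measurable fun p : Y × E3 => f p.1 p.2)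
    (hm' : ∀ k, Measurable fun p : Y × E3 => pd k (f p.1) p.2) :
    ∫⁻ y, (∫⁻ x, Q x ^ (1 / 3 : ℝ) * ‖f y x‖ₑ ^ 2) ∂μ ≤ K * (∫⁻ x, Q x) ^ (1 / 3 : ℝ) *
      ((∫⁻ y, (∫⁻ x, ‖f y x‖ₑ ^ 2) ∂μ) ^ (1 / 2 : ℝ) *
        (∫⁻ y, (∫⁻ x, gradNormSq (f y) x) ∂μ) ^ (1 / 2 : ℝ)) := by
  have m1 : Measurable fun y => ∫⁻ x, ‖f y x‖ₑ ^ 2 :=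
    Measurable.lintegral_prod_right' (f := fun p : Y × E3 => ‖f p.1 p.2‖ₑ ^ 2)
      (hm.enorm.pow_const 2)
  have m2 : Measurable fun y => ∫⁻ x, gradNormSq (f y) x :=
    Measurable.lintegral_prod_right' (f := fun p : Y × E3 => gradNormSq (f p.1) p.2)
      (Finset.measurable_sum _ fun k _ => (hm' k).enorm.pow_const 2)
  calc _ ≤ ∫⁻ y, K * (∫⁻ x, Q x) ^ (1 / 3 : ℝ) *
        ((∫⁻ x, ‖f y x‖ₑ ^ 2) ^ (1 / 2 : ℝ) * (∫⁻ x, gradNormSq (f y) x) ^ (1 / 2 : ℝ)) ∂μ :=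
        lintegral_mono fun y => lintegral_rpow_third_mul_le hQ (hf y) (hK _ (hf y) (hc y))
    _ = K * (∫⁻ x, Q x) ^ (1 / 3 : ℝ) * ∫⁻ y,
        ((∫⁻ x, ‖f y x‖ₑ ^ 2) ^ (1 / 2 : ℝ) * (∫⁻ x, gradNormSq (f y) x) ^ (1 / 2 : ℝ)) ∂μ :=
        lintegral_const_mul _ ((m1.pow_const _).mul (m2.pow_const _))
    _ ≤ _ := by
      gcongr
      exact ENNReal.lintegral_mul_norm_pow_le m1.aemeasurable m2.aemeasurable
        (by norm_num) (by norm_num) (by norm_num)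

lemma lintegral_family_rpow_two_thirds_mul_le {K : ℝ≥0}
    (hK : ∀ u : E3 → ℂ, ContDiff ℝ 1 u → HasCompactSupport u →
      (∫⁻ x, ‖u x‖ₑ ^ 6) ^ (1 / 6 : ℝ) ≤ K * (∫⁻ x, gradNormSq u x) ^ (1 / 2 : ℝ))
    {Q : E3 → ℝ≥0∞} (hQ : Measurable Q) {f : Y → E3 → ℂ}
    (hf : ∀ y, ContDiff ℝ 1 (f y)) (hc : ∀ y, HasCompactSupport (f y))
    (hm' : ∀ k, Measurable fun p : Y × E3 => pd k (f p.1) p.2) :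
    ∫⁻ y, (∫⁻ x, Q x ^ (2 / 3 : ℝ) * ‖f y x‖ₑ ^ 2) ∂μ ≤ K ^ 2 * (∫⁻ x, Q x) ^ (2 / 3 : ℝ) *
      ∫⁻ y, (∫⁻ x, gradNormSq (f y) x) ∂μ := by
  have m2 : Measurable fun y => ∫⁻ x, gradNormSq (f y) x :=
    Measurable.lintegral_prod_right' (f := fun p : Y × E3 => gradNormSq (f p.1) p.2)
      (Finset.measurable_sum _ fun k _ => (hm' k).enorm.pow_const 2)
  rw [← lintegral_const_mul _ m2]
  exact lintegral_mono fun y => lintegral_rpow_two_thirds_mul_le hQ (hf y) (hK _ (hf y) (hc y))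

end Family

section Exclusion

lemma setLIntegral_enorm_sq_le_average {k : E3 → ℝ} (hk : Continuous k) (hkc : HasCompactSupport k)
    (hk0 : ∀ w, 0 ≤ k w) (hk1 : ∫ w, k w = 1) {δ : ℝ} (hks : ∀ w, k w ≠ 0 → ‖w‖ ≤ δ)
    {u : E3 → ℂ} (hu : ContDiff ℝ 1 u) (B : Set E3) :
    ∫⁻ z in B, ‖u z‖ₑ ^ 2 ≤ 2 * (∫⁻ z in B, ‖∫ w, (k (w - z) : ℂ) * u w‖ₑ ^ 2) +
      2 * ENNReal.ofReal (δ ^ 2) * ∫⁻ z, ‖fderiv ℝ u z‖ₑ ^ 2 := by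
  have huc := hu.continuous
  have hfc : Continuous (fderiv ℝ u) := hu.continuous_fderiv (by simp)
  have hkm : Measurable fun w => ENNReal.ofReal (k w) := hk.measurable.ennreal_ofReal
  have hkint : ∫⁻ w, ENNReal.ofReal (k w) = 1 := by
    rw [← ofReal_integral_eq_lintegral_ofReal (hk.integrable_of_hasCompactSupport hkc)
      (ae_of_all _ hk0), hk1, ENNReal.ofReal_one]
  have havg : ∀ z, ∫ w, (k (w - z) : ℂ) * u w = ∫ w, (k w : ℂ) * u (z + w) := by
    intro z
    rw [← integral_add_left_eq_self (μ := (volume : Measure E3))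
      (fun w => (k (w - z) : ℂ) * u w) z]
    simp
  have hkC : HasCompactSupport fun w => (k w : ℂ) := hkc.comp_left (g := fun r : ℝ => (r : ℂ)) rfl
  have hkCc : Continuous fun w => (k w : ℂ) := Complex.continuous_ofReal.comp hk
  have hpt : ∀ z, ‖u z‖ₑ ^ 2 ≤ 2 * ‖∫ w, (k (w - z) : ℂ) * u w‖ₑ ^ 2 +
      2 * ∫⁻ w, ENNReal.ofReal (k w) * ‖u (z + w) - u z‖ₑ ^ 2 := by
    intro z
    have i1 : Integrable fun w => (k w : ℂ) * u (z + w) :=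
      Continuous.integrable_of_hasCompactSupport (by fun_prop) hkC.mul_right
    have i2 : Integrable fun w => (k w : ℂ) * u z :=
      Continuous.integrable_of_hasCompactSupport (by fun_prop) hkC.mul_right
    have hz : u z = (∫ w, (k w : ℂ) * u (z + w)) - ∫ w, (k w : ℂ) * (u (z + w) - u z) := by
      have h1 : ∫ w, (k w : ℂ) * (u (z + w) - u z) =
          (∫ w, (k w : ℂ) * u (z + w)) - ∫ w, (k w : ℂ) * u z := by
        rw [← integral_sub i1 i2]; congr 1; ext w; ring
      have h2 : ∫ w, (k w : ℂ) * u z = u z := by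
        rw [integral_mul_const, integral_complex_ofReal, hk1]; simp
      rw [h1, h2]; ring
    have h3 : ‖∫ w, (k w : ℂ) * (u (z + w) - u z)‖ₑ ^ 2 ≤
        ∫⁻ w, ENNReal.ofReal (k w) * ‖u (z + w) - u z‖ₑ ^ 2 := by
      have hv : Measurable fun w => ‖u (z + w) - u z‖ₑ :=
        (Continuous.enorm (by fun_prop)).measurable
      have h4 := sq_lintegral_le (μ := volume.withDensity fun w => ENNReal.ofReal (k w))
        hv.aemeasurable
      rw [withDensity_apply _ MeasurableSet.univ, Measure.restrict_univ, hkint, one_mul,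
        lintegral_withDensity_eq_lintegral_mul _ hkm hv,
        lintegral_withDensity_eq_lintegral_mul _ hkm (hv.pow_const 2)] at h4
      refine (pow_le_pow_left' (enorm_integral_le_lintegral_enorm _) 2).trans ?_
      refine le_of_eq_of_le ?_ h4
      congr 2
      ext w
      rw [enorm_mul, Pi.mul_apply]
      congr 1
      rw [← ofReal_norm, Complex.norm_real, Real.norm_of_nonneg (hk0 w)]
    have h5 : ‖u z‖ₑ ^ 2 ≤ 2 * (‖∫ w, (k w : ℂ) * u (z + w)‖ₑ ^ 2 +
        ‖∫ w, (k w : ℂ) * (u (z + w) - u z)‖ₑ ^ 2) := by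
      conv_lhs => rw [hz]
      refine (pow_le_pow_left' enorm_sub_le 2).trans ?_
      simpa using sq_sum_le_card_mul ![‖∫ w, (k w : ℂ) * u (z + w)‖ₑ,
        ‖∫ w, (k w : ℂ) * (u (z + w) - u z)‖ₑ]
    rw [havg]
    refine h5.trans ?_
    rw [mul_add]
    gcongr
  have hdiff : ∫⁻ z, ∫⁻ w, ENNReal.ofReal (k w) * ‖u (z + w) - u z‖ₑ ^ 2 ≤
      ENNReal.ofReal (δ ^ 2) * ∫⁻ z, ‖fderiv ℝ u z‖ₑ ^ 2 := by
    rw [lintegral_lintegral_swap (Measurable.aemeasurable (by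
      unfold Function.uncurry
      exact (hkm.comp measurable_snd).mul
        ((Continuous.enorm (by fun_prop)).measurable.pow_const 2)))]
    calc _ ≤ ∫⁻ w, ENNReal.ofReal (k w) *
          (ENNReal.ofReal (δ ^ 2) * ∫⁻ z, ‖fderiv ℝ u z‖ₑ ^ 2) := by
          refine lintegral_mono fun w => ?_
          by_cases hw : k w = 0
          · simp [hw]
          rw [lintegral_const_mul _ ((Continuous.enorm (by fun_prop)).measurable.pow_const 2)]
          gcongr
          calc _ ≤ ∫⁻ z, ‖w‖ₑ ^ 2 * ∫⁻ t in Set.Icc (0 : ℝ) 1, ‖fderiv ℝ u (z + t • w)‖ₑ ^ 2 :=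
                lintegral_mono fun z => enorm_sub_sq_le_lintegral hu z w
            _ = ‖w‖ₑ ^ 2 * ∫⁻ z, ∫⁻ t in Set.Icc (0 : ℝ) 1, ‖fderiv ℝ u (z + t • w)‖ₑ ^ 2 :=
                lintegral_const_mul' _ _ (by finiteness)
            _ = ‖w‖ₑ ^ 2 * ∫⁻ t in Set.Icc (0 : ℝ) 1, ∫⁻ z, ‖fderiv ℝ u (z + t • w)‖ₑ ^ 2 := by
                rw [lintegral_lintegral_swap (Measurable.aemeasurable (by
                  unfold Function.uncurry
                  exact ((Continuous.enorm (by fun_prop)).measurable.pow_const 2)))]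
            _ = ‖w‖ₑ ^ 2 * ∫⁻ z, ‖fderiv ℝ u z‖ₑ ^ 2 := by
                congr 1
                simp_rw [lintegral_add_right_eq_self (μ := (volume : Measure E3))
                  (fun z => ‖fderiv ℝ u z‖ₑ ^ 2)]
                simp
            _ ≤ _ := by
                gcongr
                rw [← ofReal_norm, ← ENNReal.ofReal_pow (norm_nonneg _)]
                exact ENNReal.ofReal_le_ofReal (by have := hks w hw; gcongr)
      _ = _ := by rw [lintegral_mul_const _ hkm, hkint, one_mul]
  have hmeas : Measurable fun z => ∫⁻ w, ENNReal.ofReal (k w) * ‖u (z + w) - u z‖ₑ ^ 2 :=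
    Measurable.lintegral_prod_right' (f := fun p : E3 × E3 =>
      ENNReal.ofReal (k p.2) * ‖u (p.1 + p.2) - u p.1‖ₑ ^ 2)
      ((hkm.comp measurable_snd).mul ((Continuous.enorm (by fun_prop)).measurable.pow_const 2))
  calc _ ≤ ∫⁻ z in B, (2 * ‖∫ w, (k (w - z) : ℂ) * u w‖ₑ ^ 2 +
        2 * ∫⁻ w, ENNReal.ofReal (k w) * ‖u (z + w) - u z‖ₑ ^ 2) := lintegral_mono hpt
    _ = 2 * (∫⁻ z in B, ‖∫ w, (k (w - z) : ℂ) * u w‖ₑ ^ 2) +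
        2 * ∫⁻ z in B, ∫⁻ w, ENNReal.ofReal (k w) * ‖u (z + w) - u z‖ₑ ^ 2 := by
        rw [lintegral_add_right _ (hmeas.const_mul 2), lintegral_const_mul' _ _ (by simp),
          lintegral_const_mul' _ _ (by simp)]
    _ ≤ _ := by
        rw [mul_assoc]
        gcongr
        exact (setLIntegral_le_lintegral _ _).trans hdiff

variable {Y : Type*} [MeasurableSpace Y] {μ : Measure Y}

/-- The exclusion estimate: a family satisfying Bessel's inequality has little mass on a set,
unless its gradient is large. -/
lemma lintegral_family_sq_le_of_bessel [SFinite μ] {f : Y → E3 → ℂ}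
    (hf : ∀ y, ContDiff ℝ 1 (f y)) (hm : Measurable fun p : Y × E3 => f p.1 p.2)
    (hm' : ∀ k, Measurable fun p : Y × E3 => pd k (f p.1) p.2)
    (hb : ∀ g : E3 → ℂ, Continuous g → HasCompactSupport g →
      ∫⁻ y, ‖∫ x, g x * f y x‖ₑ ^ 2 ∂μ ≤ ∫⁻ x, ‖g x‖ₑ ^ 2)
    (B : Set E3) {δ : ℝ} (hδ : 0 < δ) :
    ∫⁻ y, (∫⁻ x in B, ‖f y x‖ₑ ^ 2) ∂μ ≤ 2 * (ENNReal.ofReal ((δ ^ 3)⁻¹) * volume B) +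
      6 * ENNReal.ofReal (δ ^ 2) * ∫⁻ y, (∫⁻ x, gradNormSq (f y) x) ∂μ := by
  let η : ContDiffBump (0 : E3) := ⟨δ / 2, δ, by positivity, by linarith⟩
  set k : E3 → ℝ := η.normed volume with hk
  have hkcont : Continuous k := η.continuous_normed
  have hkc : HasCompactSupport k := η.hasCompactSupport_normed
  have hk0 : ∀ w, 0 ≤ k w := fun w => η.nonneg_normed w
  have hk1 : ∫ w, k w = 1 := η.integral_normed
  have hks : ∀ w, k w ≠ 0 → ‖w‖ ≤ δ := by
    intro w hw
    have : w ∈ Function.support k := hw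
    rw [hk, η.support_normed_eq] at this
    simpa using (Metric.mem_ball.1 this).le
  have hkle : ∀ w, k w ≤ (δ ^ 3)⁻¹ := by
    intro w
    refine (η.normed_le_div_measure_closedBall_rIn volume w).trans ?_
    have : volume.real (Metric.closedBall (0 : E3) η.rIn) = δ ^ 3 := by
      rw [Measure.real, Real.volume_pi_closedBall _ η.rIn_pos.le]
      rw [ENNReal.toReal_ofReal (by have := η.rIn_pos; positivity)]
      change (2 * (δ / 2)) ^ _ = _
      rw [Fintype.card_fin]
      ring
    rw [this, one_div]
  have hcard : ∀ z, ∫⁻ w, ‖(k (w - z) : ℂ)‖ₑ ^ 2 ≤ ENNReal.ofReal ((δ ^ 3)⁻¹) := by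
    intro z
    calc _ = ∫⁻ w, ‖(k w : ℂ)‖ₑ ^ 2 :=
          lintegral_sub_right_eq_self (μ := (volume : Measure E3)) (fun w => ‖(k w : ℂ)‖ₑ ^ 2) z
      _ ≤ ∫⁻ w, ENNReal.ofReal ((δ ^ 3)⁻¹) * ENNReal.ofReal (k w) := by
          refine lintegral_mono fun w => ?_
          rw [← ofReal_norm, Complex.norm_real, Real.norm_of_nonneg (hk0 w), sq]
          gcongr
          exact hkle w
      _ = _ := by
          rw [lintegral_const_mul' _ _ ENNReal.ofReal_ne_top,
            ← ofReal_integral_eq_lintegral_ofReal (hkcont.integrable_of_hasCompactSupport hkc)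
              (ae_of_all _ hk0), hk1, ENNReal.ofReal_one, mul_one]
  have hbz : ∀ z, ∫⁻ y, ‖∫ w, (k (w - z) : ℂ) * f y w‖ₑ ^ 2 ∂μ ≤ ENNReal.ofReal ((δ ^ 3)⁻¹) := by
    intro z
    refine (hb (fun w => (k (w - z) : ℂ)) (by fun_prop) ?_).trans (hcard z)
    have h1 : HasCompactSupport fun w => k (w - z) :=
      hkc.comp_homeomorph (Homeomorph.subRight z)
    exact h1.comp_left (g := fun r : ℝ => (r : ℂ)) rfl
  have hma : Measurable fun p : Y × E3 => ∫ w, (k (w - p.2) : ℂ) * f p.1 w := by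
    refine StronglyMeasurable.measurable ?_
    refine StronglyMeasurable.integral_prod_right (f := fun (p : Y × E3) w =>
      (k (w - p.2) : ℂ) * f p.1 w) (Measurable.stronglyMeasurable ?_)
    unfold Function.uncurry
    refine Measurable.mul ?_ (hm.comp (by fun_prop : Measurable fun q : (Y × E3) × E3 =>
      (q.1.1, q.2)))
    exact (by fun_prop : Continuous fun w => (k w : ℂ)).measurable.comp
      (by fun_prop : Measurable fun q : (Y × E3) × E3 => q.2 - q.1.2)
  have m2 : Measurable fun y => ∫⁻ x, gradNormSq (f y) x :=
    Measurable.lintegral_prod_right' (f := fun p : Y × E3 => gradNormSq (f p.1) p.2)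
      (Finset.measurable_sum _ fun k _ => (hm' k).enorm.pow_const 2)
  calc _ ≤ ∫⁻ y, (2 * (∫⁻ z in B, ‖∫ w, (k (w - z) : ℂ) * f y w‖ₑ ^ 2) +
        6 * ENNReal.ofReal (δ ^ 2) * ∫⁻ z, gradNormSq (f y) z) ∂μ := by
        refine lintegral_mono fun y => ?_
        refine (setLIntegral_enorm_sq_le_average hkcont hkc hk0 hk1 hks (hf y) B).trans ?_
        refine add_le_add le_rfl ?_
        calc 2 * ENNReal.ofReal (δ ^ 2) * ∫⁻ z, ‖fderiv ℝ (f y) z‖ₑ ^ 2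
            ≤ 2 * ENNReal.ofReal (δ ^ 2) * ∫⁻ z, 3 * gradNormSq (f y) z := by
              gcongr
              exact enorm_fderiv_sq_le _ _
          _ = _ := by rw [lintegral_const_mul' _ _ (by simp)]; ring
    _ = 2 * (∫⁻ y, (∫⁻ z in B, ‖∫ w, (k (w - z) : ℂ) * f y w‖ₑ ^ 2) ∂μ) +
        6 * ENNReal.ofReal (δ ^ 2) * ∫⁻ y, (∫⁻ z, gradNormSq (f y) z) ∂μ := by
        rw [lintegral_add_right _ (m2.const_mul _), lintegral_const_mul' _ _ (by simp),
          lintegral_const_mul' _ _ (by finiteness)]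
    _ ≤ _ := by
        gcongr
        rw [lintegral_lintegral_swap (Measurable.aemeasurable (by
          unfold Function.uncurry
          exact hma.enorm.pow_const 2))]
        calc _ ≤ ∫⁻ z in B, ENNReal.ofReal ((δ ^ 3)⁻¹) := lintegral_mono hbz
          _ = _ := by simp

end Exclusion

section Gauge

/-- The Pauli operator `σ·(-i∇ + A)` acting on a two-component function. -/
def pauliOp (A : E3 → E3) (u : Fin 2 → E3 → ℂ) (s : Fin 2) (x : E3) : ℂ :=
  ∑ k, ∑ t, pauli k s t * (-Complex.I * pd k (u t) x + (A x k : ℂ) * u t x)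

/-- A localized and gauge-transformed function. -/
def gaugeLoc (a : E3) (η : E3 → ℝ) (u : E3 → ℂ) (x : E3) : ℂ :=
  ((η x : ℂ) * Complex.exp (Complex.I * ∑ k, ((a k * x k : ℝ) : ℂ))) * u x

lemma norm_pauli_le (k : Fin 3) (s t : Fin 2) : ‖pauli k s t‖ₑ ≤ 1 := by
  rw [← ofReal_norm, ENNReal.ofReal_le_one]
  fin_cases k <;> fin_cases s <;> fin_cases t <;> simp [pauli]

lemma enorm_pauli_sum_sq_le (c : E3) (v : Fin 2 → ℂ) (s : Fin 2) :
    ‖∑ k, ∑ t, pauli k s t * ((c k : ℂ) * v t)‖ₑ ^ 2 ≤ 18 * (‖c‖ₑ ^ 2 * ∑ t, ‖v t‖ₑ ^ 2) := by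
  have h1 : ‖∑ k, ∑ t, pauli k s t * ((c k : ℂ) * v t)‖ₑ ≤ 3 * ‖c‖ₑ * ∑ t, ‖v t‖ₑ := by
    calc _ ≤ ∑ k : Fin 3, ∑ t, ‖pauli k s t * ((c k : ℂ) * v t)‖ₑ :=
          (enorm_sum_le _ _).trans (Finset.sum_le_sum fun k _ => enorm_sum_le _ _)
      _ ≤ ∑ k : Fin 3, ∑ t, ‖c‖ₑ * ‖v t‖ₑ := by
          refine Finset.sum_le_sum fun k _ => Finset.sum_le_sum fun t _ => ?_
          rw [enorm_mul, enorm_mul]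
          have h2 : ‖(c k : ℂ)‖ₑ ≤ ‖c‖ₑ := by
            rw [← ofReal_norm, ← ofReal_norm, Complex.norm_real]
            exact ENNReal.ofReal_le_ofReal (norm_le_pi_norm c k)
          calc _ ≤ 1 * (‖c‖ₑ * ‖v t‖ₑ) := by
                gcongr
                exact norm_pauli_le k s t
            _ = _ := one_mul _
      _ = _ := by simp; ring
  calc _ ≤ (3 * ‖c‖ₑ * ∑ t, ‖v t‖ₑ) ^ 2 := pow_le_pow_left' h1 2
    _ = 9 * ‖c‖ₑ ^ 2 * (∑ t, ‖v t‖ₑ) ^ 2 := by ring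
    _ ≤ 9 * ‖c‖ₑ ^ 2 * (2 * ∑ t, ‖v t‖ₑ ^ 2) := by
        gcongr
        simpa using sq_sum_le_card_mul fun t => ‖v t‖ₑ
    _ = _ := by ring

lemma enorm_gaugeLoc (a : E3) (η : E3 → ℝ) (u : E3 → ℂ) (x : E3) :
    ‖gaugeLoc a η u x‖ₑ = ‖η x‖ₑ * ‖u x‖ₑ := by
  have h : ‖Complex.exp (Complex.I * ∑ k, ((a k * x k : ℝ) : ℂ))‖ₑ = 1 := by
    rw [← ofReal_norm, ← Complex.ofReal_sum, mul_comm, Complex.norm_exp_ofReal_mul_I]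
    simp
  have h2 : ‖(η x : ℂ)‖ₑ = ‖η x‖ₑ := by
    rw [← ofReal_norm, ← ofReal_norm, Complex.norm_real]
  rw [gaugeLoc, enorm_mul, enorm_mul, h, h2, mul_one]

lemma contDiff_phase (a : E3) :
    ContDiff ℝ (⊤ : ℕ∞) fun x : E3 => Complex.exp (Complex.I * ∑ k, ((a k * x k : ℝ) : ℂ)) := by
  have h : ContDiff ℝ (⊤ : ℕ∞) fun x : E3 => ∑ k, ((a k * x k : ℝ) : ℂ) :=
    ContDiff.sum fun k _ => Complex.ofRealCLM.contDiff.comp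
      (contDiff_const.mul (contDiff_apply ℝ ℝ k))
  exact (contDiff_const.mul h).cexp

lemma contDiff_gaugeLoc (a : E3) {η : E3 → ℝ} (hη : ContDiff ℝ (⊤ : ℕ∞) η) {u : E3 → ℂ}
    (hu : ContDiff ℝ (⊤ : ℕ∞) u) : ContDiff ℝ (⊤ : ℕ∞) (gaugeLoc a η u) :=
  ((Complex.ofRealCLM.contDiff.comp hη).mul (contDiff_phase a)).mul hu

lemma pd_phase (a : E3) (k : Fin 3) (x : E3) :
    pd k (fun x : E3 => Complex.exp (Complex.I * ∑ k, ((a k * x k : ℝ) : ℂ))) x =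
      Complex.exp (Complex.I * ∑ k, ((a k * x k : ℝ) : ℂ)) * (Complex.I * a k) := by
  let ℓ : E3 →L[ℝ] ℂ := ∑ k, a k • Complex.ofRealCLM.comp (ContinuousLinearMap.proj k)
  have hℓ : ∀ x, ℓ x = ∑ k, ((a k * x k : ℝ) : ℂ) := fun x => by
    simp [ℓ]
  have h : HasFDerivAt (fun x : E3 => Complex.I * ∑ k, ((a k * x k : ℝ) : ℂ))
      (Complex.I • ℓ) x := by
    simp only [← hℓ]
    exact ℓ.hasFDerivAt.const_mul Complex.I
  rw [pd, h.cexp.fderiv]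
  simp [hℓ, Pi.single_apply, apply_ite]

lemma pd_ofReal {η : E3 → ℝ} (hη : Differentiable ℝ η) (k : Fin 3) (x : E3) :
    pd k (fun x => (η x : ℂ)) x = ((pd k η x : ℝ) : ℂ) := by
  have h := Complex.ofRealCLM.hasFDerivAt.comp x (hη x).hasFDerivAt
  rw [pd, show (fun x => (η x : ℂ)) = Complex.ofRealCLM ∘ η from rfl, h.fderiv]
  simp [pd]

lemma pd_gaugeLoc (a : E3) {η : E3 → ℝ} (hη : ContDiff ℝ (⊤ : ℕ∞) η) {u : E3 → ℂ}
    (hu : ContDiff ℝ (⊤ : ℕ∞) u) (k : Fin 3) (x : E3) :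
    pd k (gaugeLoc a η u) x = Complex.exp (Complex.I * ∑ k, ((a k * x k : ℝ) : ℂ)) *
      (((pd k η x : ℝ) : ℂ) * u x + (η x : ℂ) * (Complex.I * a k * u x + pd k u x)) := by
  have d1 : Differentiable ℝ fun x => (η x : ℂ) :=
    (Complex.ofRealCLM.contDiff.comp hη).differentiable (by simp)
  have d2 := (contDiff_phase a).differentiable (by simp)
  have d3 := hu.differentiable (by simp)
  have e1 : gaugeLoc a η u = fun x => ((η x : ℂ) *
    Complex.exp (Complex.I * ∑ k, ((a k * x k : ℝ) : ℂ))) * u x := rfl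
  rw [e1, pd_mul (u := fun x => (η x : ℂ) *
      Complex.exp (Complex.I * ∑ k, ((a k * x k : ℝ) : ℂ))) (d1.mul d2) d3, pd_mul d1 d2,
      pd_phase, pd_ofReal (hη.differentiable (by simp))]
  ring

lemma pauliGrad_gaugeLoc (A : E3 → E3) (a : E3) {η : E3 → ℝ} (hη : ContDiff ℝ (⊤ : ℕ∞) η)
    {u : Fin 2 → E3 → ℂ} (hu : ∀ t, ContDiff ℝ (⊤ : ℕ∞) (u t)) (s : Fin 2) (x : E3) :
    pauliGrad (fun t => gaugeLoc a η (u t)) s x =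
      Complex.exp (Complex.I * ∑ k, ((a k * x k : ℝ) : ℂ)) *
        ((∑ k, ∑ t, pauli k s t * (((pd k η x : ℝ) : ℂ) * u t x)) +
          Complex.I * ((η x : ℂ) * pauliOp A u s x)) -
      Complex.I * ∑ k, ∑ t, pauli k s t * (((A x - a) k : ℂ) * gaugeLoc a η (u t) x) := by
  simp only [pauliGrad, pauliOp, pd_gaugeLoc a hη (hu _), gaugeLoc, Fin.sum_univ_two,
    Fin.sum_univ_three, Pi.sub_apply]
  push_cast
  generalize Complex.exp _ = e
  ring_nf
  simp only [Complex.I_sq]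
  ring

lemma sum_enorm_pauliGrad_gaugeLoc_le (A : E3 → E3) (a : E3) {η : E3 → ℝ}
    (hη : ContDiff ℝ (⊤ : ℕ∞) η) {u : Fin 2 → E3 → ℂ} (hu : ∀ t, ContDiff ℝ (⊤ : ℕ∞) (u t))
    (x : E3) :
    ∑ s, ‖pauliGrad (fun t => gaugeLoc a η (u t)) s x‖ₑ ^ 2 ≤
      108 * (‖fderiv ℝ η x‖ₑ ^ 2 * ∑ t, ‖u t x‖ₑ ^ 2) +
      3 * (‖η x‖ₑ ^ 2 * ∑ s, ‖pauliOp A u s x‖ₑ ^ 2) +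
      108 * (‖A x - a‖ₑ ^ 2 * ∑ t, ‖gaugeLoc a η (u t) x‖ₑ ^ 2) := by
  have he : ‖Complex.exp (Complex.I * ∑ k, ((a k * x k : ℝ) : ℂ))‖ₑ = 1 := by
    rw [← ofReal_norm, ← Complex.ofReal_sum, mul_comm, Complex.norm_exp_ofReal_mul_I]
    simp
  have hI : ‖Complex.I‖ₑ = 1 := by rw [← ofReal_norm]; simp
  have h2 : ‖(η x : ℂ)‖ₑ = ‖η x‖ₑ := by
    rw [← ofReal_norm, ← ofReal_norm, Complex.norm_real]
  have hgrad : ‖(fun k => pd k η x : E3)‖ₑ ≤ ‖fderiv ℝ η x‖ₑ := by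
    rw [← ofReal_norm, ← ofReal_norm]
    refine ENNReal.ofReal_le_ofReal ((pi_norm_le_iff_of_nonneg (norm_nonneg _)).2 fun k => ?_)
    have h1 : ‖(Pi.single k (1 : ℝ) : E3)‖ = 1 := by rw [Pi.norm_single, norm_one]
    have h3 := (fderiv ℝ η x).le_opNorm (Pi.single k (1 : ℝ) : E3)
    rw [h1, mul_one] at h3
    exact h3
  have hpt : ∀ s, ‖pauliGrad (fun t => gaugeLoc a η (u t)) s x‖ₑ ^ 2 ≤
      3 * (18 * (‖fderiv ℝ η x‖ₑ ^ 2 * ∑ t, ‖u t x‖ₑ ^ 2) +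
      ‖η x‖ₑ ^ 2 * ‖pauliOp A u s x‖ₑ ^ 2 +
      18 * (‖A x - a‖ₑ ^ 2 * ∑ t, ‖gaugeLoc a η (u t) x‖ₑ ^ 2)) := by
    intro s
    rw [pauliGrad_gaugeLoc A a hη hu]
    set p := ∑ k, ∑ t, pauli k s t * (((pd k η x : ℝ) : ℂ) * u t x) with hp
    set q := ∑ k, ∑ t, pauli k s t * (((A x - a) k : ℂ) * gaugeLoc a η (u t) x) with hq
    have b1 : ‖p‖ₑ ^ 2 ≤ 18 * (‖fderiv ℝ η x‖ₑ ^ 2 * ∑ t, ‖u t x‖ₑ ^ 2) :=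
      (enorm_pauli_sum_sq_le (fun k => pd k η x) (fun t => u t x) s).trans (by gcongr)
    have b2 : ‖q‖ₑ ^ 2 ≤ 18 * (‖A x - a‖ₑ ^ 2 * ∑ t, ‖gaugeLoc a η (u t) x‖ₑ ^ 2) :=
      enorm_pauli_sum_sq_le (A x - a) (fun t => gaugeLoc a η (u t) x) s
    have b3 : ‖Complex.exp (Complex.I * ∑ k, ((a k * x k : ℝ) : ℂ)) *
        (p + Complex.I * ((η x : ℂ) * pauliOp A u s x)) - Complex.I * q‖ₑ ≤
        ‖p‖ₑ + ‖η x‖ₑ * ‖pauliOp A u s x‖ₑ + ‖q‖ₑ := by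
      refine enorm_sub_le.trans ?_
      rw [enorm_mul, he, enorm_mul, hI, one_mul, one_mul]
      gcongr
      refine (enorm_add_le _ _).trans ?_
      rw [enorm_mul, enorm_mul, hI, h2, one_mul]
    refine (pow_le_pow_left' b3 2).trans ?_
    have b4 := sq_sum_le_card_mul ![‖p‖ₑ, ‖η x‖ₑ * ‖pauliOp A u s x‖ₑ, ‖q‖ₑ]
    simp only [Fin.sum_univ_three, Matrix.cons_val_zero, Matrix.cons_val_one, Matrix.cons_val,
      Fintype.card_fin] at b4
    refine b4.trans (mul_le_mul' (by norm_num) ?_)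
    rw [mul_pow]
    gcongr
  calc _ ≤ ∑ s : Fin 2, 3 * (18 * (‖fderiv ℝ η x‖ₑ ^ 2 * ∑ t, ‖u t x‖ₑ ^ 2) +
      ‖η x‖ₑ ^ 2 * ‖pauliOp A u s x‖ₑ ^ 2 +
      18 * (‖A x - a‖ₑ ^ 2 * ∑ t, ‖gaugeLoc a η (u t) x‖ₑ ^ 2)) :=
        Finset.sum_le_sum fun s _ => hpt s
    _ = _ := by
      rw [Fin.sum_univ_two, Fin.sum_univ_two (f := fun s => ‖pauliOp A u s x‖ₑ ^ 2)]
      ring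

lemma lintegral_sum_gradNormSq_eq {f : Fin 2 → E3 → ℂ} (hf : ∀ s, ContDiff ℝ (⊤ : ℕ∞) (f s))
    (hc : ∀ s, HasCompactSupport (f s)) :
    ∫⁻ x, ∑ s, gradNormSq (f s) x = ∫⁻ x, ∑ s, ‖pauliGrad f s x‖ₑ ^ 2 := by
  have h := integral_normSq_pauliGrad hf hc
  have hpc : ∀ s k, Continuous (pd k (f s)) := fun s k => ((hf s).pd k).continuous
  have i1 : Integrable fun x => ∑ s, ∑ k, ‖pd k (f s) x‖ ^ 2 :=
    integrable_finsetSum _ fun s _ => integrable_finsetSum _ fun k _ =>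
      integrable_norm_sq_of_hasCompactSupport (hpc s k) ((hc s).pd k)
  have hgc : ∀ s, Continuous (pauliGrad f s) := fun s => by unfold pauliGrad; fun_prop
  have i2 : Integrable fun x => ∑ s, ‖pauliGrad f s x‖ ^ 2 := by
    refine integrable_finsetSum _ fun s _ =>
      integrable_norm_sq_of_hasCompactSupport (hgc s) ?_
    refine HasCompactSupport.of_support_subset_isCompact
      (K := ⋃ k, ⋃ t, tsupport (pd k (f t)))
      (isCompact_iUnion fun k => isCompact_iUnion fun t => ((hc t).pd k)) ?_
    intro x hx
    by_contra hx'
    simp only [Set.mem_iUnion, not_exists] at hx'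
    refine hx (Finset.sum_eq_zero fun k _ => Finset.sum_eq_zero fun t _ => ?_)
    rw [image_eq_zero_of_notMem_tsupport (hx' k t), mul_zero]
  have c1 := ofReal_integral_eq_lintegral_ofReal i1 (ae_of_all _ fun x => by positivity)
  have c2 := ofReal_integral_eq_lintegral_ofReal i2 (ae_of_all _ fun x => by positivity)
  rw [h, c1] at c2
  have conv : ∀ z : ℂ, ‖z‖ₑ ^ 2 = ENNReal.ofReal (‖z‖ ^ 2) := fun z => by
    rw [← ofReal_norm, ENNReal.ofReal_pow (norm_nonneg _)]
  calc _ = ∫⁻ x, ENNReal.ofReal (∑ s, ∑ k, ‖pd k (f s) x‖ ^ 2) := by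
        refine lintegral_congr fun x => ?_
        rw [ENNReal.ofReal_sum_of_nonneg fun _ _ => by positivity]
        refine Finset.sum_congr rfl fun s _ => ?_
        rw [ENNReal.ofReal_sum_of_nonneg fun _ _ => by positivity]
        exact Finset.sum_congr rfl fun k _ => conv _
    _ = _ := c2
    _ = _ := by
        refine lintegral_congr fun x => ?_
        rw [ENNReal.ofReal_sum_of_nonneg fun _ _ => by positivity]
        exact Finset.sum_congr rfl fun k _ => (conv _).symm

/-- A smooth cutoff function at every scale. -/
lemma exists_cutoff : ∃ C : ℝ≥0, ∀ (x : E3) (L : ℝ), 0 < L → ∃ η : E3 → ℝ,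
    ContDiff ℝ (⊤ : ℕ∞) η ∧ HasCompactSupport η ∧ (∀ z, ‖η z‖ₑ ≤ 1) ∧
    (∀ z ∈ Metric.ball x L, η z = 1) ∧
    (∀ z ∉ Metric.ball x (2 * L), η z = 0 ∧ fderiv ℝ η z = 0) ∧
    ∀ z, ‖fderiv ℝ η z‖ₑ ≤ C * ENNReal.ofReal L⁻¹ := by
  let b : ContDiffBump (0 : E3) := ⟨1, 3 / 2, by norm_num, by norm_num⟩
  have hb : ContDiff ℝ (⊤ : ℕ∞) b := b.contDiff
  obtain ⟨C, hC⟩ := (hb.continuous_fderiv (by simp)).bounded_above_of_compact_support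
    (b.hasCompactSupport.fderiv ℝ)
  have hC0 : 0 ≤ C := (norm_nonneg _).trans (hC 0)
  refine ⟨⟨C, hC0⟩, fun x L hL => ?_⟩
  set h : E3 ≃ₜ E3 := (Homeomorph.subRight x).trans (Homeomorph.smulOfNeZero L⁻¹ (by positivity))
    with hh
  have hdist : ∀ z, ‖L⁻¹ • (z - x)‖ = dist z x / L := fun z => by
    rw [norm_smul, norm_inv, Real.norm_of_nonneg hL.le, dist_eq_norm]; ring
  have hsm : ContDiff ℝ (⊤ : ℕ∞) fun z : E3 => b (L⁻¹ • (z - x)) :=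
    hb.comp ((contDiff_id.sub contDiff_const).const_smul _)
  have hder : ∀ z, HasFDerivAt (fun z : E3 => b (L⁻¹ • (z - x)))
      (L⁻¹ • fderiv ℝ b (L⁻¹ • (z - x))) z := by
    intro z
    have h1 : HasFDerivAt (fun z : E3 => L⁻¹ • (z - x)) (L⁻¹ • ContinuousLinearMap.id ℝ E3) z :=
      ((hasFDerivAt_id z).sub_const x).const_smul L⁻¹
    refine (((hb.differentiable (by simp)) _).hasFDerivAt.comp z h1).congr_fderiv ?_
    ext v
    simp
  refine ⟨fun z => b (L⁻¹ • (z - x)), hsm, ?_, ?_, ?_, ?_, ?_⟩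
  · exact b.hasCompactSupport.comp_homeomorph h
  · intro z
    rw [← ofReal_norm, Real.norm_of_nonneg b.nonneg, ENNReal.ofReal_le_one]
    exact b.le_one
  · intro z hz
    refine b.one_of_mem_closedBall ?_
    rw [mem_closedBall_zero_iff, hdist]
    exact (div_le_one hL).2 (Metric.mem_ball.1 hz).le
  · intro z hz
    have hn : L⁻¹ • (z - x) ∉ tsupport b := by
      rw [b.tsupport_eq, mem_closedBall_zero_iff, hdist]
      rw [Metric.mem_ball, not_lt] at hz
      change ¬ dist z x / L ≤ 3 / 2
      rw [not_le, lt_div_iff₀ hL]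
      linarith
    refine ⟨image_eq_zero_of_notMem_tsupport hn, ?_⟩
    rw [(hder z).fderiv, image_eq_zero_of_notMem_tsupport (f := fderiv ℝ b), smul_zero]
    exact fun h' => hn (tsupport_fderiv_subset ℝ h')
  · intro z
    rw [(hder z).fderiv, enorm_smul, mul_comm]
    gcongr
    · rw [← ofReal_norm]
      calc _ ≤ ENNReal.ofReal C := ENNReal.ofReal_le_ofReal (hC _)
        _ = _ := by rw [ENNReal.ofReal, Real.toNNReal_of_nonneg hC0]; rfl
    · rw [← ofReal_norm, Real.norm_of_nonneg (by positivity)]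

end Gauge

section Localization

/-- A smooth family of two-component functions with finite total mass and gradient, bounded
density, and satisfying Bessel's inequality. -/
structure IsOrbitalFamily {Y : Type} [MeasurableSpace Y] (μ : Measure Y)
    (φ : Fin 2 → Y → E3 → ℂ) : Prop where
  smooth : ∀ s y, ContDiff ℝ (⊤ : ℕ∞) (φ s y)
  measurable : ∀ s, Measurable fun p : Y × E3 => φ s p.1 p.2
  measurable_pd : ∀ s k, Measurable fun p : Y × E3 => pd k (φ s p.1) p.2
  mass_ne_top : ∀ s, ∫⁻ y, (∫⁻ x, ‖φ s y x‖ₑ ^ 2) ∂μ ≠ ∞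
  grad_ne_top : ∀ s, ∫⁻ y, (∫⁻ x, gradNormSq (φ s y) x) ∂μ ≠ ∞
  bounded : ∃ M : ℝ≥0, ∀ s x, ∫⁻ y, ‖φ s y x‖ₑ ^ 2 ∂μ ≤ M
  bessel : ∀ s (g : E3 → ℂ), Continuous g → HasCompactSupport g →
    ∫⁻ y, ‖∫ x, g x * φ s y x‖ₑ ^ 2 ∂μ ≤ ∫⁻ x, ‖g x‖ₑ ^ 2

/-- The density of a family of two-component functions. -/
def famDensity {Y : Type} [MeasurableSpace Y] (μ : Measure Y) (φ : Fin 2 → Y → E3 → ℂ)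
    (x : E3) : ℝ≥0∞ :=
  ∫⁻ y, ∑ s, ‖φ s y x‖ₑ ^ 2 ∂μ

/-- The Pauli kinetic energy density of a family of two-component functions. -/
def famKinetic {Y : Type} [MeasurableSpace Y] (μ : Measure Y) (A : E3 → E3)
    (φ : Fin 2 → Y → E3 → ℂ) (x : E3) : ℝ≥0∞ :=
  ∫⁻ y, ∑ s, ‖pauliOp A (fun t => φ t y) s x‖ₑ ^ 2 ∂μ

/-- After subtracting a constant, the vector potential is controlled on a ball by its gradient. -/
lemma exists_localized_potential : ∃ C : ℝ≥0, ∀ A : E3 → E3, ContDiff ℝ (⊤ : ℕ∞) A →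
    ∀ (x : E3) (L : ℝ), 0 < L → ∃ (a : E3) (Q : E3 → ℝ≥0∞), Measurable Q ∧
      (∀ z ∈ Metric.ball x (2 * L), ‖A z - a‖ₑ ^ 2 = Q z ^ (1 / 3 : ℝ)) ∧
      (∫⁻ z, Q z) ^ (1 / 3 : ℝ) ≤ C * ∫⁻ z in Metric.ball x (4 * L), ‖fderiv ℝ A z‖ₑ ^ 2 := by
  obtain ⟨C, hC⟩ := exists_cutoff
  obtain ⟨K, hK⟩ := exists_sobolev E3
  refine ⟨K ^ 2 * (256 * C ^ 2 + 2), fun A hA x L hL => ?_⟩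
  have hA1 : ContDiff ℝ 1 A := hA.of_le (by exact_mod_cast le_top)
  obtain ⟨a, ha⟩ := exists_poincare hA1 x (r := 4 * L) (by positivity)
  obtain ⟨η, hη, hηc, hη1, hηb, hηo, hηd⟩ := hC x (2 * L) (by positivity)
  rw [show 2 * (2 * L) = 4 * L by ring] at hηo
  set B := Metric.ball x (4 * L) with hB
  have hBm : MeasurableSet B := Metric.isOpen_ball.measurableSet
  set b := ∫⁻ z in B, ‖fderiv ℝ A z‖ₑ ^ 2 with hb
  have hη1' : ContDiff ℝ 1 η := hη.of_le (by exact_mod_cast le_top)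
  set V : E3 → E3 := fun z => η z • (A z - a) with hV
  have hVd : ContDiff ℝ 1 V := hη1'.smul (hA1.sub contDiff_const)
  have hVc : HasCompactSupport V := hηc.smul_right
  refine ⟨a, fun z => ‖V z‖ₑ ^ 6, hVd.continuous.enorm.measurable.pow_const 6, ?_, ?_⟩
  · intro z hz
    simp only [hV, hηb z hz, one_smul]
    rw [← ENNReal.rpow_natCast, ← ENNReal.rpow_natCast, ← ENNReal.rpow_mul]; norm_num
  have hfd : ∀ z, ‖fderiv ℝ V z‖ₑ ^ 2 ≤ B.indicator (fun z =>
      2 * (C * ENNReal.ofReal (2 * L)⁻¹) ^ 2 * ‖A z - a‖ₑ ^ 2 + 2 * ‖fderiv ℝ A z‖ₑ ^ 2) z := by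
    intro z
    have hd : fderiv ℝ V z = η z • fderiv ℝ A z + (fderiv ℝ η z).smulRight (A z - a) := by
      have := (hη1'.differentiable (by simp) z).hasFDerivAt.smul
        ((hA1.differentiable (by simp) z).hasFDerivAt.sub_const a)
      exact this.fderiv
    by_cases hz : z ∈ B
    · rw [Set.indicator_of_mem hz, hd]
      have h1 : ‖η z • fderiv ℝ A z + (fderiv ℝ η z).smulRight (A z - a)‖ₑ ≤
          ‖fderiv ℝ A z‖ₑ + C * ENNReal.ofReal (2 * L)⁻¹ * ‖A z - a‖ₑ := by
        have h0 : ‖η z • fderiv ℝ A z + (fderiv ℝ η z).smulRight (A z - a)‖ₑ ≤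
            ‖η z • fderiv ℝ A z‖ₑ + ‖(fderiv ℝ η z).smulRight (A z - a)‖ₑ := by
          simp only [← ofReal_norm]
          rw [← ENNReal.ofReal_add (norm_nonneg _) (norm_nonneg _)]
          exact ENNReal.ofReal_le_ofReal (norm_add_le _ _)
        refine h0.trans (add_le_add ?_ ?_)
        · rw [← ofReal_norm, norm_smul, ENNReal.ofReal_mul (norm_nonneg _), ofReal_norm,
            ofReal_norm]
          exact mul_le_of_le_one_left' (hη1 z)
        · have h2 : ‖(fderiv ℝ η z).smulRight (A z - a)‖ₑ = ‖fderiv ℝ η z‖ₑ * ‖A z - a‖ₑ := by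
            rw [← ofReal_norm, ContinuousLinearMap.norm_smulRight_apply,
              ENNReal.ofReal_mul (norm_nonneg _), ofReal_norm, ofReal_norm]
          rw [h2]
          gcongr
          exact hηd z
      refine (pow_le_pow_left' h1 2).trans ?_
      have h3 := sq_sum_le_card_mul ![‖fderiv ℝ A z‖ₑ, C * ENNReal.ofReal (2 * L)⁻¹ * ‖A z - a‖ₑ]
      simp only [Fin.sum_univ_two, Matrix.cons_val_zero, Matrix.cons_val_one,
        Fintype.card_fin] at h3
      refine h3.trans (le_of_eq ?_)
      push_cast
      ring
    · rw [Set.indicator_of_notMem hz, hd, (hηo z hz).1, (hηo z hz).2, zero_smul,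
        zero_add, ← ofReal_norm, ContinuousLinearMap.norm_smulRight_apply, norm_zero, zero_mul]
      simp
  have hInt : ∫⁻ z, ‖fderiv ℝ V z‖ₑ ^ 2 ≤ (256 * C ^ 2 + 2) * b := by
    have hm1 : Measurable fun z => 2 * ‖fderiv ℝ A z‖ₑ ^ 2 :=
      ((hA1.continuous_fderiv (by simp)).enorm.measurable.pow_const 2).const_mul _
    calc _ ≤ ∫⁻ z in B, (2 * (C * ENNReal.ofReal (2 * L)⁻¹) ^ 2 * ‖A z - a‖ₑ ^ 2 +
          2 * ‖fderiv ℝ A z‖ₑ ^ 2) := by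
          rw [← lintegral_indicator hBm]
          exact lintegral_mono hfd
      _ = 2 * (C * ENNReal.ofReal (2 * L)⁻¹) ^ 2 * (∫⁻ z in B, ‖A z - a‖ₑ ^ 2) + 2 * b := by
          rw [lintegral_add_right _ hm1, lintegral_const_mul' _ _ (by finiteness),
            lintegral_const_mul' _ _ (by simp)]
      _ ≤ 2 * (C * ENNReal.ofReal (2 * L)⁻¹) ^ 2 * (ENNReal.ofReal (32 * (4 * L) ^ 2) * b) +
          2 * b := by gcongr
      _ = _ := by
          have : ENNReal.ofReal (2 * L)⁻¹ ^ 2 * ENNReal.ofReal (32 * (4 * L) ^ 2) = 128 := by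
            rw [← ENNReal.ofReal_pow (by positivity), ← ENNReal.ofReal_mul (by positivity)]
            rw [← ENNReal.ofReal_ofNat]
            congr 1
            field_simp
            norm_num
          rw [mul_pow]
          calc _ = 2 * C ^ 2 * (ENNReal.ofReal (2 * L)⁻¹ ^ 2 *
                ENNReal.ofReal (32 * (4 * L) ^ 2)) * b + 2 * b := by ring
            _ = _ := by rw [this]; ring
  have e' : ∀ x : ℝ≥0∞, x ^ (1 / 3 : ℝ) = (x ^ (1 / 6 : ℝ)) ^ 2 := fun x => by
    rw [← ENNReal.rpow_natCast, ← ENNReal.rpow_mul]; norm_num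
  have e'' : ∀ x : ℝ≥0∞, (x ^ (1 / 2 : ℝ)) ^ 2 = x := fun x => by
    rw [← ENNReal.rpow_natCast, ← ENNReal.rpow_mul]; norm_num
  rw [e']
  calc _ ≤ (K * (∫⁻ z, ‖fderiv ℝ V z‖ₑ ^ 2) ^ (1 / 2 : ℝ)) ^ 2 :=
        pow_le_pow_left' (hK V hVd hVc) 2
    _ = K ^ 2 * ∫⁻ z, ‖fderiv ℝ V z‖ₑ ^ 2 := by rw [mul_pow, e'']
    _ ≤ K ^ 2 * ((256 * C ^ 2 + 2) * b) := by gcongr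
    _ = _ := by push_cast; ring

variable {Y : Type} [MeasurableSpace Y] {μ : Measure Y} {φ : Fin 2 → Y → E3 → ℂ}

lemma measurable_gaugeLoc (a : E3) {η : E3 → ℝ} (hη : Continuous η) {u : Y → E3 → ℂ}
    (hu : Measurable fun p : Y × E3 => u p.1 p.2) :
    Measurable fun p : Y × E3 => gaugeLoc a η (u p.1) p.2 := by
  have h : Continuous fun x => (η x : ℂ) * Complex.exp (Complex.I * ∑ k, ((a k * x k : ℝ) : ℂ)) :=
    (Complex.continuous_ofReal.comp hη).mul (contDiff_phase a).continuous
  exact (h.measurable.comp measurable_snd).mul hu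

lemma measurable_pd_gaugeLoc (a : E3) {η : E3 → ℝ} (hη : ContDiff ℝ (⊤ : ℕ∞) η)
    {u : Y → E3 → ℂ} (hs : ∀ y, ContDiff ℝ (⊤ : ℕ∞) (u y))
    (hu : Measurable fun p : Y × E3 => u p.1 p.2) (k : Fin 3)
    (hu' : Measurable fun p : Y × E3 => pd k (u p.1) p.2) :
    Measurable fun p : Y × E3 => pd k (gaugeLoc a η (u p.1)) p.2 := by
  have h1 : Measurable fun x : E3 => Complex.exp (Complex.I * ∑ k, ((a k * x k : ℝ) : ℂ)) :=
    (contDiff_phase a).continuous.measurable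
  have h2 : Measurable fun x => ((pd k η x : ℝ) : ℂ) :=
    Complex.measurable_ofReal.comp (hη.pd k).continuous.measurable
  have h3 : Measurable fun x => (η x : ℂ) := Complex.measurable_ofReal.comp hη.continuous.measurable
  simp only [pd_gaugeLoc a hη (hs _)]
  exact (h1.comp measurable_snd).mul (((h2.comp measurable_snd).mul hu).add
    ((h3.comp measurable_snd).mul ((hu.const_mul _).add hu')))

lemma measurable_pauliOp (h : IsOrbitalFamily μ φ) {A : E3 → E3} (hA : Continuous A) (s : Fin 2) :
    Measurable fun p : Y × E3 => pauliOp A (fun t => φ t p.1) s p.2 := by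
  unfold pauliOp
  refine Finset.measurable_sum _ fun k _ => Finset.measurable_sum _ fun t _ => ?_
  have h1 : Measurable fun x => (A x k : ℂ) :=
    Complex.measurable_ofReal.comp (by fun_prop : Continuous fun x => A x k).measurable
  exact (((h.measurable_pd t k).const_mul _).add
    ((h1.comp measurable_snd).mul (h.measurable t))).const_mul _

lemma IsOrbitalFamily.measurable_sum (h : IsOrbitalFamily μ φ) :
    Measurable fun p : Y × E3 => ∑ s, ‖φ s p.1 p.2‖ₑ ^ 2 :=
  Finset.measurable_sum _ fun s _ => (h.measurable s).enorm.pow_const 2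

lemma IsOrbitalFamily.measurable_pauli_sum (h : IsOrbitalFamily μ φ) {A : E3 → E3}
    (hA : Continuous A) :
    Measurable fun p : Y × E3 => ∑ s, ‖pauliOp A (fun t => φ t p.1) s p.2‖ₑ ^ 2 :=
  Finset.measurable_sum _ fun s _ => (measurable_pauliOp h hA s).enorm.pow_const 2

lemma measurable_famDensity [SFinite μ] (h : IsOrbitalFamily μ φ) : Measurable (famDensity μ φ) :=
  h.measurable_sum.lintegral_prod_left'

lemma measurable_famKinetic [SFinite μ] (h : IsOrbitalFamily μ φ) {A : E3 → E3}
    (hA : Continuous A) : Measurable (famKinetic μ A φ) :=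
  (h.measurable_pauli_sum hA).lintegral_prod_left'

lemma lintegral_gradNormSq_gaugeLoc_ne_top (h : IsOrbitalFamily μ φ) (a : E3) {η : E3 → ℝ}
    (hη : ContDiff ℝ (⊤ : ℕ∞) η) (hη1 : ∀ z, ‖η z‖ₑ ≤ 1) {D : ℝ≥0∞} (hD : D ≠ ∞)
    (hηd : ∀ z, ‖fderiv ℝ η z‖ₑ ≤ D) (s : Fin 2) :
    ∫⁻ y, (∫⁻ x, gradNormSq (gaugeLoc a η (φ s y)) x) ∂μ ≠ ∞ := by
  have hm1 : Measurable fun y => ∫⁻ x, ‖φ s y x‖ₑ ^ 2 :=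
    Measurable.lintegral_prod_right' (f := fun p : Y × E3 => ‖φ s p.1 p.2‖ₑ ^ 2)
      ((h.measurable s).enorm.pow_const 2)
  have hpt : ∀ y x, gradNormSq (gaugeLoc a η (φ s y)) x ≤
      9 * (D ^ 2 + ‖a‖ₑ ^ 2) * ‖φ s y x‖ₑ ^ 2 + 3 * gradNormSq (φ s y) x := by
    intro y x
    have he : ‖Complex.exp (Complex.I * ∑ k, ((a k * x k : ℝ) : ℂ))‖ₑ = 1 := by
      rw [← ofReal_norm, ← Complex.ofReal_sum, mul_comm, Complex.norm_exp_ofReal_mul_I]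
      simp
    have hI : ‖Complex.I‖ₑ = 1 := by rw [← ofReal_norm]; simp
    have hre : ∀ r : ℝ, ‖(r : ℂ)‖ₑ = ‖r‖ₑ := fun r => by
      rw [← ofReal_norm, ← ofReal_norm, Complex.norm_real]
    have hk : ∀ k, ‖pd k (gaugeLoc a η (φ s y)) x‖ₑ ^ 2 ≤
        3 * (D ^ 2 * ‖φ s y x‖ₑ ^ 2 + ‖a‖ₑ ^ 2 * ‖φ s y x‖ₑ ^ 2 + ‖pd k (φ s y) x‖ₑ ^ 2) := by
      intro k
      have hgrad : ‖pd k η x‖ₑ ≤ D := by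
        refine le_trans ?_ (hηd x)
        rw [← ofReal_norm, ← ofReal_norm]
        have h1 : ‖(Pi.single k (1 : ℝ) : E3)‖ = 1 := by rw [Pi.norm_single, norm_one]
        have h3 := (fderiv ℝ η x).le_opNorm (Pi.single k (1 : ℝ) : E3)
        rw [h1, mul_one] at h3
        exact ENNReal.ofReal_le_ofReal h3
      have hak : ‖a k‖ₑ ≤ ‖a‖ₑ := by
        rw [← ofReal_norm, ← ofReal_norm]
        exact ENNReal.ofReal_le_ofReal (norm_le_pi_norm a k)
      have h4 : ‖pd k (gaugeLoc a η (φ s y)) x‖ₑ ≤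
          D * ‖φ s y x‖ₑ + ‖a‖ₑ * ‖φ s y x‖ₑ + ‖pd k (φ s y) x‖ₑ := by
        rw [pd_gaugeLoc a hη (h.smooth s y), enorm_mul, he, one_mul, add_assoc]
        refine (enorm_add_le _ _).trans (add_le_add ?_ ?_)
        · rw [enorm_mul, hre]; gcongr
        · rw [enorm_mul, hre]
          refine (mul_le_of_le_one_left' (hη1 x)).trans ((enorm_add_le _ _).trans ?_)
          rw [enorm_mul, enorm_mul, hI, hre, one_mul]
          gcongr
      refine (pow_le_pow_left' h4 2).trans ?_
      have b4 := sq_sum_le_card_mul ![D * ‖φ s y x‖ₑ, ‖a‖ₑ * ‖φ s y x‖ₑ, ‖pd k (φ s y) x‖ₑ]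
      simp only [Fin.sum_univ_three, Matrix.cons_val_zero, Matrix.cons_val_one, Matrix.cons_val,
        Fintype.card_fin] at b4
      refine b4.trans (le_of_eq ?_)
      push_cast
      ring
    calc _ ≤ ∑ k : Fin 3, 3 * (D ^ 2 * ‖φ s y x‖ₑ ^ 2 + ‖a‖ₑ ^ 2 * ‖φ s y x‖ₑ ^ 2 +
          ‖pd k (φ s y) x‖ₑ ^ 2) := Finset.sum_le_sum fun k _ => hk k
      _ = _ := by
        rw [gradNormSq, Fin.sum_univ_three, Fin.sum_univ_three]; ring
  have hle : ∫⁻ y, (∫⁻ x, gradNormSq (gaugeLoc a η (φ s y)) x) ∂μ ≤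
      9 * (D ^ 2 + ‖a‖ₑ ^ 2) * (∫⁻ y, (∫⁻ x, ‖φ s y x‖ₑ ^ 2) ∂μ) +
      3 * ∫⁻ y, (∫⁻ x, gradNormSq (φ s y) x) ∂μ := by
    have hD' : 9 * (D ^ 2 + ‖a‖ₑ ^ 2) ≠ ∞ := by finiteness
    rw [← lintegral_const_mul' _ _ hD', ← lintegral_const_mul' _ _ (by simp),
      ← lintegral_add_left (hm1.const_mul _)]
    refine lintegral_mono fun y => ?_
    dsimp only
    rw [← lintegral_const_mul' _ _ hD', ← lintegral_const_mul' _ _ (by simp),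
      ← lintegral_add_left (((h.smooth s y).continuous.enorm.measurable.pow_const 2).const_mul _)]
    exact lintegral_mono fun x => hpt y x
  refine ne_top_of_le_ne_top ?_ hle
  have := h.mass_ne_top s
  have := h.grad_ne_top s
  finiteness

end Localization

section LocalBounds

variable {Y : Type} [MeasurableSpace Y] {μ : Measure Y} {φ : Fin 2 → Y → E3 → ℂ}

/-- Tonelli for sums of squares of a family restricted to a set. -/
lemma setLIntegral_famDensity [SFinite μ] (h : IsOrbitalFamily μ φ) (B : Set E3) :
    ∫⁻ x in B, famDensity μ φ x = ∑ s, ∫⁻ y, (∫⁻ x in B, ‖φ s y x‖ₑ ^ 2) ∂μ := by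
  have hm : ∀ s, Measurable fun p : E3 × Y => ‖φ s p.2 p.1‖ₑ ^ 2 := fun s =>
    ((h.measurable s).comp measurable_swap).enorm.pow_const 2
  unfold famDensity
  have h1 : ∀ x, ∫⁻ y, ∑ s, ‖φ s y x‖ₑ ^ 2 ∂μ = ∑ s, ∫⁻ y, ‖φ s y x‖ₑ ^ 2 ∂μ := fun x =>
    lintegral_finsetSum _ fun s _ => (hm s).comp measurable_prodMk_left
  simp only [h1]
  rw [lintegral_finsetSum _ fun s _ => (hm s).lintegral_prod_right']
  refine Finset.sum_congr rfl fun s _ => ?_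
  exact lintegral_lintegral_swap (hm s).aemeasurable

/-- Tonelli for weighted densities. -/
lemma setLIntegral_mul_famDensity [SFinite μ] (h : IsOrbitalFamily μ φ) (B : Set E3)
    {w : E3 → ℝ≥0∞} (hw : Measurable w) :
    ∫⁻ x in B, w x * famDensity μ φ x = ∑ s, ∫⁻ y, (∫⁻ x in B, w x * ‖φ s y x‖ₑ ^ 2) ∂μ := by
  have hm : ∀ s, Measurable fun p : E3 × Y => ‖φ s p.2 p.1‖ₑ ^ 2 := fun s =>
    ((h.measurable s).comp measurable_swap).enorm.pow_const 2
  have hm2 : ∀ s, Measurable fun p : E3 × Y => w p.1 * ‖φ s p.2 p.1‖ₑ ^ 2 := fun s =>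
    (hw.comp measurable_fst).mul (hm s)
  unfold famDensity
  have h1 : ∀ x, w x * ∫⁻ y, ∑ s, ‖φ s y x‖ₑ ^ 2 ∂μ = ∑ s, ∫⁻ y, w x * ‖φ s y x‖ₑ ^ 2 ∂μ := by
    intro x
    have h2 : ∀ s, Measurable fun y => ‖φ s y x‖ₑ ^ 2 := fun s =>
      (hm s).comp measurable_prodMk_left
    rw [lintegral_finsetSum _ fun s _ => h2 s, Finset.mul_sum]
    exact Finset.sum_congr rfl fun s _ =>
      (lintegral_const_mul _ (h2 s)).symm
  simp only [h1]
  rw [lintegral_finsetSum _ fun s _ => (hm2 s).lintegral_prod_right']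
  refine Finset.sum_congr rfl fun s _ => ?_
  exact lintegral_lintegral_swap (hm2 s).aemeasurable

lemma setLIntegral_famKinetic [SFinite μ] (h : IsOrbitalFamily μ φ) {A : E3 → E3}
    (hA : Continuous A) (B : Set E3) :
    ∫⁻ x in B, famKinetic μ A φ x =
      ∫⁻ y, (∫⁻ x in B, ∑ s, ‖pauliOp A (fun t => φ t y) s x‖ₑ ^ 2) ∂μ :=
  lintegral_lintegral_swap ((h.measurable_pauli_sum hA).comp measurable_swap).aemeasurable

lemma setLIntegral_linear_combination {B : Set E3} (hB : MeasurableSet B) {f g h : E3 → ℝ≥0∞}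
    (hf : Measurable f) (hg : Measurable g) (hh : Measurable h) (a b c : ℝ≥0∞) :
    a * (∫⁻ x in B, f x) + b * (∫⁻ x in B, g x) + c * ∫⁻ x, h x =
      ∫⁻ x, (a * B.indicator f x + b * B.indicator g x + c * h x) := by
  rw [lintegral_add_right _ (hh.const_mul _), lintegral_add_right _ ((hg.indicator hB).const_mul _),
    lintegral_const_mul _ hh, lintegral_const_mul _ (hg.indicator hB),
    lintegral_const_mul _ (hf.indicator hB), lintegral_indicator hB, lintegral_indicator hB]

lemma lintegral_family_energy_le [SFinite μ] (h : IsOrbitalFamily μ φ) {A : E3 → E3}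
    (hA : Continuous A) (a : E3) {η : E3 → ℝ} (hη : ContDiff ℝ (⊤ : ℕ∞) η)
    (hηc : HasCompactSupport η) (hη1 : ∀ z, ‖η z‖ₑ ≤ 1) {B : Set E3} (hB : MeasurableSet B)
    (hηo : ∀ z ∉ B, η z = 0 ∧ fderiv ℝ η z = 0) {D : ℝ≥0∞}
    (hηd : ∀ z, ‖fderiv ℝ η z‖ₑ ≤ D) {w : E3 → ℝ≥0∞} (hw : Measurable w)
    (hwB : ∀ z ∈ B, ‖A z - a‖ₑ ^ 2 = w z) :
    ∑ s, ∫⁻ y, (∫⁻ x, gradNormSq (gaugeLoc a η (φ s y)) x) ∂μ ≤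
      108 * (D ^ 2 * ∫⁻ x in B, famDensity μ φ x) + 3 * (∫⁻ x in B, famKinetic μ A φ x) +
      108 * ∑ s, ∫⁻ y, (∫⁻ x, w x * ‖gaugeLoc a η (φ s y) x‖ₑ ^ 2) ∂μ := by
  have hfs : ∀ s y, ContDiff ℝ (⊤ : ℕ∞) (gaugeLoc a η (φ s y)) := fun s y =>
    contDiff_gaugeLoc a hη (h.smooth s y)
  have hfc : ∀ s y, HasCompactSupport (gaugeLoc a η (φ s y)) := fun s y =>
    hηc.mono fun z hz hz' => hz (by simp [gaugeLoc, hz'])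
  have hfm : ∀ s, Measurable fun p : Y × E3 => gaugeLoc a η (φ s p.1) p.2 := fun s =>
    measurable_gaugeLoc a hη.continuous (h.measurable s)
  have hfm' : ∀ s k, Measurable fun p : Y × E3 => pd k (gaugeLoc a η (φ s p.1)) p.2 := fun s k =>
    measurable_pd_gaugeLoc a hη (h.smooth s) (h.measurable s) k (h.measurable_pd s k)
  have hgm : ∀ s, Measurable fun p : Y × E3 => gradNormSq (gaugeLoc a η (φ s p.1)) p.2 :=
    fun s => Finset.measurable_sum _ fun k _ => (hfm' s k).enorm.pow_const 2
  have hmρ : Measurable fun p : Y × E3 => ∑ s, ‖φ s p.1 p.2‖ₑ ^ 2 := h.measurable_sum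
  have hmE := h.measurable_pauli_sum hA
  have hmw : Measurable fun p : Y × E3 => ∑ s, w p.2 * ‖gaugeLoc a η (φ s p.1) p.2‖ₑ ^ 2 :=
    Finset.measurable_sum _ fun s _ => (hw.comp measurable_snd).mul ((hfm s).enorm.pow_const 2)
  have hmr : Measurable fun y => ∫⁻ x in B, ∑ s, ‖φ s y x‖ₑ ^ 2 := hmρ.lintegral_prod_right'
  have hme : Measurable fun y => ∫⁻ x in B, ∑ s, ‖pauliOp A (fun t => φ t y) s x‖ₑ ^ 2 :=
    hmE.lintegral_prod_right'
  have hy : ∀ y, ∑ s, ∫⁻ x, gradNormSq (gaugeLoc a η (φ s y)) x ≤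
      108 * D ^ 2 * (∫⁻ x in B, ∑ s, ‖φ s y x‖ₑ ^ 2) +
      3 * (∫⁻ x in B, ∑ s, ‖pauliOp A (fun t => φ t y) s x‖ₑ ^ 2) +
      108 * ∫⁻ x, ∑ s, w x * ‖gaugeLoc a η (φ s y) x‖ₑ ^ 2 := by
    intro y
    have my1 : ∀ s, Measurable fun x => gradNormSq (gaugeLoc a η (φ s y)) x := fun s => by
      have := (hgm s).comp (measurable_prodMk_left (x := y))
      exact this
    have my2 : Measurable fun x => ∑ s, ‖φ s y x‖ₑ ^ 2 := by
      have := hmρ.comp (measurable_prodMk_left (x := y))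
      exact this
    have my3 : Measurable fun x => ∑ s, ‖pauliOp A (fun t => φ t y) s x‖ₑ ^ 2 := by
      have := hmE.comp (measurable_prodMk_left (x := y))
      exact this
    have my4 : Measurable fun x => ∑ s, w x * ‖gaugeLoc a η (φ s y) x‖ₑ ^ 2 := by
      have := hmw.comp (measurable_prodMk_left (x := y))
      exact this
    have e0 := setLIntegral_linear_combination hB my2 my3 my4 (108 * D ^ 2) 3 108
    have e1 : ∑ s, ∫⁻ x, gradNormSq (gaugeLoc a η (φ s y)) x =
        ∫⁻ x, ∑ s, ‖pauliGrad (fun t => gaugeLoc a η (φ t y)) s x‖ₑ ^ 2 := by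
      rw [← lintegral_sum_gradNormSq_eq (fun s => hfs s y) (fun s => hfc s y)]
      exact (lintegral_finsetSum _ fun s _ => my1 s).symm
    refine e1.le.trans (le_trans ?_ e0.ge)
    refine lintegral_mono fun x => ?_
    dsimp only
    refine (sum_enorm_pauliGrad_gaugeLoc_le A a hη (fun t => h.smooth t y) x).trans ?_
    by_cases hx : x ∈ B
    · simp only [Set.indicator_of_mem hx, hwB x hx, Finset.mul_sum, mul_assoc]
      gcongr with t _ t _
      · exact hηd x
      · exact mul_le_of_le_one_left' (pow_le_one' (hη1 x) 2)
    · simp only [(hηo x hx).1, (hηo x hx).2, gaugeLoc]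
      have h0 : ‖(0 : E3 →L[ℝ] ℝ)‖ₑ = 0 := by rw [← ofReal_norm, norm_zero, ENNReal.ofReal_zero]
      rw [h0]
      simp
  have hsum : ∑ s, ∫⁻ y, (∫⁻ x, gradNormSq (gaugeLoc a η (φ s y)) x) ∂μ =
      ∫⁻ y, (∑ s, ∫⁻ x, gradNormSq (gaugeLoc a η (φ s y)) x) ∂μ :=
    (lintegral_finsetSum _ fun s _ => (hgm s).lintegral_prod_right').symm
  rw [hsum]
  refine (lintegral_mono hy).trans (le_of_eq ?_)
  have hmW : Measurable fun y => ∫⁻ x, ∑ s, w x * ‖gaugeLoc a η (φ s y) x‖ₑ ^ 2 :=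
    hmw.lintegral_prod_right'
  rw [lintegral_add_right _ (hmW.const_mul _), lintegral_add_right _ (hme.const_mul _),
    lintegral_const_mul _ hmr, lintegral_const_mul _ hme, lintegral_const_mul _ hmW,
    setLIntegral_famKinetic h hA]
  have e1 : ∫⁻ x in B, famDensity μ φ x = ∫⁻ y, (∫⁻ x in B, ∑ s, ‖φ s y x‖ₑ ^ 2) ∂μ :=
    lintegral_lintegral_swap (hmρ.comp measurable_swap).aemeasurable
  have e2 : ∫⁻ y, (∫⁻ x, ∑ s, w x * ‖gaugeLoc a η (φ s y) x‖ₑ ^ 2) ∂μ =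
      ∑ s, ∫⁻ y, (∫⁻ x, w x * ‖gaugeLoc a η (φ s y) x‖ₑ ^ 2) ∂μ := by
    have hms : ∀ s, Measurable fun p : Y × E3 => w p.2 * ‖gaugeLoc a η (φ s p.1) p.2‖ₑ ^ 2 :=
      fun s => (hw.comp measurable_snd).mul ((hfm s).enorm.pow_const 2)
    rw [← lintegral_finsetSum _ fun s _ => (hms s).lintegral_prod_right']
    refine lintegral_congr fun y => ?_
    exact lintegral_finsetSum _ fun s _ => (hms s).comp measurable_prodMk_left
  rw [e1, e2, mul_assoc]

/-- Local a priori bounds for an orbital family on a ball. -/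
lemma exists_local_bounds : ∃ C : ℝ≥0, ∀ (Y : Type) [MeasurableSpace Y] (μ : Measure Y) [SFinite μ]
    (φ : Fin 2 → Y → E3 → ℂ), IsOrbitalFamily μ φ → ∀ A : E3 → E3, ContDiff ℝ (⊤ : ℕ∞) A →
    ∀ (x : E3) (L : ℝ), 0 < L → ∃ G : ℝ≥0∞, G ≠ ∞ ∧
      G ≤ C * ((∫⁻ z in Metric.ball x (2 * L), famKinetic μ A φ z) +
        ENNReal.ofReal L⁻¹ ^ 2 * (∫⁻ z in Metric.ball x (2 * L), famDensity μ φ z) +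
        (∫⁻ z in Metric.ball x (4 * L), ‖fderiv ℝ A z‖ₑ ^ 2) *
          ((∫⁻ z in Metric.ball x (2 * L), famDensity μ φ z) ^ (1 / 2 : ℝ) * G ^ (1 / 2 : ℝ))) ∧
      (∫⁻ z in Metric.ball x L, famDensity μ φ z ^ (5 / 3 : ℝ)) ≤
        C * ((∫⁻ z in Metric.ball x L, famDensity μ φ z) ^ (2 / 3 : ℝ) * G) ∧
      (∫⁻ z in Metric.ball x L, famDensity μ φ z ^ (4 / 3 : ℝ)) ≤
        C * ((∫⁻ z in Metric.ball x L, famDensity μ φ z) ^ (1 / 3 : ℝ) *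
          ((∫⁻ z in Metric.ball x (2 * L), famDensity μ φ z) ^ (1 / 2 : ℝ) * G ^ (1 / 2 : ℝ))) ∧
      ∀ δ : ℝ, 0 < δ → (∫⁻ z in Metric.ball x L, famDensity μ φ z) ≤
        C * (ENNReal.ofReal (δ ^ 3)⁻¹ * ENNReal.ofReal (L ^ 3) + ENNReal.ofReal (δ ^ 2) * G) := by
  obtain ⟨C₁, hC₁⟩ := exists_cutoff
  obtain ⟨C₂, hC₂⟩ := exists_localized_potential
  obtain ⟨K, hK⟩ := exists_sobolev_gradNormSq ℂ
  set C : ℝ≥0 := 108 * C₁ ^ 2 + 3 + 216 * (K * C₂) + 2 * K + K ^ 2 + 32 with hC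
  refine ⟨C, ?_⟩
  intro Y _ μ _ φ h A hA x L hL
  obtain ⟨η, hη, hηc, hη1, hηb, hηo, hηd⟩ := hC₁ x L hL
  obtain ⟨a, Q, hQ, hQA, hQb⟩ := hC₂ A hA x L hL
  set f : Fin 2 → Y → E3 → ℂ := fun s y => gaugeLoc a η (φ s y) with hf
  set m := ∫⁻ z in Metric.ball x (2 * L), famDensity μ φ z with hmdef
  set n := ∫⁻ z in Metric.ball x L, famDensity μ φ z with hndef
  set E := ∫⁻ z in Metric.ball x (2 * L), famKinetic μ A φ z with hEdef
  set b := ∫⁻ z in Metric.ball x (4 * L), ‖fderiv ℝ A z‖ₑ ^ 2 with hbdef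
  have hBm : ∀ r, MeasurableSet (Metric.ball x r) := fun r => Metric.isOpen_ball.measurableSet
  have hfs : ∀ s y, ContDiff ℝ (⊤ : ℕ∞) (f s y) := fun s y =>
    contDiff_gaugeLoc a hη (h.smooth s y)
  have hfs1 : ∀ s y, ContDiff ℝ 1 (f s y) := fun s y =>
    (hfs s y).of_le (by exact_mod_cast le_top)
  have hfc : ∀ s y, HasCompactSupport (f s y) := fun s y =>
    hηc.mono fun z hz hz' => hz (by simp [hf, gaugeLoc, hz'])
  have hfm : ∀ s, Measurable fun p : Y × E3 => f s p.1 p.2 := fun s =>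
    measurable_gaugeLoc a hη.continuous (h.measurable s)
  have hfm' : ∀ s k, Measurable fun p : Y × E3 => pd k (f s p.1) p.2 := fun s k =>
    measurable_pd_gaugeLoc a hη (h.smooth s) (h.measurable s) k (h.measurable_pd s k)
  have hfb : ∀ s y, ∀ z ∈ Metric.ball x L, ‖f s y z‖ₑ = ‖φ s y z‖ₑ := fun s y z hz => by
    simp [hf, enorm_gaugeLoc, hηb z hz]
  have hfle : ∀ s y z, ‖f s y z‖ₑ ^ 2 ≤
      (Metric.ball x (2 * L)).indicator (fun z => ‖φ s y z‖ₑ ^ 2) z := fun s y z => by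
    by_cases hz : z ∈ Metric.ball x (2 * L)
    · rw [Set.indicator_of_mem hz, hf, enorm_gaugeLoc]
      gcongr
      exact mul_le_of_le_one_left' (hη1 z)
    · simp [hf, enorm_gaugeLoc, (hηo z hz).1]
  set g : Fin 2 → ℝ≥0∞ := fun s => ∫⁻ y, (∫⁻ x, gradNormSq (f s y) x) ∂μ with hg
  have hgle : ∀ s, g s ≤ ∑ s, g s := fun s =>
    Finset.single_le_sum (f := g) (fun _ _ => zero_le) (Finset.mem_univ s)
  have hmass : ∀ s, ∫⁻ y, (∫⁻ z, ‖f s y z‖ₑ ^ 2) ∂μ ≤ m := by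
    intro s
    rw [hmdef, setLIntegral_famDensity h]
    refine le_trans ?_ (Finset.single_le_sum (f := fun s =>
      ∫⁻ y, (∫⁻ z in Metric.ball x (2 * L), ‖φ s y z‖ₑ ^ 2) ∂μ)
      (fun _ _ => zero_le) (Finset.mem_univ s))
    refine lintegral_mono fun y => ?_
    dsimp only
    rw [← lintegral_indicator (hBm _)]
    exact lintegral_mono (hfle s y)
  have hthird : ∀ {q : E3 → ℝ≥0∞}, Measurable q → ∀ s,
      ∫⁻ y, (∫⁻ z, q z ^ (1 / 3 : ℝ) * ‖f s y z‖ₑ ^ 2) ∂μ ≤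
      K * (∫⁻ z, q z) ^ (1 / 3 : ℝ) * (m ^ (1 / 2 : ℝ) * (∑ s, g s) ^ (1 / 2 : ℝ)) := by
    intro q hq s
    refine (lintegral_family_rpow_third_mul_le hK hq (hfs1 s) (hfc s) (hfm s) (hfm' s)).trans ?_
    gcongr
    · exact hmass s
    · exact hgle s
  have hρm := measurable_famDensity h
  have hloc : ∀ p : ℝ, 0 < p → ∫⁻ z in Metric.ball x L, famDensity μ φ z ^ (1 + p) ≤
      ∑ s, ∫⁻ y, (∫⁻ z, ((Metric.ball x L).indicator (famDensity μ φ)) z ^ p *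
        ‖f s y z‖ₑ ^ 2) ∂μ := by
    intro p hp
    calc _ = ∫⁻ z in Metric.ball x L, famDensity μ φ z ^ p * famDensity μ φ z := by
          refine lintegral_congr fun z => ?_
          rw [add_comm, ENNReal.rpow_add_of_nonneg _ _ hp.le zero_le_one, ENNReal.rpow_one]
      _ = ∑ s, ∫⁻ y, (∫⁻ z in Metric.ball x L, famDensity μ φ z ^ p * ‖φ s y z‖ₑ ^ 2) ∂μ :=
          setLIntegral_mul_famDensity h _ (hρm.pow_const p)
      _ ≤ _ := by
          refine Finset.sum_le_sum fun s _ => lintegral_mono fun y => ?_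
          dsimp only
          rw [← lintegral_indicator (hBm _)]
          refine lintegral_mono fun z => ?_
          dsimp only
          by_cases hz : z ∈ Metric.ball x L
          · rw [Set.indicator_of_mem hz, Set.indicator_of_mem hz, hfb s y z hz]
          · rw [Set.indicator_of_notMem hz]; exact zero_le
  have hind : ∫⁻ z, (Metric.ball x L).indicator (famDensity μ φ) z = n := lintegral_indicator (hBm _) _
  have hcC : ∀ {c : ℝ≥0}, c ≤ C → (c : ℝ≥0∞) ≤ C := fun hc => by exact_mod_cast hc
  refine ⟨∑ s, g s, ?_, ?_, ?_, ?_, ?_⟩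
  · refine ENNReal.sum_ne_top.2 fun s _ => ?_
    exact lintegral_gradNormSq_gaugeLoc_ne_top h a hη hη1 (by finiteness) hηd s
  · have h1 := lintegral_family_energy_le h hA.continuous a hη hηc hη1 (hBm (2 * L)) hηo hηd
      (hQ.pow_const (1 / 3 : ℝ)) hQA
    have h2 : ∑ s, ∫⁻ y, (∫⁻ z, Q z ^ (1 / 3 : ℝ) * ‖f s y z‖ₑ ^ 2) ∂μ ≤
        2 * (K * (C₂ * b) * (m ^ (1 / 2 : ℝ) * (∑ s, g s) ^ (1 / 2 : ℝ))) := by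
      rw [Fin.sum_univ_two, two_mul]
      gcongr
      · exact (hthird hQ 0).trans (by gcongr)
      · exact (hthird hQ 1).trans (by gcongr)
    have k1 : (108 * C₁ ^ 2 : ℝ≥0∞) ≤ C := by
      have := hcC (c := 108 * C₁ ^ 2) (by rw [hC]; simp only [add_assoc]; exact le_self_add)
      simpa using this
    have k2 : (3 : ℝ≥0∞) ≤ C := by
      have := hcC (c := 3) (by
        rw [hC, show 108 * C₁ ^ 2 + 3 + 216 * (K * C₂) + 2 * K + K ^ 2 + 32 =
          3 + (108 * C₁ ^ 2 + 216 * (K * C₂) + 2 * K + K ^ 2 + 32) by ring]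
        exact le_self_add)
      simpa using this
    have k3 : (216 * (K * C₂) : ℝ≥0∞) ≤ C := by
      have := hcC (c := 216 * (K * C₂)) (by
        rw [hC, show 108 * C₁ ^ 2 + 3 + 216 * (K * C₂) + 2 * K + K ^ 2 + 32 =
          216 * (K * C₂) + (108 * C₁ ^ 2 + 3 + 2 * K + K ^ 2 + 32) by ring]
        exact le_self_add)
      simpa using this
    calc ∑ s, g s ≤ _ := h1
      _ ≤ 108 * ((C₁ * ENNReal.ofReal L⁻¹) ^ 2 * m) + 3 * E +
          108 * (2 * (K * (C₂ * b) * (m ^ (1 / 2 : ℝ) * (∑ s, g s) ^ (1 / 2 : ℝ)))) := by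
          gcongr
      _ = 3 * E + 108 * C₁ ^ 2 * (ENNReal.ofReal L⁻¹ ^ 2 * m) + 216 * (K * C₂) *
          (b * (m ^ (1 / 2 : ℝ) * (∑ s, g s) ^ (1 / 2 : ℝ))) := by ring
      _ ≤ C * E + C * (ENNReal.ofReal L⁻¹ ^ 2 * m) + C *
          (b * (m ^ (1 / 2 : ℝ) * (∑ s, g s) ^ (1 / 2 : ℝ))) := by gcongr
      _ = _ := by ring
  · have k : (K ^ 2 : ℝ≥0∞) ≤ C := by
      have := hcC (c := K ^ 2) (by
        rw [hC, show 108 * C₁ ^ 2 + 3 + 216 * (K * C₂) + 2 * K + K ^ 2 + 32 =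
          K ^ 2 + (108 * C₁ ^ 2 + 3 + 216 * (K * C₂) + 2 * K + 32) by ring]
        exact le_self_add)
      simpa using this
    have h1 := hloc (2 / 3) (by norm_num)
    rw [show (1 + 2 / 3 : ℝ) = 5 / 3 by norm_num] at h1
    refine h1.trans ?_
    calc _ ≤ ∑ s, K ^ 2 * n ^ (2 / 3 : ℝ) * g s := by
          refine Finset.sum_le_sum fun s _ => ?_
          have := lintegral_family_rpow_two_thirds_mul_le (μ := μ) hK
            (hρm.indicator (hBm L)) (hfs1 s) (hfc s) (hfm' s)
          rwa [hind] at this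
      _ = K ^ 2 * (n ^ (2 / 3 : ℝ) * ∑ s, g s) := by rw [← Finset.mul_sum, mul_assoc]
      _ ≤ _ := by gcongr
  · have k : (2 * K : ℝ≥0∞) ≤ C := by
      have := hcC (c := 2 * K) (by
        rw [hC, show 108 * C₁ ^ 2 + 3 + 216 * (K * C₂) + 2 * K + K ^ 2 + 32 =
          2 * K + (108 * C₁ ^ 2 + 3 + 216 * (K * C₂) + K ^ 2 + 32) by ring]
        exact le_self_add)
      simpa using this
    have h1 := hloc (1 / 3) (by norm_num)
    rw [show (1 + 1 / 3 : ℝ) = 4 / 3 by norm_num] at h1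
    refine h1.trans ?_
    have h2 : ∀ s, ∫⁻ y, (∫⁻ z, (Metric.ball x L).indicator (famDensity μ φ) z ^ (1 / 3 : ℝ) *
        ‖f s y z‖ₑ ^ 2) ∂μ ≤ K * n ^ (1 / 3 : ℝ) * (m ^ (1 / 2 : ℝ) * (∑ s, g s) ^ (1 / 2 : ℝ)) := by
      intro s
      have := hthird (hρm.indicator (hBm L)) s
      rwa [hind] at this
    refine (Finset.sum_le_sum fun s _ => h2 s).trans ?_
    rw [Finset.sum_const, Finset.card_univ, Fintype.card_fin, nsmul_eq_mul]
    calc _ = (2 * K : ℝ≥0∞) * (n ^ (1 / 3 : ℝ) * (m ^ (1 / 2 : ℝ) * (∑ s, g s) ^ (1 / 2 : ℝ))) := by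
          push_cast; ring
      _ ≤ _ := by gcongr
  · intro δ hδ
    have k : (32 : ℝ≥0∞) ≤ C := by
      have := hcC (c := 32) (by rw [hC]; exact le_add_self)
      simpa using this
    have hbes : ∀ s, ∀ q : E3 → ℂ, Continuous q → HasCompactSupport q →
        ∫⁻ y, ‖∫ z, q z * f s y z‖ₑ ^ 2 ∂μ ≤ ∫⁻ z, ‖q z‖ₑ ^ 2 := by
      intro s q hq hqc
      have e : ∀ y z, q z * f s y z = gaugeLoc a η q z * φ s y z := fun y z => by
        simp only [hf, gaugeLoc]; ring
      simp only [e]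
      refine (h.bessel s (gaugeLoc a η q) ?_ ?_).trans ?_
      · unfold gaugeLoc
        exact ((Complex.continuous_ofReal.comp hη.continuous).mul (contDiff_phase a).continuous).mul
          hq
      · exact hqc.mono fun z hz hz' => hz (by simp [gaugeLoc, hz'])
      · refine lintegral_mono fun z => ?_
        rw [enorm_gaugeLoc]
        gcongr
        exact mul_le_of_le_one_left' (hη1 z)
    have hvol : volume (Metric.ball x L) = 8 * ENNReal.ofReal (L ^ 3) := by
      rw [Real.volume_pi_ball x hL, Fintype.card_fin, mul_pow, ENNReal.ofReal_mul (by norm_num)]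
      norm_num
    have h1 : n = ∑ s, ∫⁻ y, (∫⁻ z in Metric.ball x L, ‖f s y z‖ₑ ^ 2) ∂μ := by
      rw [hndef, setLIntegral_famDensity h]
      refine Finset.sum_congr rfl fun s _ => lintegral_congr fun y => ?_
      exact setLIntegral_congr_fun (hBm L) fun z hz => by simp only [hfb s y z hz]
    rw [h1]
    calc _ ≤ ∑ s, (2 * (ENNReal.ofReal ((δ ^ 3)⁻¹) * volume (Metric.ball x L)) +
          6 * ENNReal.ofReal (δ ^ 2) * g s) := Finset.sum_le_sum fun s _ =>
            lintegral_family_sq_le_of_bessel (hfs1 s) (hfm s) (hfm' s) (hbes s) _ hδ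
      _ = 32 * (ENNReal.ofReal ((δ ^ 3)⁻¹) * ENNReal.ofReal (L ^ 3)) +
          6 * (ENNReal.ofReal (δ ^ 2) * ∑ s, g s) := by
          rw [Finset.sum_add_distrib, Finset.sum_const, ← Finset.mul_sum, Finset.card_univ,
            Fintype.card_fin, hvol, nsmul_eq_mul]
          push_cast
          ring
      _ ≤ 32 * (ENNReal.ofReal ((δ ^ 3)⁻¹) * ENNReal.ofReal (L ^ 3)) +
          32 * (ENNReal.ofReal (δ ^ 2) * ∑ s, g s) := by gcongr; norm_num
      _ = 32 * (ENNReal.ofReal ((δ ^ 3)⁻¹) * ENNReal.ofReal (L ^ 3) +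
          ENNReal.ofReal (δ ^ 2) * ∑ s, g s) := by ring
      _ ≤ _ := by gcongr

end LocalBounds

section LocalEstimate

variable {C Λ γ E b q g m s : ℝ}

lemma sq_le_of_energy_bound (hC : 1 ≤ C) (hΛ : 1 ≤ Λ) (hE : 0 ≤ E) (hs : s ^ 2 = m) (hm : m ≤ Λ)
    (h : g ^ 2 ≤ C * (E + q ^ 2 * m + b * (s * g))) :
    g ^ 2 ≤ 3 * C ^ 2 * Λ * (E + q ^ 2 + b ^ 2) := by
  have hm0 : 0 ≤ m := hs ▸ sq_nonneg s
  have h1 : C * (b * (s * g)) ≤ g ^ 2 / 2 + C ^ 2 * b ^ 2 * m / 2 := by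
    rw [← hs]; nlinarith [sq_nonneg (g - C * b * s)]
  have h2 : g ^ 2 ≤ 2 * C * (E + q ^ 2 * m) + C ^ 2 * b ^ 2 * m := by nlinarith
  have hCC : C ≤ C ^ 2 := by nlinarith
  have h3 : E + q ^ 2 * m ≤ Λ * (E + q ^ 2) := by
    nlinarith [mul_nonneg hE (sub_nonneg.2 hΛ), mul_nonneg (sq_nonneg q) (sub_nonneg.2 hm)]
  have h4 : 0 ≤ Λ * (E + q ^ 2) := by positivity
  have h5 : C * (E + q ^ 2 * m) ≤ C ^ 2 * (Λ * (E + q ^ 2)) :=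
    mul_le_mul hCC h3 (by positivity) (by positivity)
  have h6 : C ^ 2 * b ^ 2 * m ≤ C ^ 2 * b ^ 2 * Λ := by gcongr
  nlinarith [mul_nonneg (mul_nonneg (sq_nonneg C) (sq_nonneg b)) (hm0.trans hm),
    mul_nonneg (sq_nonneg C) h4]

lemma le_of_uncertainty_bounds {F : ℝ} (hC : 1 ≤ C) (hΛ : 1 ≤ Λ) (hγ : 0 < γ) (hE : 0 ≤ E)
    (hb : 0 ≤ b) (hq : 0 < q) (hs : s ^ 2 = m) (hm : m ≤ Λ)
    (h : g ^ 2 ≤ C * (E + q ^ 2 * m + b * (s * g))) (h1 : F ≤ C * (Λ * g ^ 2))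
    (h2 : F ≤ γ * (C * (Λ * g))) :
    F ≤ 9 * C ^ 3 * Λ ^ 2 * (E + γ * b + min (q ^ 2) (γ * q)) := by
  have hgb := sq_le_of_energy_bound hC hΛ hE hs hm h
  have key : ∀ M : ℝ, 0 ≤ M → E ≤ M ^ 2 → q ≤ M → b ≤ M →
      F ≤ 9 * C ^ 3 * Λ ^ 2 * min (M ^ 2) (γ * M) := by
    intro M hM hEM hqM hbM
    have hgM : g ^ 2 ≤ 9 * C ^ 2 * Λ * M ^ 2 := by
      refine hgb.trans ?_
      have : E + q ^ 2 + b ^ 2 ≤ 3 * M ^ 2 := by nlinarith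
      calc _ ≤ 3 * C ^ 2 * Λ * (3 * M ^ 2) := by gcongr
        _ = _ := by ring
    have hgM' : g ≤ 3 * C * Λ * M := by
      refine abs_le_of_sq_le_sq' ?_ (by positivity) |>.2
      refine hgM.trans ?_
      have : Λ ≤ Λ ^ 2 := by nlinarith
      calc _ ≤ 9 * C ^ 2 * Λ ^ 2 * M ^ 2 := by gcongr
        _ = _ := by ring
    have hCC : C ^ 2 ≤ C ^ 3 := pow_le_pow_right₀ hC (by norm_num)
    rcases min_choice (M ^ 2) (γ * M) with h0 | h0 <;> rw [h0]
    · calc F ≤ C * (Λ * (9 * C ^ 2 * Λ * M ^ 2)) := h1.trans (by gcongr)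
        _ = _ := by ring
    · calc F ≤ γ * (C * (Λ * (3 * C * Λ * M))) := h2.trans (by gcongr)
        _ = 3 * C ^ 2 * Λ ^ 2 * (γ * M) := by ring
        _ ≤ 9 * C ^ 3 * Λ ^ 2 * (γ * M) := by gcongr; norm_num
  have hω : 0 < min (q ^ 2) (γ * q) := by positivity
  have hK : 0 ≤ 9 * C ^ 3 * Λ ^ 2 := by positivity
  have hγb : 0 ≤ γ * b := by positivity
  have hsE := Real.sq_sqrt hE
  have hsE0 := Real.sqrt_nonneg E
  rcases le_total (Real.sqrt E) q with h3 | h3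
  · rcases le_total b q with h4 | h4
    · exact (key q hq.le (by nlinarith) le_rfl h4).trans
        (mul_le_mul_of_nonneg_left (by linarith) hK)
    · refine (key b hb (by nlinarith) h4 le_rfl).trans (mul_le_mul_of_nonneg_left ?_ hK)
      linarith [min_le_right (b ^ 2) (γ * b)]
  · rcases le_total b (Real.sqrt E) with h4 | h4
    · refine (key _ hsE0 hsE.ge h3 h4).trans (mul_le_mul_of_nonneg_left ?_ hK)
      linarith [min_le_left (Real.sqrt E ^ 2) (γ * Real.sqrt E)]
    · refine (key b hb (by nlinarith) (h3.trans h4) le_rfl).trans (mul_le_mul_of_nonneg_left ?_ hK)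
      linarith [min_le_right (b ^ 2) (γ * b)]

lemma le_of_exclusion_bound {n κ : ℝ} (hC : 1 ≤ C) (hΛ : 1 ≤ Λ) (hγ : 0 < γ) (hE : 0 ≤ E)
    (hb : 0 ≤ b) (hq : 0 < q) (hs : s ^ 2 = m) (hm : m ≤ Λ)
    (hnm : n ≤ m) (hκ : 0 < κ) (hκ1 : κ ≤ 1)
    (h : g ^ 2 ≤ C * (E + q ^ 2 * m + b * (s * g)))
    (h1 : n ≤ C * ((κ ^ 3)⁻¹ + κ ^ 2 * (q⁻¹ ^ 2 * g ^ 2))) :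
    min (q ^ 2) (γ * q) * n ≤ C * (κ ^ 3)⁻¹ * min (q ^ 2) (γ * q) +
      C ^ 2 * κ ^ 2 * (min (q ^ 2) (γ * q) * m) + 3 * C ^ 3 * Λ ^ 2 * (E + γ * b) := by
  have hgb := sq_le_of_energy_bound hC hΛ hE hs hm h
  set ω := min (q ^ 2) (γ * q) with hω
  have hω0 : 0 < ω := by positivity
  have hω1 : ω ≤ q ^ 2 := min_le_left _ _
  have hω2 : ω ≤ γ * q := min_le_right _ _
  have hm0 : 0 ≤ m := hs ▸ sq_nonneg s
  have hγb : 0 ≤ γ * b := by positivity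
  have hC3 : 1 ≤ C ^ 3 := one_le_pow₀ hC
  have hC2 : 1 ≤ C ^ 2 := one_le_pow₀ hC
  have hp1 : 0 ≤ C * (κ ^ 3)⁻¹ * ω := by positivity
  have hp2 : 0 ≤ C ^ 2 * κ ^ 2 * (ω * m) := by positivity
  have hbig : ω ≤ E + γ * b → ω * n ≤ C * (κ ^ 3)⁻¹ * ω + C ^ 2 * κ ^ 2 * (ω * m) +
      3 * C ^ 3 * Λ ^ 2 * (E + γ * b) := by
    intro h0
    have : ω * n ≤ 3 * C ^ 3 * Λ ^ 2 * (E + γ * b) := by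
      calc ω * n ≤ (E + γ * b) * Λ := by
            refine (mul_le_mul_of_nonneg_left (hnm.trans hm) hω0.le).trans ?_
            gcongr
        _ ≤ (3 * C ^ 3) * ((E + γ * b) * Λ) := le_mul_of_one_le_left (by positivity) (by linarith)
        _ = 3 * C ^ 3 * Λ * (E + γ * b) := by ring
        _ ≤ _ := by gcongr; nlinarith
    linarith
  rcases le_or_gt q b with h3 | h3
  · refine hbig ?_
    have : γ * q ≤ γ * b := by gcongr
    linarith
  rcases le_or_gt (q ^ 2) E with h4 | h4
  · exact hbig (by linarith)
  have hsg : s * g ≤ 3 * C * Λ ^ 2 * q := by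
    refine abs_le_of_sq_le_sq' ?_ (by positivity) |>.2
    have h5 : E + q ^ 2 + b ^ 2 ≤ 3 * q ^ 2 := by nlinarith
    calc (s * g) ^ 2 = m * g ^ 2 := by rw [mul_pow, hs]
      _ ≤ Λ * (3 * C ^ 2 * Λ * (3 * q ^ 2)) := by
          gcongr
          exact hgb.trans (by gcongr)
      _ = 9 * C ^ 2 * q ^ 2 * Λ ^ 2 := by ring
      _ ≤ 9 * C ^ 2 * q ^ 2 * Λ ^ 4 := by gcongr; norm_num
      _ = _ := by ring
  obtain ⟨r, hr⟩ : ∃ r, r = ω * q⁻¹ ^ 2 := ⟨_, rfl⟩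
  have hr0 : 0 ≤ r := by rw [hr]; positivity
  have hrω : r * q ^ 2 = ω := by rw [hr]; field_simp
  have hr1 : r ≤ 1 := by
    by_contra hcon
    push Not at hcon
    nlinarith [sq_pos_of_pos hq]
  have hrq : r * q ≤ γ := by
    by_contra hcon
    push Not at hcon
    nlinarith
  have hrg : r * g ^ 2 ≤ C * (E + ω * m + 3 * C * Λ ^ 2 * (γ * b)) := by
    have e1 : r * E ≤ E := mul_le_of_le_one_left hE hr1
    have e2 : r * (b * (s * g)) ≤ 3 * C * Λ ^ 2 * (γ * b) := by
      calc r * (b * (s * g)) ≤ r * (b * (3 * C * Λ ^ 2 * q)) := by gcongr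
        _ = 3 * C * Λ ^ 2 * ((r * q) * b) := by ring
        _ ≤ _ := by gcongr
    calc r * g ^ 2 ≤ r * (C * (E + q ^ 2 * m + b * (s * g))) := by gcongr
      _ = C * (r * E + r * q ^ 2 * m + r * (b * (s * g))) := by ring
      _ ≤ _ := by rw [hrω]; gcongr
  have hκ2 : κ ^ 2 ≤ 1 := pow_le_one₀ hκ.le hκ1
  calc ω * n ≤ ω * (C * ((κ ^ 3)⁻¹ + κ ^ 2 * (q⁻¹ ^ 2 * g ^ 2))) := by gcongr
    _ = C * (κ ^ 3)⁻¹ * ω + C * κ ^ 2 * (r * g ^ 2) := by rw [hr]; ring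
    _ ≤ C * (κ ^ 3)⁻¹ * ω + C * κ ^ 2 * (C * (E + ω * m + 3 * C * Λ ^ 2 * (γ * b))) := by gcongr
    _ = C * (κ ^ 3)⁻¹ * ω + C ^ 2 * κ ^ 2 * (ω * m) +
        κ ^ 2 * (C ^ 2 * (E + 3 * C * Λ ^ 2 * (γ * b))) := by ring
    _ ≤ C * (κ ^ 3)⁻¹ * ω + C ^ 2 * κ ^ 2 * (ω * m) +
        1 * (3 * C ^ 3 * Λ ^ 2 * (E + γ * b)) := by
        have hΛ2 : 1 ≤ Λ ^ 2 := one_le_pow₀ hΛ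
        have h6 : C ^ 2 * (E + 3 * C * Λ ^ 2 * (γ * b)) ≤ 3 * C ^ 3 * Λ ^ 2 * (E + γ * b) := by
          have h7 : C ^ 2 * 1 ≤ C ^ 3 * Λ ^ 2 :=
            mul_le_mul (pow_le_pow_right₀ hC (by norm_num)) hΛ2 (by norm_num) (by positivity)
          have h8 : C ^ 2 * E ≤ C ^ 3 * Λ ^ 2 * E := by
            rw [mul_one] at h7; gcongr
          have h9 : 0 ≤ C ^ 3 * Λ ^ 2 * E := by positivity
          nlinarith
        gcongr
    _ = _ := by rw [one_mul]

/-- Local estimates of the relative energy on a ball carrying a bounded mass. -/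
lemma exists_local_estimate : ∃ C : ℝ≥0, ∀ Λ : ℝ≥0, 1 ≤ Λ →
    ∀ (Y : Type) [MeasurableSpace Y] (μ : Measure Y) [SFinite μ]
    (φ : Fin 2 → Y → E3 → ℂ), IsOrbitalFamily μ φ → ∀ A : E3 → E3, ContDiff ℝ (⊤ : ℕ∞) A →
    ∀ γ : ℝ≥0, 0 < γ → ∀ (x : E3) (L : ℝ≥0), 0 < L →
    (∫⁻ z in Metric.ball x (2 * L), famDensity μ φ z) ≤ Λ →
      (∫⁻ z in Metric.ball x L, min (famDensity μ φ z ^ (5 / 3 : ℝ))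
        (γ * famDensity μ φ z ^ (4 / 3 : ℝ))) ≤
        C * Λ ^ 2 * ((∫⁻ z in Metric.ball x (4 * L), famKinetic μ A φ z) +
          γ * (∫⁻ z in Metric.ball x (4 * L), ‖fderiv ℝ A z‖ₑ ^ 2) +
          (min (L⁻¹ ^ 2) (γ * L⁻¹) : ℝ≥0)) ∧
      ∀ κ : ℝ≥0, 0 < κ → κ ≤ 1 →
        (min (L⁻¹ ^ 2) (γ * L⁻¹) : ℝ≥0) * (∫⁻ z in Metric.ball x L, famDensity μ φ z) ≤
          C * ((κ ^ 3)⁻¹ : ℝ≥0) * (min (L⁻¹ ^ 2) (γ * L⁻¹) : ℝ≥0) +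
          C * κ ^ 2 * ((min (L⁻¹ ^ 2) (γ * L⁻¹) : ℝ≥0) *
            ∫⁻ z in Metric.ball x (4 * L), famDensity μ φ z) +
          C * Λ ^ 2 * ((∫⁻ z in Metric.ball x (4 * L), famKinetic μ A φ z) +
            γ * (∫⁻ z in Metric.ball x (4 * L), ‖fderiv ℝ A z‖ₑ ^ 2)) := by
  obtain ⟨C₀, hC₀⟩ := exists_local_bounds
  obtain ⟨c, hc⟩ : ∃ c, c = max C₀ 1 := ⟨_, rfl⟩
  have hc1 : 1 ≤ c := hc ▸ le_max_right _ _
  have hcC : (C₀ : ℝ≥0∞) ≤ c := by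
    rw [hc]; exact_mod_cast le_max_left _ _
  refine ⟨9 * c ^ 3, ?_⟩
  intro Λ hΛ Y _ μ _ φ h A hA γ hγ x L hL hmΛ
  have hLr : (0 : ℝ) < L := by exact_mod_cast hL
  obtain ⟨G, hG, hi, hii, hiii, hiv⟩ := hC₀ Y μ φ h A hA x L hLr
  have hballs : ∀ {u v : ℝ}, u ≤ v → Metric.ball x (u * L) ⊆ Metric.ball x (v * L) := fun huv =>
    Metric.ball_subset_ball (by gcongr)
  have hE4 : (∫⁻ z in Metric.ball x (2 * L), famKinetic μ A φ z) ≤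
      ∫⁻ z in Metric.ball x (4 * L), famKinetic μ A φ z :=
    lintegral_mono_set (hballs (by norm_num))
  have hm4 : (∫⁻ z in Metric.ball x (2 * L), famDensity μ φ z) ≤
      ∫⁻ z in Metric.ball x (4 * L), famDensity μ φ z :=
    lintegral_mono_set (hballs (by norm_num))
  have hnm : (∫⁻ z in Metric.ball x L, famDensity μ φ z) ≤
      ∫⁻ z in Metric.ball x (2 * L), famDensity μ φ z := by
    have := hballs (u := 1) (v := 2) (by norm_num)
    rw [one_mul] at this
    exact lintegral_mono_set this
  have hF1 : (∫⁻ z in Metric.ball x L, min (famDensity μ φ z ^ (5 / 3 : ℝ))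
        (γ * famDensity μ φ z ^ (4 / 3 : ℝ))) ≤
      ∫⁻ z in Metric.ball x L, famDensity μ φ z ^ (5 / 3 : ℝ) :=
    lintegral_mono fun z => min_le_left _ _
  have hF2 : (∫⁻ z in Metric.ball x L, min (famDensity μ φ z ^ (5 / 3 : ℝ))
        (γ * famDensity μ φ z ^ (4 / 3 : ℝ))) ≤
      γ * ∫⁻ z in Metric.ball x L, famDensity μ φ z ^ (4 / 3 : ℝ) := by
    rw [← lintegral_const_mul' _ _ ENNReal.coe_ne_top]
    exact lintegral_mono fun z => min_le_right _ _
  generalize (∫⁻ z in Metric.ball x (4 * L), famKinetic μ A φ z) = E4 at *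
  generalize (∫⁻ z in Metric.ball x (4 * L), famDensity μ φ z) = m4 at *
  generalize (∫⁻ z in Metric.ball x (4 * L), ‖fderiv ℝ A z‖ₑ ^ 2) = b at *
  generalize (∫⁻ z in Metric.ball x (2 * L), famKinetic μ A φ z) = E at *
  generalize (∫⁻ z in Metric.ball x (2 * L), famDensity μ φ z) = m at *
  generalize (∫⁻ z in Metric.ball x L, famDensity μ φ z) = n at *
  generalize (∫⁻ z in Metric.ball x L, min (famDensity μ φ z ^ (5 / 3 : ℝ))
        (γ * famDensity μ φ z ^ (4 / 3 : ℝ))) = F at *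
  have hpos : (((9 * c ^ 3 : ℝ≥0) : ℝ≥0∞) * Λ ^ 2) ≠ 0 := by
    have : 9 * c ^ 3 * Λ ^ 2 ≠ 0 := by positivity
    exact_mod_cast this
  by_cases hfin : E4 + γ * b = ∞
  · have h0 : ((9 * c ^ 3 : ℝ≥0) : ℝ≥0∞) * Λ ^ 2 * (E4 + γ * b) = ∞ := by
      rw [hfin, ENNReal.mul_top hpos]
    refine ⟨?_, fun κ _ _ => ?_⟩
    · rw [mul_add, h0, top_add]; exact le_top
    · rw [h0, add_top]; exact le_top
  have hmfin : m ≠ ∞ := ne_top_of_le_ne_top ENNReal.coe_ne_top hmΛ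
  have hnfin : n ≠ ∞ := ne_top_of_le_ne_top hmfin hnm
  have hEfin4 : E4 ≠ ∞ := fun h0 => hfin (by rw [h0, top_add])
  have hEfin : E ≠ ∞ := ne_top_of_le_ne_top hEfin4 hE4
  have hbfin : b ≠ ∞ := fun h0 => hfin (by
    rw [h0, ENNReal.mul_top (by exact_mod_cast hγ.ne'), add_top])
  have hq : ENNReal.ofReal (L : ℝ)⁻¹ = ((L⁻¹ : ℝ≥0) : ℝ≥0∞) := by
    rw [← NNReal.coe_inv, ENNReal.ofReal_coe_nnreal]
  lift m to ℝ≥0 using hmfin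
  lift n to ℝ≥0 using hnfin
  lift G to ℝ≥0 using hG
  lift E to ℝ≥0 using hEfin
  lift b to ℝ≥0 using hbfin
  have hmΛ' : m ≤ Λ := by exact_mod_cast hmΛ
  have hnm' : n ≤ m := by exact_mod_cast hnm
  have hnΛ : n ≤ Λ := hnm'.trans hmΛ'
  have hpow : ∀ p : ℝ, p ≤ 1 → Λ ^ p ≤ Λ := fun p hp => by
    simpa using NNReal.rpow_le_rpow_of_exponent_le hΛ hp
  have hFG : F ≤ ((c * (Λ * G) : ℝ≥0) : ℝ≥0∞) := by
    refine (hF1.trans hii).trans ?_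
    rw [← ENNReal.coe_rpow_of_nonneg _ (by norm_num)]
    push_cast
    gcongr
    exact (NNReal.rpow_le_rpow hnΛ (by norm_num)).trans (hpow _ (by norm_num))
  have hFg : F ≤ ((γ * (c * (Λ * NNReal.sqrt G)) : ℝ≥0) : ℝ≥0∞) := by
    refine hF2.trans ?_
    rw [ENNReal.coe_mul]
    gcongr
    refine hiii.trans ?_
    rw [← ENNReal.coe_rpow_of_nonneg _ (by norm_num), ← ENNReal.coe_rpow_of_nonneg _ (by norm_num),
      ← ENNReal.coe_rpow_of_nonneg _ (by norm_num), ← mul_assoc (_ : ℝ≥0∞) _ ((G ^ _ : ℝ≥0) : ℝ≥0∞),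
      NNReal.sqrt_eq_rpow]
    push_cast
    gcongr
    norm_cast
    calc n ^ (1 / 3 : ℝ) * m ^ (1 / 2 : ℝ) ≤ Λ ^ (1 / 3 : ℝ) * Λ ^ (1 / 2 : ℝ) := by gcongr
      _ = Λ ^ (5 / 6 : ℝ) := by
          rw [← NNReal.rpow_add (by positivity)]; norm_num
      _ ≤ Λ := hpow _ (by norm_num)
  have hFfin : F ≠ ∞ := ne_top_of_le_ne_top ENNReal.coe_ne_top hFG
  lift F to ℝ≥0 using hFfin
  have hFG' : (F : ℝ) ≤ c * (Λ * (NNReal.sqrt G : ℝ) ^ 2) := by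
    rw [← NNReal.coe_pow, NNReal.sq_sqrt]
    exact_mod_cast hFG
  have hFg' : (F : ℝ) ≤ γ * (c * (Λ * NNReal.sqrt G)) := by exact_mod_cast hFg
  have hi' : (NNReal.sqrt G : ℝ) ^ 2 ≤ c * (E + ((L⁻¹ : ℝ≥0) : ℝ) ^ 2 * m +
      b * (NNReal.sqrt m * NNReal.sqrt G)) := by
    rw [← NNReal.coe_pow, NNReal.sq_sqrt]
    have h0 : G ≤ c * (E + L⁻¹ ^ 2 * m + b * (NNReal.sqrt m * NNReal.sqrt G)) := by
      rw [← ENNReal.coe_le_coe]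
      refine hi.trans ?_
      rw [hq, ← ENNReal.coe_rpow_of_nonneg _ (by norm_num),
        ← ENNReal.coe_rpow_of_nonneg _ (by norm_num), NNReal.sqrt_eq_rpow, NNReal.sqrt_eq_rpow]
      push_cast
      gcongr
    exact_mod_cast h0
  have hs : (NNReal.sqrt m : ℝ) ^ 2 = m := by rw [← NNReal.coe_pow, NNReal.sq_sqrt]
  have hc1' : (1 : ℝ) ≤ c := by exact_mod_cast hc1
  have hΛ1' : (1 : ℝ) ≤ Λ := by exact_mod_cast hΛ
  have hL' : (0 : ℝ) < (L⁻¹ : ℝ≥0) := by exact_mod_cast inv_pos.2 hL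
  have hγ' : (0 : ℝ) < γ := by exact_mod_cast hγ
  refine ⟨?_, fun κ hκ hκ1 => ?_⟩
  · have h0 := le_of_uncertainty_bounds hc1' hΛ1' hγ' E.coe_nonneg b.coe_nonneg hL' hs
      (by exact_mod_cast hmΛ') hi' hFG' hFg'
    have h1 : F ≤ 9 * c ^ 3 * Λ ^ 2 * (E + γ * b + min (L⁻¹ ^ 2) (γ * L⁻¹)) := by
      exact_mod_cast h0
    calc (F : ℝ≥0∞) ≤ ((9 * c ^ 3 * Λ ^ 2 * (E + γ * b + min (L⁻¹ ^ 2) (γ * L⁻¹)) : ℝ≥0) : ℝ≥0∞) :=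
          ENNReal.coe_le_coe.2 h1
      _ = (9 * c ^ 3 : ℝ≥0) * Λ ^ 2 * (E + γ * b + (min (L⁻¹ ^ 2) (γ * L⁻¹) : ℝ≥0)) := by
          push_cast; rfl
      _ ≤ _ := by gcongr
  · have hn : (n : ℝ) ≤ c * (((κ : ℝ) ^ 3)⁻¹ + (κ : ℝ) ^ 2 * (((L⁻¹ : ℝ≥0) : ℝ)⁻¹ ^ 2 *
        (NNReal.sqrt G : ℝ) ^ 2)) := by
      rw [← NNReal.coe_pow (NNReal.sqrt G), NNReal.sq_sqrt]
      have h0 := hiv (κ * L) (by positivity)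
      have h2 : n ≤ c * ((κ ^ 3)⁻¹ + κ ^ 2 * (L⁻¹⁻¹ ^ 2 * G)) := by
        rw [← ENNReal.coe_le_coe]
        refine h0.trans ?_
        have e1 : ENNReal.ofReal (((κ : ℝ) * L) ^ 3)⁻¹ * ENNReal.ofReal ((L : ℝ) ^ 3) =
            (((κ ^ 3)⁻¹ : ℝ≥0) : ℝ≥0∞) := by
          rw [← ENNReal.ofReal_mul (by positivity), ← ENNReal.ofReal_coe_nnreal]
          congr 1
          push_cast
          field_simp
        have e2 : ENNReal.ofReal (((κ : ℝ) * L) ^ 2) = ((κ ^ 2 * L⁻¹⁻¹ ^ 2 : ℝ≥0) : ℝ≥0∞) := by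
          rw [← ENNReal.ofReal_coe_nnreal]
          congr 1
          push_cast
          rw [inv_inv]
          ring
        rw [e1, e2, ← mul_assoc (κ ^ 2), ENNReal.coe_mul c, ENNReal.coe_add, ENNReal.coe_mul _ G]
        gcongr
      exact_mod_cast h2
    have h0 := le_of_exclusion_bound hc1' hΛ1' hγ' E.coe_nonneg b.coe_nonneg hL'
      hs (by exact_mod_cast hmΛ') (by exact_mod_cast hnm')
      (by exact_mod_cast hκ) (by exact_mod_cast hκ1) hi' hn
    have h1 : min (L⁻¹ ^ 2) (γ * L⁻¹) * n ≤ c * (κ ^ 3)⁻¹ * min (L⁻¹ ^ 2) (γ * L⁻¹) +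
        c ^ 2 * κ ^ 2 * (min (L⁻¹ ^ 2) (γ * L⁻¹) * m) + 3 * c ^ 3 * Λ ^ 2 * (E + γ * b) := by
      exact_mod_cast h0
    have hcc : c ≤ 9 * c ^ 3 := by
      calc c = 1 * c ^ 1 := by ring
        _ ≤ _ := by gcongr <;> norm_num
    have hcc2 : c ^ 2 ≤ 9 * c ^ 3 := by
      calc c ^ 2 = 1 * c ^ 2 := by ring
        _ ≤ _ := by gcongr <;> norm_num
    have hcc3 : 3 * c ^ 3 ≤ 9 * c ^ 3 := by gcongr; norm_num
    generalize min (L⁻¹ ^ 2) (γ * L⁻¹) = ω at *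
    calc (ω : ℝ≥0∞) * n = ((ω * n : ℝ≥0) : ℝ≥0∞) := by push_cast; rfl
      _ ≤ ((9 * c ^ 3 * (κ ^ 3)⁻¹ * ω + 9 * c ^ 3 * κ ^ 2 * (ω * m) +
          9 * c ^ 3 * Λ ^ 2 * (E + γ * b) : ℝ≥0) : ℝ≥0∞) := by
          refine ENNReal.coe_le_coe.2 (h1.trans ?_)
          gcongr
      _ = (9 * c ^ 3 : ℝ≥0) * ((κ ^ 3)⁻¹ : ℝ≥0) * ω + (9 * c ^ 3 : ℝ≥0) * κ ^ 2 * (ω * m) +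
          (9 * c ^ 3 : ℝ≥0) * Λ ^ 2 * (E + γ * b) := by
          rw [ENNReal.coe_add, ENNReal.coe_add]; simp only [ENNReal.coe_mul, ENNReal.coe_pow,
            ENNReal.coe_add]
      _ ≤ _ := by gcongr

end LocalEstimate

section Averaging

variable {L : E3 → ℝ≥0}

/-- Tonelli's theorem for averages over balls of variable radius. -/
lemma lintegral_mul_setLIntegral_ball (hL : Continuous L) (c : ℝ) {f h : E3 → ℝ≥0∞}
    (hf : Measurable f) (hh : Measurable h) :
    ∫⁻ x, f x * ∫⁻ y in Metric.ball x (c * L x), h y =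
      ∫⁻ y, h y * ∫⁻ x in {x | dist y x < c * L x}, f x := by
  have hL' : Continuous fun x => (L x : ℝ) := NNReal.continuous_coe.comp hL
  have hS : MeasurableSet {p : E3 × E3 | dist p.2 p.1 < c * L p.1} :=
    (isOpen_lt (continuous_snd.dist continuous_fst)
      (continuous_const.mul (hL'.comp continuous_fst))).measurableSet
  have hm : Measurable fun p : E3 × E3 =>
      {p : E3 × E3 | dist p.2 p.1 < c * L p.1}.indicator (fun p => f p.1 * h p.2) p :=
    Measurable.indicator ((hf.comp measurable_fst).mul (hh.comp measurable_snd)) hS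
  have h1 : ∀ x, f x * ∫⁻ y in Metric.ball x (c * L x), h y =
      ∫⁻ y, {p : E3 × E3 | dist p.2 p.1 < c * L p.1}.indicator (fun p => f p.1 * h p.2) (x, y) := by
    intro x
    rw [← lintegral_const_mul _ hh, ← lintegral_indicator Metric.isOpen_ball.measurableSet]
    rfl
  have h2 : ∀ y, h y * ∫⁻ x in {x | dist y x < c * L x}, f x =
      ∫⁻ x, {p : E3 × E3 | dist p.2 p.1 < c * L p.1}.indicator (fun p => f p.1 * h p.2) (x, y) := by
    intro y
    have hSy : MeasurableSet {x | dist y x < c * L x} :=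
      (isOpen_lt (continuous_const.dist continuous_id) (continuous_const.mul hL')).measurableSet
    rw [← lintegral_const_mul _ hf, ← lintegral_indicator hSy]
    refine lintegral_congr fun x => ?_
    simp only [Set.indicator, Set.mem_ofPred_eq, mul_comm]
  simp_rw [h1, h2]
  exact lintegral_lintegral_swap hm.aemeasurable

lemma measurable_setLIntegral_ball (hL : Continuous L) (c : ℝ) {h : E3 → ℝ≥0∞} (hh : Measurable h) :
    Measurable fun x => ∫⁻ y in Metric.ball x (c * L x), h y := by
  have hL' : Continuous fun x => (L x : ℝ) := NNReal.continuous_coe.comp hL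
  have hS : MeasurableSet {p : E3 × E3 | dist p.2 p.1 < c * L p.1} :=
    (isOpen_lt (continuous_snd.dist continuous_fst)
      (continuous_const.mul (hL'.comp continuous_fst))).measurableSet
  have hm : Measurable fun p : E3 × E3 =>
      {p : E3 × E3 | dist p.2 p.1 < c * L p.1}.indicator (fun p => h p.2) p :=
    Measurable.indicator (hh.comp measurable_snd) hS
  have h1 : ∀ x, ∫⁻ y in Metric.ball x (c * L x), h y =
      ∫⁻ y, {p : E3 × E3 | dist p.2 p.1 < c * L p.1}.indicator (fun p => h p.2) (x, y) := by
    intro x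
    rw [← lintegral_indicator Metric.isOpen_ball.measurableSet]
    rfl
  simp_rw [h1]
  exact hm.lintegral_prod_right'

lemma volume_ball_E3 (x : E3) {r : ℝ} (hr : 0 ≤ r) :
    volume (Metric.ball x r) = ENNReal.ofReal ((2 * r) ^ 3) := by
  rcases hr.eq_or_lt with rfl | hr
  · simp
  · rw [Real.volume_pi_ball _ hr]; simp

lemma inv_cube_mul_ofReal {l c : ℝ≥0} (hl : 0 < l) :
    (((l ^ 3)⁻¹ : ℝ≥0) : ℝ≥0∞) * ENNReal.ofReal ((c * l) ^ 3) = (c ^ 3 : ℝ≥0) := by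
  rw [← ENNReal.ofReal_coe_nnreal, ← ENNReal.ofReal_mul (by positivity),
    ← ENNReal.ofReal_coe_nnreal]
  congr 1
  push_cast
  have : (l : ℝ) ≠ 0 := by exact_mod_cast hl.ne'
  field_simp

lemma continuous_of_le_add_dist
    (hLip : ∀ x y, (L x : ℝ) ≤ L y + dist x y / 8) : Continuous L := by
  have : LipschitzWith 1 L := by
    refine LipschitzWith.of_dist_le_mul fun x y => ?_
    rw [NNReal.dist_eq, NNReal.coe_one, one_mul, abs_le]
    have h1 := hLip x y
    have h2 := hLip y x
    rw [dist_comm y x] at h2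
    have := dist_nonneg (x := x) (y := y)
    constructor <;> linarith
  exact this.continuous

lemma inv_cube_le {s t c : ℝ≥0} (hs : 0 < s) (h : s ≤ c * t) :
    (t ^ 3)⁻¹ ≤ c ^ 3 * (s ^ 3)⁻¹ := by
  rcases eq_or_ne t 0 with rfl | ht
  · simp
  have ht : 0 < t := pos_iff_ne_zero.2 ht
  have hst : s ^ 3 ≤ c ^ 3 * t ^ 3 := by rw [← mul_pow]; gcongr
  rw [inv_le_iff_one_le_mul₀ (by positivity), mul_assoc, mul_comm _ (t ^ 3), ← mul_assoc,
    ← div_eq_mul_inv, le_div_iff₀ (by positivity), one_mul]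
  exact hst

/-- Averaging over balls of variable radius is bounded. -/
lemma lintegral_average_le (hL : ∀ x, 0 < L x)
    (hLip : ∀ x y, (L x : ℝ) ≤ L y + dist x y / 8)
    {w h : E3 → ℝ≥0∞} (hw : Measurable w) (hh : Measurable h) {a : ℝ≥0}
    (ha : ∀ x y, dist x y < 4 * L x → w x ≤ a * w y) :
    ∫⁻ x, (((L x ^ 3)⁻¹ : ℝ≥0) : ℝ≥0∞) * w x * ∫⁻ y in Metric.ball x (4 * L x), h y ≤
      13824 * a * ∫⁻ y, w y * h y := by
  have hLc := continuous_of_le_add_dist hLip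
  have hm : Measurable fun x => (((L x ^ 3)⁻¹ : ℝ≥0) : ℝ≥0∞) :=
    ((hLc.measurable.pow_const 3).inv).coe_nnreal_ennreal
  rw [lintegral_mul_setLIntegral_ball hLc 4
    (f := fun x => (((L x ^ 3)⁻¹ : ℝ≥0) : ℝ≥0∞) * w x) (hm.mul hw) hh, 
    ← lintegral_const_mul' _ _ (by finiteness)]
  refine lintegral_mono fun y => ?_
  have key : ∫⁻ x in {x | dist y x < 4 * L x}, (((L x ^ 3)⁻¹ : ℝ≥0) : ℝ≥0∞) * w x ≤
      13824 * a * w y := by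
    calc ∫⁻ x in {x | dist y x < 4 * L x}, (((L x ^ 3)⁻¹ : ℝ≥0) : ℝ≥0∞) * w x
        ≤ ∫⁻ x in {x | dist y x < 4 * L x},
            (((3 / 2) ^ 3 * (L y ^ 3)⁻¹ : ℝ≥0) : ℝ≥0∞) * (a * w y) := by
          refine setLIntegral_mono' ?_ fun x hx => ?_
          · exact (isOpen_lt (continuous_const.dist continuous_id)
              (continuous_const.mul (NNReal.continuous_coe.comp hLc))).measurableSet
          · have hx : dist y x < 4 * L x := hx
            refine mul_le_mul' (ENNReal.coe_le_coe.2 (inv_cube_le (hL y) ?_))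
              (ha x y (by rwa [dist_comm]))
            rw [← NNReal.coe_le_coe]
            push_cast
            linarith [hLip y x]
      _ ≤ ∫⁻ x in Metric.ball y (8 * L y),
            (((3 / 2) ^ 3 * (L y ^ 3)⁻¹ : ℝ≥0) : ℝ≥0∞) * (a * w y) := by
          refine lintegral_mono_set fun x hx => ?_
          have hx : dist y x < 4 * L x := hx
          have := hLip x y
          rw [dist_comm] at this
          rw [Metric.mem_ball, dist_comm]
          linarith
      _ = 13824 * a * w y := by
          rw [setLIntegral_const, volume_ball_E3 _ (by positivity), ENNReal.coe_mul]
          have := inv_cube_mul_ofReal (c := 16) (hL y)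
          push_cast at this
          rw [← mul_assoc 2, show (2 : ℝ) * 8 = 16 by norm_num]
          calc _ = (((3 / 2) ^ 3 : ℝ≥0) : ℝ≥0∞) * ((((L y ^ 3)⁻¹ : ℝ≥0) : ℝ≥0∞) *
                ENNReal.ofReal ((16 * L y) ^ 3)) * a * w y := by ring
            _ = _ := by
                rw [this]
                congr 2
                have : ((3 / 2) ^ 3 * 16 ^ 3 : ℝ≥0) = 13824 := by norm_num
                exact_mod_cast congrArg (fun t : ℝ≥0 => (t : ℝ≥0∞)) this
  calc h y * _ ≤ h y * (13824 * a * w y) := by gcongr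
    _ = _ := by ring

/-- Averaging over balls of variable radius is bounded from below. -/
lemma lintegral_le_average (hL : ∀ x, 0 < L x)
    (hLip : ∀ x y, (L x : ℝ) ≤ L y + dist x y / 8)
    {w h : E3 → ℝ≥0∞} (hw : Measurable w) (hh : Measurable h) {a : ℝ≥0}
    (ha : ∀ x y, dist x y < 4 * L x → w x ≤ a * w y) :
    ∫⁻ y, w y * h y ≤
      8 * a * ∫⁻ x, (((L x ^ 3)⁻¹ : ℝ≥0) : ℝ≥0∞) * w x * ∫⁻ y in Metric.ball x (L x), h y := by
  have hLc := continuous_of_le_add_dist hLip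
  have hm : Measurable fun x => (((L x ^ 3)⁻¹ : ℝ≥0) : ℝ≥0∞) :=
    ((hLc.measurable.pow_const 3).inv).coe_nnreal_ennreal
  have h0 := lintegral_mul_setLIntegral_ball hLc 1
    (f := fun x => (((L x ^ 3)⁻¹ : ℝ≥0) : ℝ≥0∞) * w x) (hm.mul hw) hh
  simp only [one_mul] at h0
  rw [h0]
  have hSy : ∀ y, MeasurableSet {x | dist y x < L x} := fun y =>
    (isOpen_lt (continuous_const.dist continuous_id)
              (NNReal.continuous_coe.comp hLc)).measurableSet
  have key : ∀ y, w y ≤ 8 * a *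
      ∫⁻ x in {x | dist y x < L x}, (((L x ^ 3)⁻¹ : ℝ≥0) : ℝ≥0∞) * w x := by
    intro y
    rw [← lintegral_const_mul' _ _ (by finiteness)]
    calc w y = ∫⁻ x in Metric.ball y (L y / 2), (((L y ^ 3)⁻¹ : ℝ≥0) : ℝ≥0∞) * w y := by
          rw [setLIntegral_const, volume_ball_E3 _ (by positivity)]
          have := inv_cube_mul_ofReal (c := 1) (hL y)
          push_cast at this
          rw [mul_div_cancel₀ _ (by norm_num : (2 : ℝ) ≠ 0), mul_right_comm]
          simp only [one_mul] at this
          rw [this]; simp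
      _ ≤ ∫⁻ x in Metric.ball y (L y / 2),
            8 * a * ((((L x ^ 3)⁻¹ : ℝ≥0) : ℝ≥0∞) * w x) := by
          refine setLIntegral_mono' Metric.isOpen_ball.measurableSet fun x hx => ?_
          rw [Metric.mem_ball] at hx
          have h1 : (((L y ^ 3)⁻¹ : ℝ≥0) : ℝ≥0∞) ≤ 8 * (((L x ^ 3)⁻¹ : ℝ≥0) : ℝ≥0∞) := by
            have := inv_cube_le (c := 2) (t := L y) (hL x) (by
              rw [← NNReal.coe_le_coe]; push_cast; linarith [hLip x y, (L y).coe_nonneg])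
            have h8 : (2 : ℝ≥0) ^ 3 = 8 := by norm_num
            rw [h8] at this
            exact_mod_cast ENNReal.coe_le_coe.2 this
          have h2 : w y ≤ a * w x := ha y x (by
            rw [dist_comm]; linarith [(L y).coe_nonneg])
          calc _ ≤ 8 * (((L x ^ 3)⁻¹ : ℝ≥0) : ℝ≥0∞) * (a * w x) := mul_le_mul' h1 h2
            _ = _ := by ring
      _ ≤ _ := by
          refine lintegral_mono_set fun x hx => ?_
          rw [Metric.mem_ball] at hx
          have := hLip y x
          rw [dist_comm y x] at this
          have h3 : (0 : ℝ) < L y := hL y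
          change dist y x < L x
          rw [dist_comm]
          linarith
  rw [← lintegral_const_mul' _ _ (by finiteness)]
  refine lintegral_mono fun y => ?_
  calc w y * h y ≤ 8 * a * (∫⁻ x in {x | dist y x < L x},
        (((L x ^ 3)⁻¹ : ℝ≥0) : ℝ≥0∞) * w x) * h y := by gcongr; exact key y
    _ = _ := by ring

lemma inv_le_mul_inv {s t c : ℝ≥0} (hs : 0 < s) (h : s ≤ c * t) : t⁻¹ ≤ c * s⁻¹ := by
  rcases eq_or_ne t 0 with rfl | ht
  · simp
  rw [inv_le_iff_one_le_mul₀ (pos_iff_ne_zero.2 ht), mul_right_comm, ← div_eq_mul_inv,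
    le_div_iff₀ hs, one_mul]
  exact h

lemma min_inv_le {γ s t : ℝ≥0} (hs : 0 < s) (h : s ≤ 2 * t) :
    min (t⁻¹ ^ 2) (γ * t⁻¹) ≤ 4 * min (s⁻¹ ^ 2) (γ * s⁻¹) := by
  have h1 : t⁻¹ ≤ 2 * s⁻¹ := by simpa using inv_le_mul_inv hs h
  rw [mul_min_of_nonneg _ _ (by positivity)]
  refine min_le_min ?_ ?_
  · calc t⁻¹ ^ 2 ≤ (2 * s⁻¹) ^ 2 := by gcongr
      _ = _ := by ring
  · calc γ * t⁻¹ ≤ γ * (2 * s⁻¹) := by gcongr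
      _ = 2 * (γ * s⁻¹) := by ring
      _ ≤ _ := by gcongr; norm_num

lemma inv_cube_mul_min_le {γ l D t : ℝ≥0} (hl : 0 < l) (hlD : l ≤ D) (hD : D ≤ 19 * t) :
    (t ^ 3)⁻¹ * min (t⁻¹ ^ 2) (γ * t⁻¹) ≤
      19 ^ 5 * (l * min (l⁻¹ ^ 2) (γ * l⁻¹)) * (D ^ 4)⁻¹ := by
  have hDp : 0 < D := hl.trans_le hlD
  have h1 : t⁻¹ ≤ 19 * D⁻¹ := by
    have htp : 0 < t := by
      rcases eq_or_ne t 0 with rfl | ht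
      · simp at hD; exact absurd hD hDp.ne'
      · exact pos_iff_ne_zero.2 ht
    rw [inv_le_iff_one_le_mul₀ htp, mul_right_comm, ← div_eq_mul_inv, le_div_iff₀ hDp, one_mul]
    exact hD
  have h2 : D⁻¹ ≤ l⁻¹ := by gcongr
  rcases le_total (l⁻¹ ^ 2) (γ * l⁻¹) with h | h
  · rw [min_eq_left h]
    calc (t ^ 3)⁻¹ * min (t⁻¹ ^ 2) (γ * t⁻¹) ≤ (t ^ 3)⁻¹ * t⁻¹ ^ 2 := by
          gcongr; exact min_le_left _ _
      _ = t⁻¹ ^ 5 := by rw [← inv_pow]; ring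
      _ ≤ (19 * D⁻¹) ^ 5 := by gcongr
      _ = 19 ^ 5 * D⁻¹ * D⁻¹ ^ 4 := by ring
      _ ≤ 19 ^ 5 * l⁻¹ * D⁻¹ ^ 4 := by gcongr
      _ = _ := by
          rw [inv_pow D, pow_two, ← mul_assoc l, mul_inv_cancel₀ hl.ne', one_mul]
  · rw [min_eq_right h]
    calc (t ^ 3)⁻¹ * min (t⁻¹ ^ 2) (γ * t⁻¹) ≤ (t ^ 3)⁻¹ * (γ * t⁻¹) := by
          gcongr; exact min_le_right _ _
      _ = γ * t⁻¹ ^ 4 := by rw [← inv_pow]; ring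
      _ ≤ γ * (19 * D⁻¹) ^ 4 := by gcongr
      _ = 19 ^ 4 * γ * D⁻¹ ^ 4 := by ring
      _ ≤ 19 ^ 5 * γ * D⁻¹ ^ 4 := by gcongr <;> norm_num
      _ = _ := by
          rw [inv_pow D, mul_left_comm l, mul_inv_cancel₀ hl.ne', mul_one]

lemma exists_lintegral_decay : ∃ I : ℝ≥0, ∀ (y : E3) (l : ℝ≥0), 0 < l →
    ∫⁻ x, ((((l + nndist x y) ^ 4)⁻¹ : ℝ≥0) : ℝ≥0∞) = (l⁻¹ : ℝ≥0) * I := by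
  have hfin : ∫⁻ x : E3, ENNReal.ofReal ((1 + ‖x‖) ^ (-(4 : ℝ))) < ∞ :=
    finite_integral_one_add_norm (by simp; norm_num)
  have hI : ∫⁻ x : E3, ((((1 + ‖x‖₊) ^ 4)⁻¹ : ℝ≥0) : ℝ≥0∞) ≠ ∞ := by
    refine (lt_of_le_of_lt (lintegral_mono fun x => ?_) hfin).ne
    rw [← ENNReal.ofReal_coe_nnreal]
    apply ENNReal.ofReal_le_ofReal
    rw [Real.rpow_neg (by positivity)]
    push_cast
    norm_cast
  refine ⟨(∫⁻ x : E3, ((((1 + ‖x‖₊) ^ 4)⁻¹ : ℝ≥0) : ℝ≥0∞)).toNNReal, fun y l hl => ?_⟩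
  rw [ENNReal.coe_toNNReal hI]
  have hm : Measurable fun x : E3 => ((((l + nndist x y) ^ 4)⁻¹ : ℝ≥0) : ℝ≥0∞) :=
    ((measurable_const.add (measurable_id.nndist measurable_const)).pow_const 4).inv.coe_nnreal_ennreal
  have h := lintegral_comp_smul_add _ hm (c := l) hl y
  have h2 : ∀ w : E3, ((((l + nndist ((l : ℝ) • w + y) y) ^ 4)⁻¹ : ℝ≥0) : ℝ≥0∞) =
      (((l ^ 4)⁻¹ : ℝ≥0) : ℝ≥0∞) * ((((1 + ‖w‖₊) ^ 4)⁻¹ : ℝ≥0) : ℝ≥0∞) := by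
    intro w
    rw [← ENNReal.coe_mul, ← mul_inv, ← mul_pow, nndist_eq_nnnorm, add_sub_cancel_right,
      nnnorm_smul, mul_add, mul_one]
    simp
  simp_rw [h2] at h
  rw [lintegral_const_mul' _ _ (by finiteness)] at h
  have h3 : ENNReal.ofReal (((l : ℝ) ^ 3)⁻¹) = ((l ^ 3)⁻¹ : ℝ≥0) := by
    rw [← ENNReal.ofReal_coe_nnreal]; push_cast; rfl
  rw [h3] at h
  have h4 : ((l ^ 3 : ℝ≥0) : ℝ≥0∞) * ((l ^ 3)⁻¹ : ℝ≥0) = 1 := by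
    rw [← ENNReal.coe_mul, mul_inv_cancel₀ (by positivity)]; rfl
  have h5 : ((l ^ 3 : ℝ≥0) : ℝ≥0∞) * ((l ^ 4)⁻¹ : ℝ≥0) = (l⁻¹ : ℝ≥0) := by
    rw [← ENNReal.coe_mul]; congr 1; field_simp
  calc _ = ((l ^ 3 : ℝ≥0) : ℝ≥0∞) * (((l ^ 3)⁻¹ : ℝ≥0) *
        ∫⁻ x : E3, ((((l + nndist x y) ^ 4)⁻¹ : ℝ≥0) : ℝ≥0∞)) := by
        rw [← mul_assoc, h4, one_mul]
    _ = _ := by rw [← h, ← mul_assoc, h5]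

end Averaging

section GlobalEstimate

lemma exists_decay_sum_le : ∃ I : ℝ≥0, ∀ (L : E3 → ℝ≥0) (γ Λ : ℝ≥0) (ρ : E3 → ℝ≥0∞),
    (∀ x, 0 < L x) → (∀ x y, (L x : ℝ) ≤ L y + dist x y / 8) → Measurable ρ →
    (∀ x, Λ ≤ ∫⁻ z in Metric.ball x (16 * L x), ρ z) →
    Λ * ∫⁻ x, (((L x ^ 3)⁻¹ : ℝ≥0) : ℝ≥0∞) * (min ((L x)⁻¹ ^ 2) (γ * (L x)⁻¹) : ℝ≥0) ≤
      I * ∫⁻ x, (min ((L x)⁻¹ ^ 2) (γ * (L x)⁻¹) : ℝ≥0) * ρ x := by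
  obtain ⟨I, hI⟩ := exists_lintegral_decay
  refine ⟨19 ^ 5 * I, fun L γ Λ ρ hL hLip hρ hm => ?_⟩
  have hLc := continuous_of_le_add_dist hLip
  have hLm := hLc.measurable
  have hw : Measurable fun x => (((min ((L x)⁻¹ ^ 2) (γ * (L x)⁻¹) : ℝ≥0)) : ℝ≥0∞) :=
    ((hLm.inv.pow_const 2).min (hLm.inv.const_mul γ)).coe_nnreal_ennreal
  have hm3 : Measurable fun x => (((L x ^ 3)⁻¹ : ℝ≥0) : ℝ≥0∞) :=
    ((hLm.pow_const 3).inv).coe_nnreal_ennreal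
  have hf : Measurable fun x => (((L x ^ 3)⁻¹ : ℝ≥0) : ℝ≥0∞) *
      (min ((L x)⁻¹ ^ 2) (γ * (L x)⁻¹) : ℝ≥0) := hm3.mul hw
  calc Λ * ∫⁻ x, (((L x ^ 3)⁻¹ : ℝ≥0) : ℝ≥0∞) * (min ((L x)⁻¹ ^ 2) (γ * (L x)⁻¹) : ℝ≥0)
      = ∫⁻ x, (((L x ^ 3)⁻¹ : ℝ≥0) : ℝ≥0∞) * (min ((L x)⁻¹ ^ 2) (γ * (L x)⁻¹) : ℝ≥0) * Λ := by
        rw [lintegral_mul_const _ hf, mul_comm]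
    _ ≤ ∫⁻ x, (((L x ^ 3)⁻¹ : ℝ≥0) : ℝ≥0∞) * (min ((L x)⁻¹ ^ 2) (γ * (L x)⁻¹) : ℝ≥0) *
          ∫⁻ z in Metric.ball x (16 * L x), ρ z :=
        lintegral_mono fun x => mul_le_mul_right (hm x) _
    _ = ∫⁻ y, ρ y * ∫⁻ x in {x | dist y x < 16 * L x}, (((L x ^ 3)⁻¹ : ℝ≥0) : ℝ≥0∞) *
          (min ((L x)⁻¹ ^ 2) (γ * (L x)⁻¹) : ℝ≥0) := lintegral_mul_setLIntegral_ball hLc 16 hf hρ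
    _ ≤ ∫⁻ y, (19 ^ 5 * I : ℝ≥0) * ((min ((L y)⁻¹ ^ 2) (γ * (L y)⁻¹) : ℝ≥0) * ρ y) := by
        refine lintegral_mono fun y => ?_
        have key : ∫⁻ x in {x | dist y x < 16 * L x}, (((L x ^ 3)⁻¹ : ℝ≥0) : ℝ≥0∞) *
            (min ((L x)⁻¹ ^ 2) (γ * (L x)⁻¹) : ℝ≥0) ≤
            (19 ^ 5 * I : ℝ≥0) * (min ((L y)⁻¹ ^ 2) (γ * (L y)⁻¹) : ℝ≥0) := by
          calc ∫⁻ x in {x | dist y x < 16 * L x}, (((L x ^ 3)⁻¹ : ℝ≥0) : ℝ≥0∞) *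
                (min ((L x)⁻¹ ^ 2) (γ * (L x)⁻¹) : ℝ≥0)
              ≤ ∫⁻ x in {x | dist y x < 16 * L x},
                ((19 ^ 5 * (L y * min ((L y)⁻¹ ^ 2) (γ * (L y)⁻¹)) : ℝ≥0) : ℝ≥0∞) *
                  ((((L y + nndist x y) ^ 4)⁻¹ : ℝ≥0) : ℝ≥0∞) := by
                refine setLIntegral_mono' ?_ fun x hx => ?_
                · exact (isOpen_lt (continuous_const.dist continuous_id)
                    (continuous_const.mul (NNReal.continuous_coe.comp hLc))).measurableSet
                · have hx : dist y x < 16 * L x := hx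
                  rw [← ENNReal.coe_mul, ← ENNReal.coe_mul]
                  refine ENNReal.coe_le_coe.2 (inv_cube_mul_min_le (hL y) le_self_add ?_)
                  rw [← NNReal.coe_le_coe]
                  push_cast
                  rw [dist_comm x y]
                  linarith [hLip y x]
            _ ≤ ∫⁻ x, ((19 ^ 5 * (L y * min ((L y)⁻¹ ^ 2) (γ * (L y)⁻¹)) : ℝ≥0) : ℝ≥0∞) *
                  ((((L y + nndist x y) ^ 4)⁻¹ : ℝ≥0) : ℝ≥0∞) := setLIntegral_le_lintegral _ _
            _ = _ := by
                rw [lintegral_const_mul' _ _ ENNReal.coe_ne_top, hI y _ (hL y),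
                  ← ENNReal.coe_mul, ← ENNReal.coe_mul, ← ENNReal.coe_mul]
                congr 1
                have := (hL y).ne'
                generalize min ((L y)⁻¹ ^ 2) (γ * (L y)⁻¹) = w
                field_simp
        calc ρ y * _ ≤ ρ y * ((19 ^ 5 * I : ℝ≥0) * (min ((L y)⁻¹ ^ 2) (γ * (L y)⁻¹) : ℝ≥0)) := by
              gcongr
          _ = _ := by ring
    _ = _ := lintegral_const_mul' _ _ ENNReal.coe_ne_top

lemma tendsto_setLIntegral_ball {ρ : E3 → ℝ≥0∞} (x : E3) :
    Filter.Tendsto (fun n : ℕ => ∫⁻ z in Metric.ball x (n : ℝ), ρ z) Filter.atTop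
      (nhds (∫⁻ z, ρ z)) := by
  have h := tendsto_measure_iUnion_atTop (μ := volume.withDensity ρ)
    (s := fun n : ℕ => Metric.ball x (n : ℝ)) (fun m n h => Metric.ball_subset_ball (by
      exact_mod_cast h))
  rw [Metric.iUnion_ball_nat] at h
  simpa [Function.comp_def, withDensity_apply _ Metric.isOpen_ball.measurableSet] using h

/-- The scale at which the mass of a ball reaches a given threshold. -/
lemma exists_scale {ρ : E3 → ℝ≥0∞} {Λ M : ℝ≥0} (hΛ : 1 ≤ Λ) (hM : ∀ x, ρ x ≤ M)
    (hmass : Λ < ∫⁻ z, ρ z) : ∃ L : E3 → ℝ≥0, (∃ r : ℝ≥0, 0 < r ∧ ∀ x, r ≤ L x) ∧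
      (∀ x y, (L x : ℝ) ≤ L y + dist x y / 8) ∧
      (∀ x, ∫⁻ z in Metric.ball x (2 * L x), ρ z ≤ Λ) ∧
      ∀ x, Λ ≤ ∫⁻ z in Metric.ball x (16 * L x), ρ z := by
  set S : E3 → Set ℝ := fun x => {r | 0 ≤ r ∧ ∫⁻ z in Metric.ball x r, ρ z ≤ Λ} with hS
  have hmono : ∀ x r r', r ≤ r' → r' ∈ S x → 0 ≤ r → r ∈ S x := fun x r r' h h' h0 =>
    ⟨h0, (lintegral_mono_set (Metric.ball_subset_ball h)).trans h'.2⟩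
  have hbdd : ∀ x, BddAbove (S x) := by
    intro x
    obtain ⟨n, hn⟩ := ((tendsto_setLIntegral_ball (ρ := ρ) x).eventually (lt_mem_nhds hmass)).exists
    refine ⟨n, fun r hr => ?_⟩
    by_contra! h
    exact absurd (hmono x n r h.le hr (Nat.cast_nonneg n)).2 (not_le.2 hn)
  have hr0 : ∀ x, (1 / (2 * (M + 1)) : ℝ) ∈ S x := by
    intro x
    refine ⟨by positivity, ?_⟩
    calc ∫⁻ z in Metric.ball x (1 / (2 * (M + 1)) : ℝ), ρ z
        ≤ ∫⁻ z in Metric.ball x (1 / (2 * (M + 1)) : ℝ), M := lintegral_mono fun z => hM z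
      _ = M * ENNReal.ofReal ((1 / (M + 1)) ^ 3) := by
          rw [setLIntegral_const, volume_ball_E3 _ (by positivity)]
          congr 3; field_simp
      _ ≤ 1 := by
          rw [← ENNReal.ofReal_coe_nnreal, ← ENNReal.ofReal_mul (by positivity),
            ← ENNReal.ofReal_one]
          apply ENNReal.ofReal_le_ofReal
          have h0 : (0 : ℝ) ≤ M := M.coe_nonneg
          have h1 : (1 / (M + 1) : ℝ) ≤ 1 := by rw [div_le_one (by positivity)]; linarith
          calc (M : ℝ) * (1 / (M + 1)) ^ 3 ≤ (M + 1) * (1 / (M + 1)) ^ 1 := by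
                gcongr ?_ * ?_
                · linarith
                · exact pow_le_pow_of_le_one (by positivity) h1 (by norm_num)
            _ = 1 := by field_simp
      _ ≤ Λ := by exact_mod_cast hΛ
  have hne : ∀ x, (S x).Nonempty := fun x => ⟨_, hr0 x⟩
  have hle : ∀ x, (1 / (2 * (M + 1)) : ℝ) ≤ sSup (S x) := fun x => le_csSup (hbdd x) (hr0 x)
  have hpos : ∀ x, 0 < sSup (S x) := fun x => lt_of_lt_of_le (by positivity) (hle x)
  obtain ⟨L, hL⟩ : ∃ L : E3 → ℝ≥0, ∀ x, (L x : ℝ) = sSup (S x) / 8 :=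
    ⟨fun x => (sSup (S x) / 8).toNNReal, fun x =>
      Real.coe_toNNReal _ (by linarith [hpos x])⟩
  refine ⟨L, ⟨(1 / (2 * (M + 1)) / 8 : ℝ≥0), by positivity, fun x => ?_⟩, fun x y => ?_,
    fun x => ?_, fun x => ?_⟩
  · rw [← NNReal.coe_le_coe, hL]
    push_cast
    linarith [hle x]
  · rw [hL, hL]
    have : sSup (S x) ≤ sSup (S y) + dist x y := by
      refine csSup_le (hne x) fun r hr => ?_
      rcases le_total r (dist x y) with h | h
      · linarith [hpos y]
      · have : r - dist x y ∈ S y := ⟨by linarith, (lintegral_mono_set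
          (Metric.ball_subset_ball' (by rw [dist_comm y x]; linarith))).trans hr.2⟩
        linarith [le_csSup (hbdd y) this]
    linarith
  · rw [hL]
    obtain ⟨r, hr, hlt⟩ := exists_lt_of_lt_csSup (hne x) (show 2 * (sSup (S x) / 8) < sSup (S x) by
      linarith [hpos x])
    exact (hmono x _ r hlt.le hr (by linarith [hpos x])).2
  · rw [hL]
    by_contra! h
    have : 16 * (sSup (S x) / 8) ∈ S x := ⟨by linarith [hpos x], h.le⟩
    linarith [le_csSup (hbdd x) this, hpos x]

lemma mul_le_mul_of_mul_le {Λ I c d : ℝ≥0} {J R : ℝ≥0∞} (hΛ : 1 ≤ Λ) (h : Λ * J ≤ I * R)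
    (hc : c * I ≤ d * Λ) : c * J ≤ d * R := by
  have hΛ0 : (Λ : ℝ≥0∞) ≠ 0 := by
    exact_mod_cast (zero_lt_one.trans_le hΛ).ne'
  have hc' : (c : ℝ≥0∞) * I ≤ d * Λ := by exact_mod_cast hc
  rw [← ENNReal.mul_le_mul_iff_right hΛ0 ENNReal.coe_ne_top]
  calc Λ * (c * J) = c * (Λ * J) := by ring
    _ ≤ c * (I * R) := by gcongr
    _ = (c * I) * R := by ring
    _ ≤ (d * Λ) * R := by gcongr
    _ = _ := by ring

lemma le_of_le_half_add {R X : ℝ≥0∞} (hR : R ≠ ∞) (h : R ≤ (1 / 2 : ℝ≥0) * R + X) : R ≤ 2 * X := by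
  rcases eq_or_ne X ∞ with rfl | hX
  · simp
  lift R to ℝ≥0 using hR
  lift X to ℝ≥0 using hX
  have h' : R ≤ 1 / 2 * R + X := by exact_mod_cast h
  have : R ≤ 2 * X := by
    rw [← NNReal.coe_le_coe] at h' ⊢
    push_cast at h' ⊢
    linarith
  exact_mod_cast this

/-- Estimates on all balls of controlled mass imply a global estimate. -/
lemma exists_global_of_local (C : ℝ≥0) : ∃ Λ C' : ℝ≥0, 1 ≤ Λ ∧
    ∀ (ρ F G : E3 → ℝ≥0∞) (M γ : ℝ≥0), Measurable ρ → Measurable F → Measurable G →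
    (∀ x, ρ x ≤ M) → ∫⁻ z, ρ z ≠ ∞ →
    (∀ (x : E3) (L : ℝ≥0), 0 < L → ∫⁻ z in Metric.ball x (2 * L), ρ z ≤ Λ →
      (∫⁻ z in Metric.ball x L, F z ≤ C * Λ ^ 2 * ((∫⁻ z in Metric.ball x (4 * L), G z) +
        (min (L⁻¹ ^ 2) (γ * L⁻¹) : ℝ≥0))) ∧
      ∀ κ : ℝ≥0, 0 < κ → κ ≤ 1 →
        (min (L⁻¹ ^ 2) (γ * L⁻¹) : ℝ≥0) * ∫⁻ z in Metric.ball x L, ρ z ≤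
          C * ((κ ^ 3)⁻¹ : ℝ≥0) * (min (L⁻¹ ^ 2) (γ * L⁻¹) : ℝ≥0) +
          C * κ ^ 2 * ((min (L⁻¹ ^ 2) (γ * L⁻¹) : ℝ≥0) * ∫⁻ z in Metric.ball x (4 * L), ρ z) +
          C * Λ ^ 2 * ∫⁻ z in Metric.ball x (4 * L), G z) →
    ∫⁻ z, F z ≤ C' * ∫⁻ z, G z := by
  obtain ⟨I, hI⟩ := exists_decay_sum_le
  obtain ⟨κ, hκ, hκ1, hκC⟩ : ∃ κ : ℝ≥0, 0 < κ ∧ κ ≤ 1 ∧ 32 * (C * κ ^ 2 * 55296) ≤ 1 / 4 := by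
    refine ⟨(1 + 128 * C * 55296)⁻¹, by positivity, inv_le_one_of_one_le₀ le_self_add, ?_⟩
    have h1 : (1 + 128 * C * 55296)⁻¹ ≤ (1 : ℝ≥0) := inv_le_one_of_one_le₀ le_self_add
    set k := (1 + 128 * C * 55296 : ℝ≥0)⁻¹ with hk
    have h2 : 128 * C * 55296 * k ≤ 1 := by
      rw [hk, ← div_eq_mul_inv, div_le_one (by positivity)]
      exact le_add_self
    calc 32 * (C * k ^ 2 * 55296) = 1 / 4 * (128 * C * 55296 * k) * k := by ring
      _ ≤ 1 / 4 * 1 * 1 := by gcongr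
      _ = _ := by ring
  set Λ : ℝ≥0 := 1 + 128 * C * (κ ^ 3)⁻¹ * I + I with hΛ
  have hΛ1 : 1 ≤ Λ := by rw [hΛ, add_assoc]; exact le_self_add
  have hΛC : 32 * (C * (κ ^ 3)⁻¹) * I ≤ 1 / 4 * Λ := by
    calc 32 * (C * (κ ^ 3)⁻¹) * I = 1 / 4 * (128 * C * (κ ^ 3)⁻¹ * I) := by ring
      _ ≤ _ := by
        gcongr; rw [hΛ, add_right_comm]; exact le_add_self
  have hΛI : I ≤ Λ := le_add_self
  refine ⟨Λ, 8 * (C * Λ ^ 2 * (13824 + 64 * (C * Λ ^ 2 * 13824))) + C * Λ ^ 2, hΛ1,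
    fun ρ F G M γ hρ hF hG hM hmass hloc => ?_⟩
  rcases le_or_gt (∫⁻ z, ρ z) Λ with hle | hgt
  · have hb : ∀ n : ℕ, ∫⁻ z in Metric.ball 0 ((n + 1 : ℕ) : ℝ), F z ≤
        C * Λ ^ 2 * ((∫⁻ z, G z) + (((n + 1 : ℕ) : ℝ≥0)⁻¹ : ℝ≥0)) := by
      intro n
      have := (hloc 0 ((n + 1 : ℕ) : ℝ≥0) (by positivity)
        ((setLIntegral_le_lintegral _ _).trans hle)).1
      rw [NNReal.coe_natCast] at this
      refine this.trans ?_
      gcongr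
      · exact Measure.restrict_le_self
      · refine (min_le_left _ _).trans ?_
        have h1 : (((n + 1 : ℕ) : ℝ≥0))⁻¹ ≤ 1 := inv_le_one_of_one_le₀ (by simp)
        exact pow_le_of_le_one (by positivity) h1 two_ne_zero
    have ht1 := (Filter.tendsto_add_atTop_iff_nat 1).2 (tendsto_setLIntegral_ball (ρ := F) 0)
    have ht2 : Filter.Tendsto (fun n : ℕ => (C * Λ ^ 2 : ℝ≥0∞) *
        ((∫⁻ z, G z) + (((n + 1 : ℕ) : ℝ≥0)⁻¹ : ℝ≥0))) Filter.atTop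
        (nhds (C * Λ ^ 2 * ((∫⁻ z, G z) + (0 : ℝ≥0)))) :=
      ENNReal.Tendsto.const_mul (tendsto_const_nhds.add (ENNReal.tendsto_coe.2
        ((Filter.tendsto_add_atTop_iff_nat 1).2 (tendsto_inv_atTop_nhds_zero_nat (𝕜 := ℝ≥0)))))
        (Or.inr (by finiteness))
    refine (le_of_tendsto_of_tendsto' ht1 ht2 hb).trans ?_
    rw [ENNReal.coe_zero, add_zero]
    gcongr
    push_cast
    exact le_add_self
  · obtain ⟨L, ⟨r, hr, hrL⟩, hLip, hL2, hL16⟩ := exists_scale hΛ1 hM hgt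
    have hL : ∀ x, 0 < L x := fun x => hr.trans_le (hrL x)
    have hLc := continuous_of_le_add_dist hLip
    have hLm := hLc.measurable
    have hJ0 := hI L γ Λ ρ hL hLip hρ hL16
    set w : E3 → ℝ≥0∞ := fun x => (min ((L x)⁻¹ ^ 2) (γ * (L x)⁻¹) : ℝ≥0) with hw
    set q : E3 → ℝ≥0∞ := fun x => (((L x ^ 3)⁻¹ : ℝ≥0) : ℝ≥0∞) with hq
    have hwm : Measurable w :=
      ((hLm.inv.pow_const 2).min (hLm.inv.const_mul γ)).coe_nnreal_ennreal
    have hqm : Measurable q := ((hLm.pow_const 3).inv).coe_nnreal_ennreal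
    have hqw : Measurable fun x => q x * w x := hqm.mul hwm
    have hqG : Measurable fun x => C * Λ ^ 2 * (q x * ∫⁻ z in Metric.ball x (4 * L x), G z) :=
      (hqm.mul (measurable_setLIntegral_ball hLc 4 hG)).const_mul _
    have hwa : ∀ x y, dist x y < 4 * L x → w x ≤ (4 : ℝ≥0) * w y := by
      intro x y hxy
      simp only [hw, ← ENNReal.coe_mul]
      refine ENNReal.coe_le_coe.2 (min_inv_le (hL y) ?_)
      rw [← NNReal.coe_le_coe]
      push_cast
      have := hLip y x
      rw [dist_comm] at this
      linarith [(L x).coe_nonneg]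
    have h1a : ∀ x y, dist x y < 4 * L x → (1 : E3 → ℝ≥0∞) x ≤ (1 : ℝ≥0) * (1 : E3 → ℝ≥0∞) y := by
      simp
    set R := ∫⁻ x, w x * ρ x with hR
    set J := ∫⁻ x, q x * w x with hJ
    set S := ∫⁻ x, G x with hS
    have hRtop : R ≠ ∞ := by
      have : R ≤ (min (r⁻¹ ^ 2) (γ * r⁻¹) : ℝ≥0) * ∫⁻ x, ρ x := by
        rw [← lintegral_const_mul _ hρ]
        refine lintegral_mono fun x => mul_le_mul_left (ENNReal.coe_le_coe.2 ?_) _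
        have : (L x)⁻¹ ≤ r⁻¹ := by gcongr; exact hrL x
        gcongr
      exact ne_top_of_le_ne_top (by finiteness) this
    have hJR : 32 * (C * ((κ ^ 3)⁻¹ : ℝ≥0)) * J ≤ (1 / 4 : ℝ≥0) * R := by
      have := mul_le_mul_of_mul_le hΛ1 hJ0 hΛC
      push_cast at this ⊢
      exact this
    have hJR' : J ≤ R := by
      simpa using mul_le_mul_of_mul_le (c := 1) (d := 1) hΛ1 hJ0 (by simpa using hΛI)
    have hR2 : R ≤ 32 * ∫⁻ x, q x * (w x * ∫⁻ z in Metric.ball x (L x), ρ z) := by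
      have := lintegral_le_average hL hLip hwm hρ hwa
      simp_rw [mul_assoc] at this
      refine this.trans (le_of_eq ?_)
      rw [← mul_assoc]; norm_num [hq]
    have hR3 : ∫⁻ x, q x * (w x * ∫⁻ z in Metric.ball x (4 * L x), ρ z) ≤ 55296 * R := by
      have := lintegral_average_le hL hLip hwm hρ hwa
      simp_rw [mul_assoc] at this
      refine this.trans (le_of_eq ?_)
      rw [← mul_assoc]; norm_num [hR]
    have hG3 : ∫⁻ x, q x * ∫⁻ z in Metric.ball x (4 * L x), G z ≤ 13824 * S := by
      have := lintegral_average_le hL hLip measurable_one hG h1a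
      simpa using this
    have hF3 : ∫⁻ x, F x ≤ 8 * ∫⁻ x, q x * ∫⁻ z in Metric.ball x (L x), F z := by
      have := lintegral_le_average hL hLip measurable_one hF h1a
      simpa using this
    have hex : ∫⁻ x, q x * (w x * ∫⁻ z in Metric.ball x (L x), ρ z) ≤
        C * ((κ ^ 3)⁻¹ : ℝ≥0) * J + C * κ ^ 2 * (55296 * R) + C * Λ ^ 2 * (13824 * S) := by
      calc ∫⁻ x, q x * (w x * ∫⁻ z in Metric.ball x (L x), ρ z)
          ≤ ∫⁻ x, (C * ((κ ^ 3)⁻¹ : ℝ≥0) * (q x * w x) + C * κ ^ 2 * (q x * (w x *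
              ∫⁻ z in Metric.ball x (4 * L x), ρ z)) +
              C * Λ ^ 2 * (q x * ∫⁻ z in Metric.ball x (4 * L x), G z)) := by
            refine lintegral_mono fun x => ?_
            calc _ ≤ q x * _ := mul_le_mul_right ((hloc x (L x) (hL x) (hL2 x)).2 κ hκ hκ1) _
              _ = _ := by simp only [hw]; ring
        _ = C * ((κ ^ 3)⁻¹ : ℝ≥0) * J + C * κ ^ 2 * (∫⁻ x, q x * (w x *
              ∫⁻ z in Metric.ball x (4 * L x), ρ z)) +
              C * Λ ^ 2 * ∫⁻ x, q x * ∫⁻ z in Metric.ball x (4 * L x), G z := by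
            rw [lintegral_add_right _ hqG, lintegral_add_left (hqw.const_mul _),
              lintegral_const_mul' _ _ (by finiteness),
              lintegral_const_mul' _ _ (by finiteness), lintegral_const_mul' _ _ (by finiteness)]
        _ ≤ _ := by gcongr
    have hRS : R ≤ 64 * (C * Λ ^ 2 * (13824 * S)) := by
      have h1 : 32 * (C * κ ^ 2 * 55296) * R ≤ (1 / 4 : ℝ≥0) * R := by
        gcongr; exact_mod_cast hκC
      have h2 : R ≤ (1 / 2 : ℝ≥0) * R + 32 * (C * Λ ^ 2 * (13824 * S)) := by
        calc R ≤ 32 * (C * ((κ ^ 3)⁻¹ : ℝ≥0) * J + C * κ ^ 2 * (55296 * R) +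
              C * Λ ^ 2 * (13824 * S)) := hR2.trans (by gcongr)
          _ = 32 * (C * ((κ ^ 3)⁻¹ : ℝ≥0)) * J + 32 * (C * κ ^ 2 * 55296) * R +
              32 * (C * Λ ^ 2 * (13824 * S)) := by ring
          _ ≤ (1 / 4 : ℝ≥0) * R + (1 / 4 : ℝ≥0) * R + 32 * (C * Λ ^ 2 * (13824 * S)) := by gcongr
          _ = _ := by
            rw [← add_mul, ← ENNReal.coe_add]; congr 3; norm_num
      refine (le_of_le_half_add hRtop h2).trans (le_of_eq ?_)
      ring
    have hFS : ∫⁻ x, q x * ∫⁻ z in Metric.ball x (L x), F z ≤ C * Λ ^ 2 * (13824 * S + J) := by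
      calc ∫⁻ x, q x * ∫⁻ z in Metric.ball x (L x), F z
          ≤ ∫⁻ x, C * Λ ^ 2 * (q x * (∫⁻ z in Metric.ball x (4 * L x), G z) + q x * w x) := by
            refine lintegral_mono fun x => ?_
            calc _ ≤ q x * _ := mul_le_mul_right (hloc x (L x) (hL x) (hL2 x)).1 _
              _ = _ := by simp only [hw]; ring
        _ = C * Λ ^ 2 * ((∫⁻ x, q x * ∫⁻ z in Metric.ball x (4 * L x), G z) + J) := by
            rw [lintegral_const_mul' _ _ (by finiteness), lintegral_add_right _ hqw]
        _ ≤ _ := by gcongr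
    calc ∫⁻ x, F x ≤ 8 * (C * Λ ^ 2 * (13824 * S + 64 * (C * Λ ^ 2 * (13824 * S)))) := by
          refine hF3.trans ?_
          gcongr
          refine hFS.trans ?_
          gcongr
          exact hJR'.trans hRS
      _ = ((8 * (C * Λ ^ 2 * (13824 + 64 * (C * Λ ^ 2 * 13824))) : ℝ≥0) : ℝ≥0∞) * S := by
          push_cast; ring
      _ ≤ _ := by gcongr; exact le_self_add

/-- The kinetic energy inequality for orbital families. -/
lemma exists_family_kinetic_inequality : ∃ C : ℝ≥0, ∀ (Y : Type) [MeasurableSpace Y]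
    (μ : Measure Y) [SFinite μ] (φ : Fin 2 → Y → E3 → ℂ), IsOrbitalFamily μ φ →
    ∀ A : E3 → E3, ContDiff ℝ (⊤ : ℕ∞) A → ∀ γ : ℝ≥0, 0 < γ →
    ∫⁻ z, min (famDensity μ φ z ^ (5 / 3 : ℝ)) (γ * famDensity μ φ z ^ (4 / 3 : ℝ)) ≤
      C * ((∫⁻ z, famKinetic μ A φ z) + γ * ∫⁻ z, ‖fderiv ℝ A z‖ₑ ^ 2) := by
  obtain ⟨C, hC⟩ := exists_local_estimate
  obtain ⟨Λ, C', hΛ, hC'⟩ := exists_global_of_local C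
  refine ⟨C', fun Y _ μ _ φ h A hA γ hγ => ?_⟩
  have hρ := measurable_famDensity h
  have hA' : Measurable fun z => ‖fderiv ℝ A z‖ₑ ^ 2 :=
    ((hA.continuous_fderiv (by simp)).enorm.measurable).pow_const 2
  have hK := measurable_famKinetic h hA.continuous
  obtain ⟨M, hM⟩ := h.bounded
  have hs : ∀ B : Set E3, ∫⁻ z in B, (famKinetic μ A φ z + γ * ‖fderiv ℝ A z‖ₑ ^ 2) =
      (∫⁻ z in B, famKinetic μ A φ z) + γ * ∫⁻ z in B, ‖fderiv ℝ A z‖ₑ ^ 2 := fun B => by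
    rw [lintegral_add_left hK, lintegral_const_mul _ hA']
  have hs' : ∫⁻ z, (famKinetic μ A φ z + γ * ‖fderiv ℝ A z‖ₑ ^ 2) =
      (∫⁻ z, famKinetic μ A φ z) + γ * ∫⁻ z, ‖fderiv ℝ A z‖ₑ ^ 2 := by
    simpa using hs Set.univ
  rw [← hs']
  refine hC' (famDensity μ φ) _ _ (2 * M) γ hρ ((hρ.pow_const _).min ((hρ.pow_const _).const_mul _))
    (hK.add (hA'.const_mul _)) (fun x => ?_) ?_ fun x L hL hm => ?_
  · rw [famDensity]
    simp only [Fin.sum_univ_two]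
    rw [lintegral_add_left]
    · refine (add_le_add (hM 0 x) (hM 1 x)).trans (le_of_eq ?_)
      push_cast; ring
    · have := (h.measurable 0).comp (measurable_prodMk_right (y := x))
      exact this.enorm.pow_const 2
  · have := setLIntegral_famDensity h Set.univ
    simp only [Measure.restrict_univ] at this
    rw [this]
    exact ENNReal.sum_ne_top.2 fun s _ => h.mass_ne_top s
  · have := hC Λ hΛ Y μ φ h A hA γ hγ x L hL hm
    simp only [hs]
    refine ⟨this.1, fun κ hκ hκ1 => this.2 κ hκ hκ1⟩

end GlobalEstimate

section Antisymmetric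

variable {Z : Type}

/-- Tensor product of a one-body function with an antisymmetric function of the remaining
variables. -/
def headTensor {n : ℕ} (h : Z → ℂ) (f : (Fin n → Z) → ℂ) (p : Fin (n + 1) → Z) : ℂ :=
  h (p 0) * f fun i => p i.succ

lemma sign_mul_headTensor {n : ℕ} {h : Z → ℂ} {f : (Fin n → Z) → ℂ}
    (hf : ∀ (π : Equiv.Perm (Fin n)) (p : Fin n → Z),
      f (fun i => p (π i)) = ((Equiv.Perm.sign π : ℤ) : ℂ) * f p)
    (π : Equiv.Perm (Fin (n + 1))) (p : Fin (n + 1) → Z) :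
    ((Equiv.Perm.sign π : ℤ) : ℂ) * headTensor h f (fun i => p (π i)) =
      if π 0 = 0 then headTensor h f p
      else -headTensor h f fun i => p (Equiv.swap 0 (π 0) i) := by
  obtain ⟨⟨a, e⟩, rfl⟩ := Equiv.Perm.decomposeFin.symm.surjective π
  have hse : ((Equiv.Perm.sign e : ℤ) : ℂ) * ((Equiv.Perm.sign e : ℤ) : ℂ) = 1 := by
    rcases Int.units_eq_one_or (Equiv.Perm.sign e) with h | h <;> simp [h]
  have h1 := hf e fun i => p (Equiv.swap 0 a i.succ)
  simp only [headTensor, Equiv.Perm.decomposeFin_symm_apply_zero,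
    Equiv.Perm.decomposeFin_symm_apply_succ, Equiv.Perm.decomposeFin.symm_sign, h1,
    Equiv.swap_apply_left]
  split_ifs with ha
  · subst ha
    simp only [one_mul, Equiv.swap_self, Equiv.refl_apply]
    linear_combination (h (p 0) * f fun i => p i.succ) * hse
  · push_cast
    linear_combination (-h (p a) * f fun i => p (Equiv.swap 0 a i.succ)) * hse

variable [MeasurableSpace Z]

lemma integral_pi_comp_perm {n : ℕ} {E : Type*} [NormedAddCommGroup E] [NormedSpace ℝ E]
    (ν : Measure Z) [SigmaFinite ν] (π : Equiv.Perm (Fin n)) (Φ : (Fin n → Z) → E) :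
    ∫ p, Φ (fun i => p (π i)) ∂(Measure.pi fun _ => ν) = ∫ p, Φ p ∂(Measure.pi fun _ => ν) := by
  have h := measurePreserving_piCongrLeft (fun _ : Fin n => ν) π.symm
  rw [← h.integral_comp' Φ]
  refine integral_congr_ae (Filter.Eventually.of_forall fun p => ?_)
  refine congrArg Φ (funext fun i => ?_)
  have := MeasurableEquiv.piCongrLeft_apply_apply (β := fun _ => Z) π.symm p (π i)
  simpa using this.symm

lemma measurable_finCons {n : ℕ} :
    Measurable fun w : Z × (Fin n → Z) => (Fin.cons w.1 w.2 : Fin (n + 1) → Z) := by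
  refine measurable_pi_lambda _ fun i => ?_
  refine Fin.cases ?_ (fun j => ?_) i
  · simpa using measurable_fst
  · simp only [Fin.cons_succ]
    exact (measurable_pi_apply j).comp measurable_snd

lemma integral_pi_succ {n : ℕ} (ν : Measure Z) [SigmaFinite ν] (Φ : (Fin (n + 1) → Z) → ℂ) :
    ∫ p, Φ p ∂(Measure.pi fun _ => ν) =
      ∫ w : Z × (Fin n → Z), Φ (Fin.cons w.1 w.2) ∂(ν.prod (Measure.pi fun _ => ν)) := by
  have h := measurePreserving_piFinSuccAbove (fun _ : Fin (n + 1) => ν) 0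
  rw [← h.symm.integral_comp' Φ]
  simp [MeasurableEquiv.piFinSuccAbove_symm_apply, Fin.insertNthEquiv]

lemma lintegral_pi_succ {n : ℕ} (ν : Measure Z) [SigmaFinite ν] (Φ : (Fin (n + 1) → Z) → ℝ≥0∞) :
    ∫⁻ p, Φ p ∂(Measure.pi fun _ => ν) =
      ∫⁻ w : Z × (Fin n → Z), Φ (Fin.cons w.1 w.2) ∂(ν.prod (Measure.pi fun _ => ν)) := by
  have h := measurePreserving_piFinSuccAbove (fun _ : Fin (n + 1) => ν) 0
  rw [← h.symm.lintegral_comp_emb (MeasurableEquiv.measurableEmbedding _) Φ]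
  simp [MeasurableEquiv.piFinSuccAbove_symm_apply, Fin.insertNthEquiv]

lemma integrable_of_bounded_of_support_subset {α E : Type*} [MeasurableSpace α]
    [NormedAddCommGroup E] {μ : Measure α}
    {g : α → E} (hg : AEStronglyMeasurable g μ) {M : ℝ} (hM : ∀ x, ‖g x‖ ≤ M) {K : Set α}
    (hKμ : μ K ≠ ∞) (hs : ∀ x, x ∉ K → g x = 0) : Integrable g μ := by
  have h : IntegrableOn g K μ := Measure.integrableOn_of_bounded hKμ hg
    (Filter.Eventually.of_forall hM)
  exact (integrableOn_iff_integrable_of_support_subset fun x hx => by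
    by_contra hxK; exact hx (hs x hxK)).1 h

lemma integral_headTensor_swap_one {n : ℕ} (ν : Measure Z) [SigmaFinite ν] {h : Z → ℂ}
    {f : (Fin (n + 1) → Z) → ℂ}
    (hf : ∀ (π : Equiv.Perm (Fin (n + 1))) (p : Fin (n + 1) → Z),
      f (fun i => p (π i)) = ((Equiv.Perm.sign π : ℤ) : ℂ) * f p)
    {a : Fin (n + 2)} (ha : a ≠ 0) :
    ∫ p, starRingEnd ℂ (headTensor h f p) * headTensor h f (fun i => p (Equiv.swap 0 a i))
        ∂(Measure.pi fun _ => ν) =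
      ∫ p, starRingEnd ℂ (headTensor h f p) * headTensor h f (fun i => p (Equiv.swap 0 1 i))
        ∂(Measure.pi fun _ => ν) := by
  have h01 : (0 : Fin (n + 2)) ≠ 1 := by simp
  rw [← integral_pi_comp_perm ν (Equiv.swap 1 a)]
  refine integral_congr_ae (Filter.Eventually.of_forall fun p => ?_)
  have h1 := sign_mul_headTensor (h := h) hf (Equiv.swap 1 a) p
  have h2 := sign_mul_headTensor (h := h) hf (Equiv.swap 1 a * Equiv.swap 0 a) p
  have h3 : (Equiv.swap 1 a) 0 = (0 : Fin (n + 2)) := Equiv.swap_apply_of_ne_of_ne h01 ha.symm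
  have h4 : (Equiv.swap 1 a * Equiv.swap 0 a) 0 = (1 : Fin (n + 2)) := by simp
  rw [h3, if_pos rfl] at h1
  rw [h4, if_neg h01.symm, Equiv.Perm.sign_mul, Equiv.Perm.sign_swap ha.symm] at h2
  have hs : ((Equiv.Perm.sign (Equiv.swap 1 a) : ℤ) : ℂ) *
      ((Equiv.Perm.sign (Equiv.swap 1 a) : ℤ) : ℂ) = 1 := by
    rcases Int.units_eq_one_or (Equiv.Perm.sign (Equiv.swap 1 a)) with h | h <;> simp [h]
  have hc : starRingEnd ℂ (((Equiv.Perm.sign (Equiv.swap 1 a) : ℤ) : ℂ)) =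
      ((Equiv.Perm.sign (Equiv.swap 1 a) : ℤ) : ℂ) := by simp
  push_cast at h2
  simp only [Function.comp_apply] at h2
  beta_reduce
  rw [← h1, map_mul, hc]
  have h5 : headTensor h f (fun i => p (Equiv.swap 0 1 i)) =
      ((Equiv.Perm.sign (Equiv.swap 1 a) : ℤ) : ℂ) *
        headTensor h f (fun i => p (Equiv.swap 1 a (Equiv.swap 0 a i))) := by
    linear_combination h2
  rw [h5]
  linear_combination -(starRingEnd ℂ (headTensor h f fun i => p (Equiv.swap 1 a i))) *
    (headTensor h f (fun i => p (Equiv.swap 1 a (Equiv.swap 0 a i)))) * hs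

lemma integral_headTensor_mul_perm {n : ℕ} (ν : Measure Z) [SigmaFinite ν] {h : Z → ℂ}
    {f : (Fin (n + 1) → Z) → ℂ}
    (hf : ∀ (π : Equiv.Perm (Fin (n + 1))) (p : Fin (n + 1) → Z),
      f (fun i => p (π i)) = ((Equiv.Perm.sign π : ℤ) : ℂ) * f p)
    (i j : Fin (n + 2)) :
    ∫ p, starRingEnd ℂ (((Equiv.Perm.sign (Equiv.swap 0 i) : ℤ) : ℂ) *
          headTensor h f fun l => p (Equiv.swap 0 i l)) *
        (((Equiv.Perm.sign (Equiv.swap 0 j) : ℤ) : ℂ) *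
          headTensor h f fun l => p (Equiv.swap 0 j l)) ∂(Measure.pi fun _ => ν) =
      if i = j then ∫ p, starRingEnd ℂ (headTensor h f p) * headTensor h f p
        ∂(Measure.pi fun _ => ν)
      else -∫ p, starRingEnd ℂ (headTensor h f p) *
        headTensor h f (fun i => p (Equiv.swap 0 1 i)) ∂(Measure.pi fun _ => ν) := by
  rw [← integral_pi_comp_perm ν (Equiv.swap 0 i)]
  have hpt : ∀ p : Fin (n + 2) → Z,
      starRingEnd ℂ (((Equiv.Perm.sign (Equiv.swap 0 i) : ℤ) : ℂ) *
          headTensor h f fun l => p (Equiv.swap 0 i (Equiv.swap 0 i l))) *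
        (((Equiv.Perm.sign (Equiv.swap 0 j) : ℤ) : ℂ) *
          headTensor h f fun l => p (Equiv.swap 0 i (Equiv.swap 0 j l))) =
      starRingEnd ℂ (headTensor h f p) * (if i = j then headTensor h f p
      else -headTensor h f fun l => p (Equiv.swap 0 (Equiv.swap 0 i j) l)) := by
    intro p
    have h2 := sign_mul_headTensor (h := h) hf (Equiv.swap 0 i * Equiv.swap 0 j) p
    have h0 : (Equiv.swap 0 i * Equiv.swap 0 j) 0 = Equiv.swap 0 i j := by simp
    have h1 : (Equiv.swap 0 i) j = 0 ↔ i = j := by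
      constructor
      · intro h
        have := congrArg (Equiv.swap 0 i) h
        simpa using this.symm
      · rintro rfl; simp
    rw [h0] at h2
    simp only [h1, Equiv.Perm.mul_apply] at h2
    rw [← h2, Equiv.Perm.sign_mul]
    simp only [Equiv.swap_apply_self, map_mul, Units.val_mul, Int.cast_mul, map_intCast]
    ring
  simp only [hpt]
  by_cases hij : i = j
  · simp [hij]
  · simp only [hij, if_false, mul_neg, integral_neg]
    rw [integral_headTensor_swap_one ν hf]
    intro h
    apply hij
    have := congrArg (Equiv.swap 0 i) h
    simpa using this.symm

lemma integral_conj_headTensor_self {n : ℕ} (ν : Measure Z) [SigmaFinite ν] (h : Z → ℂ)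
    (f : (Fin n → Z) → ℂ) :
    ∫ p, starRingEnd ℂ (headTensor h f p) * headTensor h f p ∂(Measure.pi fun _ => ν) =
      (((∫ z, ‖h z‖ ^ 2 ∂ν) * ∫ q, ‖f q‖ ^ 2 ∂(Measure.pi fun _ => ν) : ℝ) : ℂ) := by
  rw [integral_pi_succ, ← integral_prod_mul, ← integral_complex_ofReal]
  refine integral_congr_ae (Filter.Eventually.of_forall fun w => ?_)
  simp only [headTensor, Fin.cons_zero, Fin.cons_succ, map_mul, Complex.ofReal_mul,
    Complex.ofReal_pow, ← Complex.conj_mul']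
  ring

lemma integral_conj_headTensor_swap {n : ℕ} (ν : Measure Z) [SigmaFinite ν] {h : Z → ℂ}
    {f : (Fin (n + 1) → Z) → ℂ}
    (hi : Integrable (fun p => starRingEnd ℂ (headTensor h f p) *
        headTensor h f (fun i => p (Equiv.swap 0 1 i))) (Measure.pi fun _ => ν)) :
    ∫ p, starRingEnd ℂ (headTensor h f p) * headTensor h f (fun i => p (Equiv.swap 0 1 i))
        ∂(Measure.pi fun _ => ν) =
      ((∫ q, ‖∫ z, starRingEnd ℂ (h z) * f (Fin.cons z q) ∂ν‖ ^ 2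
        ∂(Measure.pi fun _ => ν) : ℝ) : ℂ) := by
  set Φ := fun p => starRingEnd ℂ (headTensor h f p) *
        headTensor h f (fun i => p (Equiv.swap 0 1 i)) with hΦ
  have e1 := (measurePreserving_piFinSuccAbove (fun _ : Fin (n + 2) => ν) 0).symm
  have e2 := (MeasurePreserving.id ν).prod
    (measurePreserving_piFinSuccAbove (fun _ : Fin (n + 1) => ν) 0).symm
  have e3 := measurePreserving_prodAssoc ν ν (Measure.pi fun _ : Fin n => ν)
  set E2 : Z × Z × (Fin n → Z) ≃ᵐ Z × (Fin (n + 1) → Z) := (MeasurableEquiv.refl Z).prodCongr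
    (MeasurableEquiv.piFinSuccAbove (fun _ : Fin (n + 1) => Z) 0).symm with hE2
  set e := (MeasurableEquiv.prodAssoc.trans E2).trans
    (MeasurableEquiv.piFinSuccAbove (fun _ : Fin (n + 2) => Z) 0).symm with he
  have hmp : MeasurePreserving e ((ν.prod ν).prod (Measure.pi fun _ => ν))
      (Measure.pi fun _ => ν) := e1.comp (e2.comp e3)
  have hpt : ∀ w, Φ (e w) =
      (starRingEnd ℂ (h w.1.1) * f (Fin.cons w.1.1 w.2)) *
        starRingEnd ℂ (starRingEnd ℂ (h w.1.2) * f (Fin.cons w.1.2 w.2)) := by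
    rintro ⟨⟨z, z'⟩, q⟩
    have h0 : e ((z, z'), q) = Fin.cons z (Fin.cons z' q) := by
      change (MeasurableEquiv.piFinSuccAbove (fun _ => Z) 0).symm
        (z, (MeasurableEquiv.piFinSuccAbove (fun _ => Z) 0).symm (z', q)) = _
      simp [MeasurableEquiv.piFinSuccAbove_symm_apply, Fin.insertNthEquiv]
    have h1 : (fun i : Fin (n + 1) =>
        (Fin.cons z (Fin.cons z' q) : Fin (n + 2) → Z) (Equiv.swap 0 1 i.succ)) =
        Fin.cons z q := by
      funext i
      refine Fin.cases ?_ (fun j => ?_) i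
      · simp
      · rw [Equiv.swap_apply_of_ne_of_ne (Fin.succ_ne_zero _)]
        · simp
        · intro hj
          have := congrArg Fin.val hj
          simp at this
    have h2 : (Fin.cons z (Fin.cons z' q) : Fin (n + 2) → Z) 1 = z' := rfl
    rw [h0, hΦ]
    simp only [headTensor, h1, Fin.cons_zero, Fin.cons_succ, Equiv.swap_apply_left, h2, map_mul,
      Complex.conj_conj]
    ring
  have hi' : Integrable (fun w => Φ (e w)) ((ν.prod ν).prod (Measure.pi fun _ => ν)) :=
    hmp.integrable_comp_emb e.measurableEmbedding |>.2 hi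
  rw [← hmp.integral_comp' Φ, integral_prod_symm _ hi', ← integral_complex_ofReal]
  refine integral_congr_ae (Filter.Eventually.of_forall fun q => ?_)
  simp only [hpt]
  rw [integral_prod_mul (fun z => starRingEnd ℂ (h z) * f (Fin.cons z q))
    (fun z => starRingEnd ℂ (starRingEnd ℂ (h z) * f (Fin.cons z q))), integral_conj,
    Complex.mul_conj']
  simp

lemma integral_conj_sum_mul_sum {α ι : Type*} [MeasurableSpace α] {μ : Measure α} [Fintype ι]
    (G : ι → α → ℂ) (hG : ∀ i j, Integrable (fun p => starRingEnd ℂ (G i p) * G j p) μ) :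
    0 ≤ (∑ i, ∑ j, ∫ p, starRingEnd ℂ (G i p) * G j p ∂μ).re := by
  have h : ∑ i, ∑ j, ∫ p, starRingEnd ℂ (G i p) * G j p ∂μ =
      ((∫ p, ‖∑ i, G i p‖ ^ 2 ∂μ : ℝ) : ℂ) := by
    rw [← integral_complex_ofReal]
    simp_rw [← integral_finsetSum Finset.univ fun j _ => hG _ j]
    rw [← integral_finsetSum _ fun i _ => integrable_finsetSum _ fun j _ => hG i j]
    refine integral_congr_ae (Filter.Eventually.of_forall fun p => ?_)
    simp only [Complex.ofReal_pow, ← Complex.conj_mul', map_sum, Finset.sum_mul, Finset.mul_sum]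
    rw [Finset.sum_comm]
  rw [h, Complex.ofReal_re]
  exact integral_nonneg fun p => sq_nonneg _

/-- Pauli principle: the one-body density matrix of an antisymmetric function is bounded by its
squared norm. -/
lemma integral_norm_sq_contraction_le {n : ℕ} (ν : Measure Z) [SigmaFinite ν] {h : Z → ℂ}
    {f : (Fin (n + 1) → Z) → ℂ}
    (hf : ∀ (π : Equiv.Perm (Fin (n + 1))) (p : Fin (n + 1) → Z),
      f (fun i => p (π i)) = ((Equiv.Perm.sign π : ℤ) : ℂ) * f p)
    (hfm : Measurable f) (hhm : Measurable h) {M : ℝ} (hfM : ∀ p, ‖f p‖ ≤ M)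
    (hhM : ∀ z, ‖h z‖ ≤ M) {K : Set Z} (hK : ν K ≠ ∞) (hfK : ∀ p, (∃ i, p i ∉ K) → f p = 0)
    (hhK : ∀ z, z ∉ K → h z = 0) :
    (n + 1) * ∫ q, ‖∫ z, starRingEnd ℂ (h z) * f (Fin.cons z q) ∂ν‖ ^ 2
        ∂(Measure.pi fun _ => ν) ≤
      (∫ z, ‖h z‖ ^ 2 ∂ν) * ∫ p, ‖f p‖ ^ 2 ∂(Measure.pi fun _ => ν) := by
  have hTm : Measurable (headTensor h f) :=
    (hhm.comp (measurable_pi_apply 0)).mul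
      (hfm.comp (measurable_pi_lambda _ fun i => measurable_pi_apply _))
  have hM0 : ∀ z : Z, 0 ≤ M := fun z => (norm_nonneg _).trans (hhM z)
  have hTM : ∀ p, ‖headTensor h f p‖ ≤ M * M := fun p => by
    rw [headTensor, norm_mul]
    exact mul_le_mul (hhM _) (hfM _) (norm_nonneg _) (hM0 (p 0))
  have hTK : ∀ p, (∃ i, p i ∉ K) → headTensor h f p = 0 := by
    rintro p ⟨i, hi⟩
    revert hi
    refine Fin.cases (fun hi => ?_) (fun j hi => ?_) i
    · simp [headTensor, hhK _ hi]
    · simp [headTensor, hfK (fun i => p i.succ) ⟨j, hi⟩]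
  have hKn : (Measure.pi fun _ : Fin (n + 2) => ν) (Set.univ.pi fun _ => K) ≠ ∞ := by
    rw [Measure.pi_pi]
    exact ENNReal.prod_ne_top fun _ _ => hK
  have hInt : ∀ π τ : Equiv.Perm (Fin (n + 2)),
      Integrable (fun p => starRingEnd ℂ (headTensor h f fun i => p (π i)) *
        headTensor h f fun i => p (τ i)) (Measure.pi fun _ => ν) := by
    intro π τ
    have hm : ∀ π : Equiv.Perm (Fin (n + 2)),
        Measurable fun p : Fin (n + 2) → Z => headTensor h f fun i => p (π i) := fun π =>
      hTm.comp (measurable_pi_lambda _ fun i => measurable_pi_apply _)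
    refine integrable_of_bounded_of_support_subset (M := (M * M) * (M * M))
      (((Complex.continuous_conj.measurable.comp (hm π)).mul (hm τ)).aestronglyMeasurable)
      (fun p => ?_) hKn (fun p hp => ?_)
    · rw [norm_mul, RCLike.norm_conj]
      exact mul_le_mul (hTM _) (hTM _) (norm_nonneg _) ((norm_nonneg _).trans (hTM p))
    · rw [hTK fun i => p (τ i), mul_zero]
      simp only [Set.mem_pi, Set.mem_univ, true_implies, not_forall] at hp
      obtain ⟨i, hi⟩ := hp
      exact ⟨τ.symm i, by simpa using hi⟩
  have hpos := integral_conj_sum_mul_sum (μ := Measure.pi fun _ : Fin (n + 2) => ν)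
    (fun (i : Fin (n + 2)) p => ((Equiv.Perm.sign (Equiv.swap 0 i) : ℤ) : ℂ) *
          headTensor h f fun l => p (Equiv.swap 0 i l)) (fun i j => by
      have := (hInt (Equiv.swap 0 i) (Equiv.swap 0 j)).const_mul
        (((Equiv.Perm.sign (Equiv.swap 0 i) : ℤ) : ℂ) *
          ((Equiv.Perm.sign (Equiv.swap 0 j) : ℤ) : ℂ))
      refine this.congr (Filter.Eventually.of_forall fun p => ?_)
      simp only [map_mul, map_intCast]
      ring)
  simp only [integral_headTensor_mul_perm ν hf, integral_conj_headTensor_self,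
    integral_conj_headTensor_swap ν (hInt 1 (Equiv.swap 0 1))] at hpos
  set D := (∫ z, ‖h z‖ ^ 2 ∂ν) * ∫ p, ‖f p‖ ^ 2 ∂(Measure.pi fun _ => ν)
  set F := ∫ q, ‖∫ z, starRingEnd ℂ (h z) * f (Fin.cons z q) ∂ν‖ ^ 2 ∂(Measure.pi fun _ => ν)
  have hsum : ∀ i : Fin (n + 2), ∑ j, (if i = j then (D : ℂ) else -(F : ℂ)) =
      ((D - (n + 1) * F : ℝ) : ℂ) := by
    intro i
    have : ∀ j, (if i = j then (D : ℂ) else -(F : ℂ)) =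
        (if i = j then (D : ℂ) + F else 0) - F := by
      intro j; split_ifs <;> ring
    simp only [this, Finset.sum_sub_distrib, Finset.sum_ite_eq, Finset.mem_univ, if_true,
      Finset.sum_const, Finset.card_univ, Fintype.card_fin, nsmul_eq_mul]
    push_cast
    ring
  simp only [hsum, Finset.sum_const, Finset.card_univ, Fintype.card_fin, nsmul_eq_mul] at hpos
  have hpos' : 0 ≤ ((n + 2 : ℕ) : ℝ) * (D - (n + 1) * F) := by
    rw [← Complex.ofReal_natCast, ← Complex.ofReal_mul, Complex.ofReal_re] at hpos
    exact hpos
  have := (mul_nonneg_iff_of_pos_left (by positivity)).1 hpos'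
  linarith

end Antisymmetric

section SpinSpace

lemma lintegral_norm_sq_eq_ofReal {α E : Type*} [MeasurableSpace α] [NormedAddCommGroup E]
    {μ : Measure α} {g : α → E} (hg : Integrable (fun x => ‖g x‖ ^ 2) μ) :
    ∫⁻ x, ‖g x‖ₑ ^ 2 ∂μ = ENNReal.ofReal (∫ x, ‖g x‖ ^ 2 ∂μ) := by
  rw [ofReal_integral_eq_lintegral_ofReal hg (Filter.Eventually.of_forall fun x => sq_nonneg _)]
  refine lintegral_congr fun x => ?_
  rw [ENNReal.ofReal_pow (norm_nonneg _), ofReal_norm]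

lemma lintegral_enorm_sq_contraction_le {Z : Type} [MeasurableSpace Z] {n : ℕ} (ν : Measure Z)
    [SigmaFinite ν] {h : Z → ℂ} {f : (Fin (n + 1) → Z) → ℂ}
    (hf : ∀ (π : Equiv.Perm (Fin (n + 1))) (p : Fin (n + 1) → Z),
      f (fun i => p (π i)) = ((Equiv.Perm.sign π : ℤ) : ℂ) * f p)
    (hfm : Measurable f) (hhm : Measurable h) {M : ℝ} (hfM : ∀ p, ‖f p‖ ≤ M)
    (hhM : ∀ z, ‖h z‖ ≤ M) {K : Set Z} (hK : ν K ≠ ∞) (hfK : ∀ p, (∃ i, p i ∉ K) → f p = 0)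
    (hhK : ∀ z, z ∉ K → h z = 0) :
    (n + 1) * ∫⁻ q, ‖∫ z, h z * f (Fin.cons z q) ∂ν‖ₑ ^ 2 ∂(Measure.pi fun _ => ν) ≤
      (∫⁻ z, ‖h z‖ₑ ^ 2 ∂ν) * ∫⁻ p, ‖f p‖ₑ ^ 2 ∂(Measure.pi fun _ => ν) := by
  have hsq : ∀ {α : Type} [MeasurableSpace α] {μ : Measure α} {g : α → ℂ} {B : ℝ} {K : Set α},
      AEStronglyMeasurable g μ → (∀ x, ‖g x‖ ≤ B) → μ K ≠ ∞ → (∀ x, x ∉ K → g x = 0) →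
      Integrable (fun x => ‖g x‖ ^ 2) μ := by
    intro α _ μ g B K hg hB hK h0
    refine integrable_of_bounded_of_support_subset (M := B ^ 2) (hg.norm.pow 2) (fun x => ?_) hK
      fun x hx => by simp [h0 x hx]
    rw [norm_pow, norm_norm]
    exact pow_le_pow_left₀ (norm_nonneg _) (hB x) 2
  have hKn : ∀ m, (Measure.pi fun _ : Fin m => ν) (Set.univ.pi fun _ => K) ≠ ∞ := fun m => by
    rw [Measure.pi_pi]
    exact ENNReal.prod_ne_top fun _ _ => hK
  have hout : ∀ {m} {p : Fin m → Z}, p ∉ Set.univ.pi (fun _ => K) → ∃ i, p i ∉ K := by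
    intro m p hp
    simpa using hp
  have hhi : Integrable h ν := integrable_of_bounded_of_support_subset hhm.aestronglyMeasurable
    hhM hK hhK
  have hcm : StronglyMeasurable fun q : Fin n → Z => ∫ z, h z * f (Fin.cons z q) ∂ν := by
    have : Measurable fun w : (Fin n → Z) × Z => h w.2 * f (Fin.cons w.2 w.1) :=
      (hhm.comp measurable_snd).mul (hfm.comp (measurable_finCons.comp measurable_swap))
    exact this.stronglyMeasurable.integral_prod_right
  have hcb : ∀ q : Fin n → Z, ‖∫ z, h z * f (Fin.cons z q) ∂ν‖ ≤ ∫ z, ‖h z‖ * M ∂ν := fun q => by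
    refine norm_integral_le_of_norm_le (hhi.norm.mul_const M)
      (Filter.Eventually.of_forall fun z => ?_)
    rw [norm_mul]
    exact mul_le_mul_of_nonneg_left (hfM _) (norm_nonneg _)
  have hc0 : ∀ q : Fin n → Z, q ∉ Set.univ.pi (fun _ => K) →
      ∫ z, h z * f (Fin.cons z q) ∂ν = 0 := fun q hq => by
    obtain ⟨i, hi⟩ := hout hq
    have : ∀ z, f (Fin.cons z q) = 0 := fun z => hfK _ ⟨i.succ, by simpa using hi⟩
    simp [this]
  rw [lintegral_norm_sq_eq_ofReal (hsq hcm.aestronglyMeasurable hcb (hKn n) hc0),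
    lintegral_norm_sq_eq_ofReal (hsq hhm.aestronglyMeasurable hhM hK hhK),
    lintegral_norm_sq_eq_ofReal (hsq hfm.aestronglyMeasurable hfM (hKn _)
      fun p hp => hfK p (hout hp)),
    ← ENNReal.ofReal_mul (integral_nonneg fun _ => sq_nonneg _)]
  have hn : ((n : ℝ≥0∞) + 1) = ENNReal.ofReal ((n : ℝ) + 1) := by
    rw [ENNReal.ofReal_add (by positivity) zero_le_one]; simp
  rw [hn, ← ENNReal.ofReal_mul (by positivity)]
  refine ENNReal.ofReal_le_ofReal ?_
  have := integral_norm_sq_contraction_le ν (h := fun z => starRingEnd ℂ (h z)) hf hfm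
    (Complex.continuous_conj.measurable.comp hhm) hfM (fun z => by simpa using hhM z) hK hfK
    (fun z hz => by simp [hhK z hz])
  simpa using this

lemma lintegral_count_prod {S X : Type*} [Fintype S] [MeasurableSpace S]
    [MeasurableSingletonClass S] [MeasurableSpace X] (μ : Measure X) [SFinite μ]
    {H : S × X → ℝ≥0∞} (hH : Measurable H) :
    ∫⁻ p, H p ∂(Measure.count.prod μ) = ∑ s, ∫⁻ x, H (s, x) ∂μ := by
  rw [lintegral_prod _ hH.aemeasurable, lintegral_count, tsum_fintype]

/-- Lebesgue measure on position-spin space. -/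
def spinVolume : Measure (Fin 2 × E3) := Measure.count.prod volume

instance : SigmaFinite spinVolume := by unfold spinVolume; infer_instance

lemma pi_count {ι S : Type*} [Fintype ι] [Fintype S] [MeasurableSpace S]
    [MeasurableSingletonClass S] :
    (Measure.pi fun _ : ι => (Measure.count : Measure S)) = Measure.count := by
  refine Measure.ext_of_singleton fun s => ?_
  rw [Measure.pi_singleton]
  simp

lemma lintegral_pi_spinVolume {n : ℕ} (H : (Fin n → Fin 2) × (Fin n → E3) → ℝ≥0∞) :
    ∫⁻ p, H (fun i => (p i).1, fun i => (p i).2) ∂(Measure.pi fun _ : Fin n => spinVolume) =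
      ∫⁻ w, H w ∂(Measure.count.prod volume) := by
  have h := measurePreserving_arrowProdEquivProdArrow (Fin 2) E3 (Fin n)
    (fun _ => Measure.count) (fun _ => volume)
  rw [pi_count] at h
  exact h.lintegral_comp_emb (MeasurableEquiv.measurableEmbedding _) H

end SpinSpace

section WaveFunction

lemma integral_count_prod {S X : Type*} [Fintype S] [MeasurableSpace S]
    [MeasurableSingletonClass S] [MeasurableSpace X] (μ : Measure X) [SFinite μ]
    {H : S × X → ℂ} (hH : Integrable H (Measure.count.prod μ)) :
    ∫ p, H p ∂(Measure.count.prod μ) = ∑ s, ∫ x, H (s, x) ∂μ := by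
  rw [integral_prod _ hH, integral_fintype (Integrable.of_finite)]
  simp

lemma measurable_uncurry_of_finite {S X F : Type*} [Finite S] [MeasurableSpace S]
    [MeasurableSingletonClass S] [MeasurableSpace X] [MeasurableSpace F] {G : S → X → F}
    (hG : ∀ s, Measurable (G s)) : Measurable fun w : S × X => G w.1 w.2 :=
  measurable_from_prod_countable_right hG

lemma lintegral_enorm_sq_ne_top {n : ℕ} {F : Type*} [NormedAddCommGroup F]
    {u : (Fin n → E3) → F} (hu : Continuous u) (hc : HasCompactSupport u) :
    ∫⁻ x, ‖u x‖ₑ ^ 2 ≠ ∞ := by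
  rw [lintegral_norm_sq_eq_ofReal (integrable_norm_sq_of_hasCompactSupport hu hc)]
  exact ENNReal.ofReal_ne_top

/-- Splitting off the first particle. -/
lemma sum_lintegral_cons {n : ℕ} {G : (Fin (n + 1) → Fin 2) → (Fin (n + 1) → E3) → ℝ≥0∞}
    (hG : ∀ σ, Measurable (G σ)) :
    ∑ s, ∫⁻ w : (Fin n → Fin 2) × (Fin n → E3), (∫⁻ x, G (Fin.cons s w.1) (Fin.cons x w.2))
        ∂(Measure.count.prod volume) = ∑ σ, ∫⁻ x, G σ x := by
  rw [← Fintype.sum_equiv (Fin.consEquiv fun _ : Fin (n + 1) => Fin 2)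
    (fun w => ∫⁻ x, G (Fin.cons w.1 w.2) x) _ fun w => rfl, Fintype.sum_prod_type]
  refine Finset.sum_congr rfl fun s _ => ?_
  have hm : ∀ σ : Fin n → Fin 2, Measurable fun w : E3 × (Fin n → E3) =>
      G (Fin.cons s σ) (Fin.cons w.1 w.2) := fun σ => (hG _).comp measurable_finCons
  have hI : Measurable fun w : (Fin n → Fin 2) × (Fin n → E3) =>
      ∫⁻ x, G (Fin.cons s w.1) (Fin.cons x w.2) :=
    measurable_uncurry_of_finite (G := fun (σ : Fin n → Fin 2) (y : Fin n → E3) =>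
      ∫⁻ x, G (Fin.cons s σ) (Fin.cons x y)) fun σ =>
        ((hm σ).comp measurable_swap).lintegral_prod_right'
  rw [lintegral_count_prod volume hI]
  refine Finset.sum_congr rfl fun σ _ => ?_
  have h := lintegral_pi_succ (volume : Measure E3) (G (Fin.cons s σ))
  rw [lintegral_prod_symm _ (hm σ).aemeasurable] at h
  exact h.symm

variable {N : ℕ} {Ψ : (Fin (N + 1) → Fin 3 → ℝ) → (Fin (N + 1) → Fin 2) → ℂ}

/-- The family of one-body functions obtained by fixing all particles but the first. -/
def waveFamily (Ψ : (Fin (N + 1) → Fin 3 → ℝ) → (Fin (N + 1) → Fin 2) → ℂ) (s : Fin 2)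
    (w : (Fin N → Fin 2) × (Fin N → E3)) (x : E3) : ℂ :=
  Ψ (Fin.cons x w.2) (Fin.cons s w.1)

/-- The measure on the remaining particles, including the particle number. -/
def waveMeasure (N : ℕ) : Measure ((Fin N → Fin 2) × (Fin N → E3)) :=
  (N + 1 : ℝ≥0∞) • Measure.count.prod volume

instance : SFinite (waveMeasure N) := by unfold waveMeasure; infer_instance

lemma IsWaveFun.exists_bound (hΨ : IsWaveFun (N + 1) Ψ) : ∃ M : ℝ≥0, ∀ x s, ‖Ψ x s‖ ≤ M := by
  choose C hC using fun s => (hΨ.smooth s).continuous.bounded_above_of_compact_support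
    (hΨ.compactSupport s)
  refine ⟨∑ s, (C s).toNNReal, fun x s => (hC s x).trans ?_⟩
  refine (Real.le_coe_toNNReal _).trans ?_
  exact_mod_cast Finset.single_le_sum (f := fun s => (C s).toNNReal) (fun _ _ => zero_le)
    (Finset.mem_univ s)

lemma IsWaveFun.exists_radius (hΨ : IsWaveFun (N + 1) Ψ) :
    ∃ R : ℝ, ∀ x s, (∃ i, x i ∉ Metric.closedBall (0 : E3) R) → Ψ x s = 0 := by
  choose R hR using fun s => (hΨ.compactSupport s).isCompact.isBounded.subset_closedBall 0
  obtain ⟨B, hB⟩ := (Set.finite_range R).bddAbove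
  refine ⟨B, fun x s ⟨i, hi⟩ => ?_⟩
  by_contra h
  have h1 := hR s (subset_tsupport _ h)
  apply hi
  rw [mem_closedBall_zero_iff] at h1 ⊢
  exact (norm_le_pi_norm x i).trans (h1.trans (hB ⟨s, rfl⟩))

lemma hasFDerivAt_finCons_left {n : ℕ} (y : Fin n → E3) (x : E3) :
    HasFDerivAt (fun x : E3 => (Fin.cons x y : Fin (n + 1) → E3))
      (ContinuousLinearMap.single ℝ (fun _ : Fin (n + 1) => E3) 0) x := by
  have h : (fun x : E3 => (Fin.cons x y : Fin (n + 1) → E3)) = fun x =>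
      ContinuousLinearMap.single ℝ (fun _ : Fin (n + 1) => E3) 0 x + Fin.cons 0 y := by
    funext x i
    refine Fin.cases ?_ (fun j => ?_) i <;> simp
  rw [h]
  exact (ContinuousLinearMap.hasFDerivAt _).add_const _

lemma contDiff_finCons {n : ℕ} (y : Fin n → E3) :
    ContDiff ℝ (⊤ : ℕ∞) fun x : E3 => (Fin.cons x y : Fin (n + 1) → E3) := by
  refine contDiff_pi.2 fun i => ?_
  refine Fin.cases ?_ (fun j => ?_) i
  · exact contDiff_id
  · simpa using contDiff_const

lemma pd_waveFamily (hΨ : IsWaveFun (N + 1) Ψ) (k : Fin 3) (s : Fin 2)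
    (w : (Fin N → Fin 2) × (Fin N → E3)) (x : E3) :
    pd k (waveFamily Ψ s w) x =
      fderiv ℝ (fun y => Ψ y (Fin.cons s w.1)) (Fin.cons x w.2) (eVec (N + 1) 0 k) := by
  have h : HasFDerivAt (waveFamily Ψ s w) _ x :=
    HasFDerivAt.comp (g := fun y => Ψ y (Fin.cons s w.1)) x
      (((hΨ.smooth (Fin.cons s w.1)).differentiable (by simp) _).hasFDerivAt)
      (hasFDerivAt_finCons_left w.2 x)
  rw [pd, h.fderiv]
  rfl

lemma IsWaveFun.continuous_partial (hΨ : IsWaveFun (N + 1) Ψ) (σ : Fin (N + 1) → Fin 2)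
    (j : Fin (N + 1)) (k : Fin 3) :
    Continuous fun x => fderiv ℝ (fun y => Ψ y σ) x (eVec (N + 1) j k) :=
  ((hΨ.smooth σ).continuous_fderiv (by simp)).clm_apply continuous_const

lemma IsWaveFun.hasCompactSupport_partial (hΨ : IsWaveFun (N + 1) Ψ) (σ : Fin (N + 1) → Fin 2)
    (j : Fin (N + 1)) (k : Fin 3) :
    HasCompactSupport fun x => fderiv ℝ (fun y => Ψ y σ) x (eVec (N + 1) j k) :=
  (hΨ.compactSupport σ).fderiv_apply ℝ _

lemma measurable_cons_cons {F : Type*} [MeasurableSpace F]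
    {G : (Fin (N + 1) → Fin 2) → (Fin (N + 1) → E3) → F} (hG : ∀ σ, Measurable (G σ))
    (s : Fin 2) :
    Measurable fun p : ((Fin N → Fin 2) × (Fin N → E3)) × E3 =>
      G (Fin.cons s p.1.1) (Fin.cons p.2 p.1.2) := by
  have h : Measurable fun w : (Fin N → Fin 2) × ((Fin N → E3) × E3) =>
      G (Fin.cons s w.1) (Fin.cons w.2.2 w.2.1) :=
    measurable_uncurry_of_finite (G := fun (σ : Fin N → Fin 2) (v : (Fin N → E3) × E3) =>
      G (Fin.cons s σ) (Fin.cons v.2 v.1)) fun σ =>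
        (hG _).comp (measurable_finCons.comp measurable_swap)
  exact h.comp MeasurableEquiv.prodAssoc.measurable

lemma lintegral_cons_ne_top {G : (Fin (N + 1) → Fin 2) → (Fin (N + 1) → E3) → ℝ≥0∞}
    (hG : ∀ σ, Measurable (G σ)) (hfin : ∀ σ, ∫⁻ x, G σ x ≠ ∞) (s : Fin 2) :
    ∫⁻ w, (∫⁻ x, G (Fin.cons s w.1) (Fin.cons x w.2)) ∂(waveMeasure N) ≠ ∞ := by
  rw [waveMeasure, lintegral_smul_measure, smul_eq_mul]
  refine ENNReal.mul_ne_top (by finiteness) ?_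
  have h := sum_lintegral_cons hG
  refine ne_top_of_le_ne_top (h ▸ ENNReal.sum_ne_top.2 fun σ _ => hfin σ) ?_
  exact Finset.single_le_sum (f := fun s => ∫⁻ w : (Fin N → Fin 2) × (Fin N → E3),
    (∫⁻ x, G (Fin.cons s w.1) (Fin.cons x w.2)) ∂(Measure.count.prod volume))
    (fun _ _ => zero_le) (Finset.mem_univ s)

lemma IsWaveFun.sum_lintegral_eq_one (hΨ : IsWaveFun (N + 1) Ψ) :
    ∑ σ, ∫⁻ x, ‖Ψ x σ‖ₑ ^ 2 = 1 := by
  have h : ∀ σ, ∫⁻ x, ‖Ψ x σ‖ₑ ^ 2 = ENNReal.ofReal (∫ x, ‖Ψ x σ‖ ^ 2) := fun σ =>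
    lintegral_norm_sq_eq_ofReal (integrable_norm_sq_of_hasCompactSupport
      (hΨ.smooth σ).continuous (hΨ.compactSupport σ))
  simp only [h]
  rw [← ENNReal.ofReal_sum_of_nonneg fun σ _ => integral_nonneg fun _ => sq_nonneg _,
    hΨ.normalized, ENNReal.ofReal_one]

lemma IsWaveFun.bessel (hΨ : IsWaveFun (N + 1) Ψ) (s : Fin 2) {g : E3 → ℂ} (hg : Continuous g)
    (hgc : HasCompactSupport g) :
    ∫⁻ w, ‖∫ x, g x * waveFamily Ψ s w x‖ₑ ^ 2 ∂(waveMeasure N) ≤ ∫⁻ x, ‖g x‖ₑ ^ 2 := by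
  obtain ⟨M, hM⟩ := hΨ.exists_bound
  obtain ⟨R, hR⟩ := hΨ.exists_radius
  obtain ⟨M', hM'⟩ := hg.bounded_above_of_compact_support hgc
  obtain ⟨R', hR'⟩ := hgc.isCompact.isBounded.subset_closedBall 0
  set K : Set (Fin 2 × E3) := Set.univ ×ˢ Metric.closedBall (0 : E3) (max R R') with hK
  have hKν : spinVolume K ≠ ∞ := by
    rw [spinVolume, hK, Measure.prod_prod]
    exact ENNReal.mul_ne_top (measure_ne_top _ _) measure_closedBall_lt_top.ne
  set f : (Fin (N + 1) → Fin 2 × E3) → ℂ := fun p => Ψ (fun i => (p i).2) fun i => (p i).1 with hf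
  set h : Fin 2 × E3 → ℂ := fun z => if z.1 = s then g z.2 else 0 with hh
  have hfm : Measurable f := by
    have h1 : Measurable fun w : (Fin (N + 1) → Fin 2) × (Fin (N + 1) → E3) => Ψ w.2 w.1 :=
      measurable_uncurry_of_finite (G := fun σ x => Ψ x σ) fun σ =>
        (hΨ.smooth σ).continuous.measurable
    exact h1.comp (MeasurableEquiv.arrowProdEquivProdArrow (Fin 2) E3 (Fin (N + 1))).measurable
  have hhm : Measurable h :=
    Measurable.ite (measurable_fst (measurableSet_singleton s))
      (hg.measurable.comp measurable_snd) measurable_const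
  have hhM : ∀ z, ‖h z‖ ≤ max (M : ℝ) M' := fun z => by
    simp only [hh]
    split_ifs
    · exact (hM' _).trans (le_max_right _ _)
    · rw [norm_zero]; exact M.2.trans (le_max_left _ _)
  have hfK : ∀ p, (∃ i, p i ∉ K) → f p = 0 := by
    rintro p ⟨i, hi⟩
    refine hR _ _ ⟨i, fun hi' => hi ⟨Set.mem_univ _, ?_⟩⟩
    exact Metric.closedBall_subset_closedBall (le_max_left _ _) hi'
  have hhK : ∀ z, z ∉ K → h z = 0 := by
    intro z hz
    simp only [hh]
    split_ifs with hzs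
    · by_contra hne
      refine hz ⟨Set.mem_univ _, ?_⟩
      exact Metric.closedBall_subset_closedBall (le_max_right _ _) (hR' (subset_tsupport _ hne))
    · rfl
  have key := lintegral_enorm_sq_contraction_le spinVolume (h := h) (f := f)
    (fun π p => hΨ.antisymm π (fun i => (p i).2) fun i => (p i).1) hfm hhm (M := max (M : ℝ) M')
    (fun p => (hM _ _).trans (le_max_left _ _)) hhM hKν hfK hhK
  have hone : ∫⁻ p, ‖f p‖ₑ ^ 2 ∂(Measure.pi fun _ => spinVolume) = 1 := by
    rw [lintegral_pi_spinVolume fun w => ‖Ψ w.2 w.1‖ₑ ^ 2, lintegral_count_prod,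
      hΨ.sum_lintegral_eq_one]
    exact measurable_uncurry_of_finite (G := fun σ x => ‖Ψ x σ‖ₑ ^ 2) fun σ =>
        (hΨ.smooth σ).continuous.measurable.enorm.pow_const 2
  have hh2 : ∫⁻ z, ‖h z‖ₑ ^ 2 ∂spinVolume = ∫⁻ x, ‖g x‖ₑ ^ 2 := by
    rw [spinVolume, lintegral_count_prod volume (hhm.enorm.pow_const 2)]
    rw [Finset.sum_eq_single s]
    · simp [hh]
    · intro t _ ht
      simp [hh, ht]
    · simp
  have hinner : ∀ q : Fin N → Fin 2 × E3, ∫ z, h z * f (Fin.cons z q) ∂spinVolume =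
      ∫ x, g x * waveFamily Ψ s (fun i => (q i).1, fun i => (q i).2) x := by
    intro q
    have hInt : Integrable (fun z => h z * f (Fin.cons z q)) spinVolume := by
      refine integrable_of_bounded_of_support_subset (M := max (M : ℝ) M' * M)
        (hhm.mul (hfm.comp ?_)).aestronglyMeasurable (fun z => ?_) hKν
        fun z hz => by rw [hhK z hz, zero_mul]
      · exact (measurable_finCons (Z := Fin 2 × E3) (n := N)).comp
          (measurable_id.prodMk measurable_const)
      · rw [norm_mul]
        exact mul_le_mul (hhM z) (hM _ _) (norm_nonneg _) ((norm_nonneg _).trans (hhM z))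
    have hf' : ∀ x, f (Fin.cons (s, x) q) =
        waveFamily Ψ s (fun i => (q i).1, fun i => (q i).2) x := by
      intro x
      simp only [hf, waveFamily]
      congr 1
      · funext i
        refine Fin.cases ?_ (fun j => ?_) i <;> simp
      · funext i
        refine Fin.cases ?_ (fun j => ?_) i <;> simp
    rw [spinVolume] at hInt ⊢
    rw [integral_count_prod volume hInt, Finset.sum_eq_single s]
    · simp [hh, hf']
    · intro t _ ht
      simp [hh, ht]
    · simp
  rw [hone, hh2, mul_one] at key
  simp only [hinner] at key
  rw [lintegral_pi_spinVolume fun w => ‖∫ x, g x * waveFamily Ψ s w x‖ₑ ^ 2] at key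
  rwa [waveMeasure, lintegral_smul_measure, smul_eq_mul]

lemma isOrbitalFamily_waveFamily (hΨ : IsWaveFun (N + 1) Ψ) :
    IsOrbitalFamily (waveMeasure N) (waveFamily Ψ) where
  smooth s w := (hΨ.smooth (Fin.cons s w.1)).comp (contDiff_finCons w.2)
  measurable s := measurable_cons_cons (G := fun σ x => Ψ x σ)
    (fun σ => (hΨ.smooth σ).continuous.measurable) s
  measurable_pd s k := by
    simp only [pd_waveFamily hΨ]
    exact measurable_cons_cons
      (G := fun σ x => fderiv ℝ (fun y => Ψ y σ) x (eVec (N + 1) 0 k))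
      (fun σ => (hΨ.continuous_partial σ 0 k).measurable) s
  mass_ne_top s := lintegral_cons_ne_top (G := fun σ x => ‖Ψ x σ‖ₑ ^ 2)
    (fun σ => (hΨ.smooth σ).continuous.measurable.enorm.pow_const 2)
    (fun σ => lintegral_enorm_sq_ne_top (hΨ.smooth σ).continuous (hΨ.compactSupport σ)) s
  grad_ne_top s := by
    simp only [gradNormSq, pd_waveFamily hΨ]
    refine lintegral_cons_ne_top
      (G := fun σ x => ∑ k, ‖fderiv ℝ (fun y => Ψ y σ) x (eVec (N + 1) 0 k)‖ₑ ^ 2)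
      (fun σ => Finset.measurable_fun_sum _ fun k _ =>
        (hΨ.continuous_partial σ 0 k).measurable.enorm.pow_const 2) (fun σ => ?_) s
    rw [lintegral_finsetSum _ fun k _ =>
      (hΨ.continuous_partial σ 0 k).measurable.enorm.pow_const 2]
    exact ENNReal.sum_ne_top.2 fun k _ => lintegral_enorm_sq_ne_top
      (hΨ.continuous_partial σ 0 k) (hΨ.hasCompactSupport_partial σ 0 k)
  bounded := by
    obtain ⟨M, hM⟩ := hΨ.exists_bound
    obtain ⟨R, hR⟩ := hΨ.exists_radius
    set K : Set ((Fin N → Fin 2) × (Fin N → E3)) :=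
      Set.univ ×ˢ Set.univ.pi fun _ => Metric.closedBall (0 : E3) R with hK
    have hKm : MeasurableSet K := MeasurableSet.univ.prod
      (MeasurableSet.univ_pi fun _ => Metric.isClosed_closedBall.measurableSet)
    have hKμ : waveMeasure N K ≠ ∞ := by
      rw [waveMeasure, Measure.smul_apply, smul_eq_mul, hK, Measure.prod_prod, volume_pi_pi]
      exact ENNReal.mul_ne_top (by finiteness) (ENNReal.mul_ne_top (measure_ne_top _ _)
        (ENNReal.prod_ne_top fun _ _ => measure_closedBall_lt_top.ne))
    refine ⟨M ^ 2 * (waveMeasure N K).toNNReal, fun s x => ?_⟩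
    calc ∫⁻ w, ‖waveFamily Ψ s w x‖ₑ ^ 2 ∂(waveMeasure N)
        ≤ ∫⁻ w, K.indicator (fun _ => (M : ℝ≥0∞) ^ 2) w ∂(waveMeasure N) := by
          refine lintegral_mono fun w => ?_
          by_cases hw : w ∈ K
          · rw [Set.indicator_of_mem hw]
            refine pow_le_pow_left' ?_ 2
            have := hM (Fin.cons x w.2) (Fin.cons s w.1)
            exact enorm_le_coe.2 this
          · have : ∃ i, w.2 i ∉ Metric.closedBall (0 : E3) R := by
              by_contra! h
              exact hw ⟨Set.mem_univ _, fun i _ => h i⟩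
            obtain ⟨i, hi⟩ := this
            have h0 : waveFamily Ψ s w x = 0 := hR _ _ ⟨i.succ, by simpa using hi⟩
            simp [h0]
      _ = _ := by
          rw [lintegral_indicator hKm, setLIntegral_const]
          push_cast
          rw [ENNReal.coe_toNNReal hKμ]
  bessel s g hg hgc := hΨ.bessel s hg hgc

end WaveFunction

section VectorPotential

variable {A : E3 → E3}

lemma pdVec_eq_pd (hA : ContDiff ℝ (⊤ : ℕ∞) A) (i j : Fin 3) (x : E3) :
    pdVec A i j x = pd i (fun y => A y j) x := by
  have h := hasFDerivAt_pi'.1 (hA.differentiable (by simp) x).hasFDerivAt j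
  rw [pd, h.fderiv]
  rfl

lemma continuous_pdVec (hA : ContDiff ℝ (⊤ : ℕ∞) A) (i j : Fin 3) : Continuous (pdVec A i j) :=
  (continuous_apply j).comp ((hA.continuous_fderiv (by simp)).clm_apply continuous_const)

lemma hasCompactSupport_pdVec (hc : HasCompactSupport A) (i j : Fin 3) :
    HasCompactSupport (pdVec A i j) :=
  (hc.fderiv_apply ℝ (Pi.single i 1)).comp_left (g := fun v : E3 => v j) rfl

lemma integrable_pdVec_mul (hA : ContDiff ℝ (⊤ : ℕ∞) A) (hc : HasCompactSupport A)
    (i j k l : Fin 3) : Integrable fun x => pdVec A i j x * pdVec A k l x :=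
  ((continuous_pdVec hA i j).mul (continuous_pdVec hA k l)).integrable_of_hasCompactSupport
    ((hasCompactSupport_pdVec hc i j).mul_right)

lemma integrable_gradSq (hA : ContDiff ℝ (⊤ : ℕ∞) A) (hc : HasCompactSupport A) :
    Integrable (gradSq A) := by
  refine integrable_finsetSum _ fun i _ => integrable_finsetSum _ fun j _ => ?_
  simpa only [sq] using integrable_pdVec_mul hA hc i j i j

lemma integral_gradSq_eq_integral_curlSq (hA : IsVecPot A) :
    ∫ x, gradSq A x = ∫ x, curlSq A x := by
  obtain ⟨hs, hc, hdiv⟩ := hA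
  have hcomp : ∀ j, ContDiff ℝ (⊤ : ℕ∞) fun y => A y j := fun j => contDiff_pi.1 hs j
  have hcompc : ∀ j, HasCompactSupport fun y => A y j := fun j =>
    hc.comp_left (g := fun v : E3 => v j) rfl
  have hpt : ∀ x, curlSq A x = gradSq A x - ∑ i, ∑ j, pdVec A i j x * pdVec A j i x := by
    intro x
    simp only [curlSq, gradSq, curl3, Fin.sum_univ_three, Matrix.cons_val_zero,
      Matrix.cons_val_one, Matrix.cons_val]
    ring
  have hzero : ∫ x, ∑ i, ∑ j, pdVec A i j x * pdVec A j i x = 0 := by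
    have h1 : ∫ x, ∑ i, ∑ j, pdVec A i j x * pdVec A j i x =
        ∫ x, ∑ i, ∑ j, pdVec A j j x * pdVec A i i x := by
      rw [integral_finsetSum _ fun i _ => integrable_finsetSum _ fun j _ =>
          integrable_pdVec_mul hs hc i j j i,
        integral_finsetSum _ fun i _ => integrable_finsetSum _ fun j _ =>
          integrable_pdVec_mul hs hc j j i i]
      refine Finset.sum_congr rfl fun i _ => ?_
      rw [integral_finsetSum _ fun j _ => integrable_pdVec_mul hs hc i j j i,
        integral_finsetSum _ fun j _ => integrable_pdVec_mul hs hc j j i i]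
      refine Finset.sum_congr rfl fun j _ => ?_
      simp only [pdVec_eq_pd hs]
      exact integral_pd_mul_pd_comm (hcomp j) (hcomp i) (hcompc j) i j
    rw [h1]
    simp [← Finset.sum_mul, hdiv]
  simp only [hpt]
  rw [integral_sub (integrable_gradSq hs hc) (integrable_finsetSum _ fun i _ =>
    integrable_finsetSum _ fun j _ => integrable_pdVec_mul hs hc i j j i), hzero, sub_zero]

lemma lintegral_enorm_fderiv_sq_le (hA : IsVecPot A) :
    ∫⁻ x, ‖fderiv ℝ A x‖ₑ ^ 2 ≤ ENNReal.ofReal (3 * ∫ x, curlSq A x) := by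
  have hpt : ∀ x, ‖fderiv ℝ A x‖ₑ ^ 2 ≤ ENNReal.ofReal (3 * gradSq A x) := by
    intro x
    refine (enorm_fderiv_sq_le A x).trans ?_
    rw [ENNReal.ofReal_mul (by norm_num), gradSq,
      ENNReal.ofReal_sum_of_nonneg fun i _ => Finset.sum_nonneg fun j _ => sq_nonneg _]
    simp only [gradNormSq, ENNReal.ofReal_ofNat]
    gcongr with i
    rw [← ofReal_norm, ← ENNReal.ofReal_pow (norm_nonneg _)]
    refine ENNReal.ofReal_le_ofReal ?_
    have h0 : 0 ≤ ∑ j, pdVec A i j x ^ 2 := Finset.sum_nonneg fun j _ => sq_nonneg _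
    refine (Real.le_sqrt (norm_nonneg _) h0).1 ?_
    refine (pi_norm_le_iff_of_nonneg (Real.sqrt_nonneg _)).2 fun j => ?_
    exact Real.abs_le_sqrt (Finset.single_le_sum (f := fun j => pdVec A i j x ^ 2)
      (fun j _ => sq_nonneg _) (Finset.mem_univ j))
  refine (lintegral_mono hpt).trans ?_
  rw [← integral_gradSq_eq_integral_curlSq hA, ← integral_const_mul,
    ofReal_integral_eq_lintegral_ofReal ((integrable_gradSq hA.1 hA.2.1).const_mul 3)
      (Filter.Eventually.of_forall fun x => mul_nonneg (by norm_num)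
        (Finset.sum_nonneg fun i _ => Finset.sum_nonneg fun j _ => sq_nonneg _))]

end VectorPotential

section ManyBody

variable {N : ℕ} {Ψ : (Fin (N + 1) → Fin 3 → ℝ) → (Fin (N + 1) → Fin 2) → ℂ}

/-- The Pauli operator acting on particle `j`. -/
def manyPauli (A : E3 → E3) (j : Fin N) (Ψ : (Fin N → Fin 3 → ℝ) → (Fin N → Fin 2) → ℂ)
    (s : Fin N → Fin 2) (x : Fin N → E3) : ℂ :=
  ∑ k : Fin 3, ∑ t : Fin 2, pauli k (s j) t *
    (-Complex.I * fderiv ℝ (fun y => Ψ y (Function.update s j t)) x (eVec N j k)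
      + (A (x j) k : ℂ) * Ψ x (Function.update s j t))

lemma pauliKin_eq (A : E3 → E3) (j : Fin N) (Ψ : (Fin N → Fin 3 → ℝ) → (Fin N → Fin 2) → ℂ) :
    pauliKin N A j Ψ = ∑ s, ∫ x, ‖manyPauli A j Ψ s x‖ ^ 2 := rfl

lemma IsWaveFun.continuous_manyPauli (hΨ : IsWaveFun (N + 1) Ψ) {A : E3 → E3}
    (hA : Continuous A) (j : Fin (N + 1)) (s : Fin (N + 1) → Fin 2) :
    Continuous (manyPauli A j Ψ s) := by
  refine continuous_finsetSum _ fun k _ => continuous_finsetSum _ fun t _ =>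
    continuous_const.mul ((continuous_const.mul (hΨ.continuous_partial _ j k)).add
      ((Complex.continuous_ofReal.comp ?_).mul (hΨ.smooth _).continuous))
  exact (continuous_apply k).comp (hA.comp (continuous_apply j))

lemma IsWaveFun.hasCompactSupport_manyPauli (hΨ : IsWaveFun (N + 1) Ψ) (A : E3 → E3)
    (j : Fin (N + 1)) (s : Fin (N + 1) → Fin 2) : HasCompactSupport (manyPauli A j Ψ s) := by
  refine HasCompactSupport.intro (K := ⋃ t, tsupport fun x => Ψ x (Function.update s j t))
    (isCompact_iUnion fun t => hΨ.compactSupport _) fun x hx => ?_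
  simp only [Set.mem_iUnion, not_exists] at hx
  refine Finset.sum_eq_zero fun k _ => Finset.sum_eq_zero fun t _ => ?_
  have h1 : Ψ x (Function.update s j t) = 0 :=
    image_eq_zero_of_notMem_tsupport (f := fun x => Ψ x (Function.update s j t)) (hx t)
  have h2 : fderiv ℝ (fun y => Ψ y (Function.update s j t)) x = 0 := by
    by_contra h
    exact hx t (support_fderiv_subset ℝ h)
  simp [h1, h2]

lemma norm_manyPauli_eq (hΨ : IsWaveFun (N + 1) Ψ) (A : E3 → E3) (j : Fin (N + 1))
    (s : Fin (N + 1) → Fin 2) (x : Fin (N + 1) → E3) :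
    ‖manyPauli A 0 Ψ (fun i => s (Equiv.swap 0 j i)) fun i => x (Equiv.swap 0 j i)‖ =
      ‖manyPauli A j Ψ s x‖ := by
  set π := Equiv.swap 0 j with hπ
  set ε : ℂ := ((Equiv.Perm.sign π : ℤ) : ℂ) with hε
  have hεn : ‖ε‖ = 1 := by
    rcases Int.units_eq_one_or (Equiv.Perm.sign π) with h | h <;> simp [hε, h]
  have hup : ∀ t, Function.update (fun i => s (π i)) 0 t = fun i => Function.update s j t (π i) := by
    intro t
    funext i
    by_cases hi : i = 0
    · subst hi; simp [hπ]
    · have hij : π i ≠ j := fun h => hi (by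
        have := congrArg π h
        simpa [hπ] using this)
      rw [Function.update_of_ne hi, Function.update_of_ne hij]
  let L : (Fin (N + 1) → E3) →L[ℝ] (Fin (N + 1) → E3) :=
    ContinuousLinearMap.pi fun i => ContinuousLinearMap.proj (π i)
  have hL : ∀ k, L (eVec (N + 1) j k) = eVec (N + 1) 0 k := by
    intro k
    funext i
    change eVec (N + 1) j k (π i) = _
    by_cases hi : i = 0
    · subst hi; simp [hπ, eVec]
    · have hij : π i ≠ j := fun h => hi (by
        have := congrArg π h
        simpa [hπ] using this)
      simp [eVec, hi, hij]
  have hfd : ∀ k t, fderiv ℝ (fun y => Ψ y (Function.update (fun i => s (π i)) 0 t))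
      (fun i => x (π i)) (eVec (N + 1) 0 k) =
      ε * fderiv ℝ (fun y => Ψ y (Function.update s j t)) x (eVec (N + 1) j k) := by
    intro k t
    have hc : (fun y => Ψ y (Function.update (fun i => s (π i)) 0 t)) ∘ L =
        fun y => ε * Ψ y (Function.update s j t) := by
      funext y
      rw [Function.comp_apply, hup]
      exact hΨ.antisymm π y _
    have h1 := ((hΨ.smooth (Function.update (fun i => s (π i)) 0 t)).differentiable (by simp)
      (L x)).hasFDerivAt.comp x L.hasFDerivAt
    have h2 := ((hΨ.smooth (Function.update s j t)).differentiable (by simp)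
      x).hasFDerivAt.const_mul ε
    rw [hc] at h1
    have h3 := congrArg (fun T => T (eVec (N + 1) j k)) (h1.unique h2)
    simp only [ContinuousLinearMap.comp_apply, hL, _root_.smul_apply,
      smul_eq_mul] at h3
    exact h3
  have hval : ∀ t, Ψ (fun i => x (π i)) (Function.update (fun i => s (π i)) 0 t) =
      ε * Ψ x (Function.update s j t) := fun t => by
    rw [hup]
    exact hΨ.antisymm π x _
  have h0 : π 0 = j := by simp [hπ]
  have : manyPauli A 0 Ψ (fun i => s (π i)) (fun i => x (π i)) = ε * manyPauli A j Ψ s x := by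
    simp only [manyPauli, hfd, hval, h0, Finset.mul_sum]
    refine Finset.sum_congr rfl fun k _ => Finset.sum_congr rfl fun t _ => ?_
    ring
  rw [this, norm_mul, hεn, one_mul]

lemma pauliKin_eq_zero_index (hΨ : IsWaveFun (N + 1) Ψ) (A : E3 → E3) (j : Fin (N + 1)) :
    pauliKin (N + 1) A j Ψ = pauliKin (N + 1) A 0 Ψ := by
  rw [pauliKin_eq, pauliKin_eq]
  refine Fintype.sum_equiv ((Equiv.swap 0 j).arrowCongr (Equiv.refl (Fin 2))) _ _ fun s => ?_
  simp only [← norm_manyPauli_eq hΨ A j]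
  exact integral_pi_comp_perm volume (Equiv.swap 0 j) fun x =>
    ‖manyPauli A 0 Ψ (fun i => s (Equiv.swap 0 j i)) x‖ ^ 2

lemma pauliOp_waveFamily (hΨ : IsWaveFun (N + 1) Ψ) (A : E3 → E3) (s : Fin 2)
    (w : (Fin N → Fin 2) × (Fin N → E3)) (x : E3) :
    pauliOp A (fun t => waveFamily Ψ t w) s x =
      manyPauli A 0 Ψ (Fin.cons s w.1) (Fin.cons x w.2) := by
  simp only [pauliOp, manyPauli, pd_waveFamily hΨ, Fin.update_cons_zero, Fin.cons_zero]
  rfl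

lemma sum_pauliKin_eq_mul (hΨ : IsWaveFun (N + 1) Ψ) {A : E3 → E3} (hA : Continuous A) :
    ENNReal.ofReal (∑ j, pauliKin (N + 1) A j Ψ) =
      ((N + 1 : ℕ) : ℝ≥0∞) * ∑ σ, ∫⁻ x, ‖manyPauli A 0 Ψ σ x‖ₑ ^ 2 := by
  have h3 : ∀ σ, ∫⁻ x, ‖manyPauli A 0 Ψ σ x‖ₑ ^ 2 =
      ENNReal.ofReal (∫ x, ‖manyPauli A 0 Ψ σ x‖ ^ 2) := fun σ =>
    lintegral_norm_sq_eq_ofReal (integrable_norm_sq_of_hasCompactSupport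
      (hΨ.continuous_manyPauli hA 0 σ) (hΨ.hasCompactSupport_manyPauli A 0 σ))
  rw [Finset.sum_congr rfl fun j _ => pauliKin_eq_zero_index hΨ A j,
    Finset.sum_congr rfl fun σ _ => h3 σ,
    ← ENNReal.ofReal_sum_of_nonneg fun σ _ => integral_nonneg fun _ => sq_nonneg _,
    ← pauliKin_eq, Finset.sum_const, Finset.card_univ, Fintype.card_fin, nsmul_eq_mul,
    ENNReal.ofReal_mul (Nat.cast_nonneg _), ENNReal.ofReal_natCast]

lemma lintegral_waveMeasure_sum_cons
    {G : (Fin (N + 1) → Fin 2) → (Fin (N + 1) → E3) → ℝ≥0∞} (hG : ∀ σ, Measurable (G σ)) :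
    ∫⁻ w, (∫⁻ x, ∑ s, G (Fin.cons s w.1) (Fin.cons x w.2)) ∂(waveMeasure N) =
      ((N + 1 : ℕ) : ℝ≥0∞) * ∑ σ, ∫⁻ x, G σ x := by
  have hm := measurable_cons_cons hG
  have h2 : ∀ w : (Fin N → Fin 2) × (Fin N → E3),
      ∫⁻ x, ∑ s, G (Fin.cons s w.1) (Fin.cons x w.2) =
      ∑ s, ∫⁻ x, G (Fin.cons s w.1) (Fin.cons x w.2) := fun w =>
    lintegral_finsetSum _ fun s _ => (hm s).comp (measurable_prodMk_left (x := w))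
  rw [lintegral_congr h2, lintegral_finsetSum _ fun s _ => (hm s).lintegral_prod_right',
    ← sum_lintegral_cons hG, Finset.mul_sum]
  refine Finset.sum_congr rfl fun s _ => ?_
  rw [waveMeasure, lintegral_smul_measure, smul_eq_mul, Nat.cast_add_one]

lemma lintegral_famKinetic_waveFamily (hΨ : IsWaveFun (N + 1) Ψ) {A : E3 → E3}
    (hA : Continuous A) :
    ∫⁻ z, famKinetic (waveMeasure N) A (waveFamily Ψ) z =
      ENNReal.ofReal (∑ j, pauliKin (N + 1) A j Ψ) := by
  have h1 := setLIntegral_famKinetic (isOrbitalFamily_waveFamily hΨ) hA Set.univ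
  rw [Measure.restrict_univ] at h1
  rw [h1, sum_pauliKin_eq_mul hΨ hA, ← lintegral_waveMeasure_sum_cons fun σ =>
    (hΨ.continuous_manyPauli hA 0 σ).measurable.enorm.pow_const 2]
  refine lintegral_congr fun w => lintegral_congr fun x => Finset.sum_congr rfl fun s _ => ?_
  rw [pauliOp_waveFamily hΨ]

lemma famDensity_waveFamily (hΨ : IsWaveFun (N + 1) Ψ) (x : E3) :
    famDensity (waveMeasure N) (waveFamily Ψ) x = ENNReal.ofReal (oneDensity N Ψ x) := by
  obtain ⟨M, hM⟩ := hΨ.exists_bound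
  obtain ⟨R, hR⟩ := hΨ.exists_radius
  have hcm : Measurable fun y : Fin N → E3 => (Fin.cons x y : Fin (N + 1) → E3) :=
    (measurable_finCons (Z := E3)).comp (measurable_const.prodMk measurable_id)
  have hc : ∀ σ, Measurable fun y : Fin N → E3 => Ψ (Fin.cons x y) σ := fun σ =>
    (hΨ.smooth σ).continuous.measurable.comp hcm
  have hInt : ∀ σ, Integrable fun y : Fin N → E3 => ‖Ψ (Fin.cons x y) σ‖ ^ 2 := by
    intro σ
    refine integrable_of_bounded_of_support_subset (M := (M : ℝ) ^ 2)
      (K := Set.univ.pi fun _ => Metric.closedBall (0 : E3) R)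
      ((hc σ).norm.pow_const 2).aestronglyMeasurable (fun y => ?_) ?_ fun y hy => ?_
    · rw [norm_pow, norm_norm]
      exact pow_le_pow_left₀ (norm_nonneg _) (hM _ _) 2
    · rw [volume_pi_pi]
      exact ENNReal.prod_ne_top fun _ _ => measure_closedBall_lt_top.ne
    · simp only [Set.mem_pi, Set.mem_univ, true_implies, not_forall] at hy
      obtain ⟨i, hi⟩ := hy
      rw [hR _ _ ⟨i.succ, by simpa using hi⟩]
      simp
  have hm : ∀ s, Measurable fun w : (Fin N → Fin 2) × (Fin N → E3) =>
      ‖waveFamily Ψ s w x‖ₑ ^ 2 := fun s =>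
    measurable_uncurry_of_finite (G := fun σ y => ‖Ψ (Fin.cons x y) (Fin.cons s σ)‖ₑ ^ 2)
      fun σ => (hc _).enorm.pow_const 2
  rw [famDensity, lintegral_finsetSum _ fun s _ => hm s]
  simp only [waveMeasure, lintegral_smul_measure, smul_eq_mul]
  rw [← Finset.mul_sum, oneDensity, ENNReal.ofReal_mul (by positivity),
    ENNReal.ofReal_sum_of_nonneg fun σ _ => integral_nonneg fun _ => sq_nonneg _]
  congr 1
  · rw [ENNReal.ofReal_add (by positivity) zero_le_one]; simp
  · simp only [← lintegral_norm_sq_eq_ofReal (hInt _)]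
    rw [← Fintype.sum_equiv (Fin.consEquiv fun _ : Fin (N + 1) => Fin 2)
      (fun w => ∫⁻ y : Fin N → E3, ‖Ψ (Fin.cons x y) (Fin.cons w.1 w.2)‖ₑ ^ 2) _ fun w => rfl,
      Fintype.sum_prod_type]
    exact Finset.sum_congr rfl fun s _ => lintegral_count_prod volume (hm s)

end ManyBody

lemma min_rpow_ofReal {ρ γ : ℝ} (hρ : 0 ≤ ρ) (hγ : 0 < γ) :
    min (ENNReal.ofReal ρ ^ (5 / 3 : ℝ)) ((γ.toNNReal : ENNReal) * ENNReal.ofReal ρ ^ (4 / 3 : ℝ)) =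
      ENNReal.ofReal (min (ρ ^ ((5 : ℝ) / 3)) (γ * ρ ^ ((4 : ℝ) / 3))) := by
  rw [ENNReal.ofReal_min, ENNReal.ofReal_mul hγ.le,
    ENNReal.ofReal_rpow_of_nonneg hρ (by norm_num),
    ENNReal.ofReal_rpow_of_nonneg hρ (by norm_num)]
  rfl

lemma oneDensity_nonneg (N : ℕ) (Ψ : (Fin (N + 1) → Fin 3 → ℝ) → (Fin (N + 1) → Fin 2) → ℂ)
    (x : E3) : 0 ≤ oneDensity N Ψ x :=
  mul_nonneg (by positivity) (Finset.sum_nonneg fun _ _ => integral_nonneg fun _ => sq_nonneg _)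

lemma measurable_oneDensity {N : ℕ} {Ψ : (Fin (N + 1) → Fin 3 → ℝ) → (Fin (N + 1) → Fin 2) → ℂ}
    (hΨ : IsWaveFun (N + 1) Ψ) : Measurable (oneDensity N Ψ) := by
  have h := (measurable_famDensity (isOrbitalFamily_waveFamily hΨ)).ennreal_toReal
  simpa only [famDensity_waveFamily hΨ, ENNReal.toReal_ofReal (oneDensity_nonneg N Ψ _)] using h

/-- Kinetic energy inequality for the Pauli operator with self-generated field:
Σ_j t_A^{(j)}[Ψ] ≥ c ∫ min(ρ_Ψ^{5/3}, γ ρ_Ψ^{4/3}) − γ ∫|∇×A|². -/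
theorem pauli_kinetic_energy_inequality :
    ∃ c : ℝ, 0 < c ∧ ∀ N : ℕ, ∀ Ψ, IsWaveFun (N + 1) Ψ →
      ∀ A, IsVecPot A → ∀ γ : ℝ, 0 < γ →
        (∑ j : Fin (N + 1), pauliKin (N + 1) A j Ψ)
          ≥ c * (∫ x : Fin 3 → ℝ,
              min (oneDensity N Ψ x ^ ((5 : ℝ) / 3)) (γ * oneDensity N Ψ x ^ ((4 : ℝ) / 3)))
            - γ * (∫ x : Fin 3 → ℝ, curlSq A x) := by
  obtain ⟨C, hC⟩ := exists_family_kinetic_inequality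
  refine ⟨(3 * (C + 1 : ℝ))⁻¹, by positivity, fun N Ψ hΨ A hA γ hγ => ?_⟩
  have key := hC _ (waveMeasure N) (waveFamily Ψ) (isOrbitalFamily_waveFamily hΨ) A hA.1
    γ.toNNReal (Real.toNNReal_pos.2 hγ)
  have hT : 0 ≤ ∑ j : Fin (N + 1), pauliKin (N + 1) A j Ψ :=
    Finset.sum_nonneg fun _ _ => Finset.sum_nonneg fun _ _ => integral_nonneg fun _ => sq_nonneg _
  have hB : 0 ≤ ∫ x, curlSq A x :=
    integral_nonneg fun _ => Finset.sum_nonneg fun _ _ => sq_nonneg _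
  set T := ∑ j : Fin (N + 1), pauliKin (N + 1) A j Ψ
  set B := ∫ x, curlSq A x
  simp only [famDensity_waveFamily hΨ, min_rpow_ofReal (oneDensity_nonneg N Ψ _) hγ,
    lintegral_famKinetic_waveFamily hΨ hA.1.continuous] at key
  have hm : Measurable fun x => min (oneDensity N Ψ x ^ ((5 : ℝ) / 3))
      (γ * oneDensity N Ψ x ^ ((4 : ℝ) / 3)) :=
    ((measurable_oneDensity hΨ).pow_const _).min
      (((measurable_oneDensity hΨ).pow_const _).const_mul γ)
  have hI : (∫ x, min (oneDensity N Ψ x ^ ((5 : ℝ) / 3)) (γ * oneDensity N Ψ x ^ ((4 : ℝ) / 3))) ≤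
      C * (T + γ * (3 * B)) := by
    rw [integral_eq_lintegral_of_nonneg_ae (Filter.Eventually.of_forall fun x =>
      le_min (Real.rpow_nonneg (oneDensity_nonneg N Ψ x) _)
        (mul_nonneg hγ.le (Real.rpow_nonneg (oneDensity_nonneg N Ψ x) _))) hm.aestronglyMeasurable]
    refine ENNReal.toReal_le_of_le_ofReal (by positivity) (key.trans ?_)
    rw [ENNReal.ofReal_mul C.coe_nonneg, ENNReal.ofReal_add hT (by positivity), ENNReal.ofReal_mul hγ.le,
      ENNReal.ofReal_coe_nnreal]
    gcongr
    · exact le_rfl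
    · exact lintegral_enorm_fderiv_sq_le hA
  have hCB : C * (T + γ * (3 * B)) ≤ 3 * (C + 1) * (T + γ * B) := by
    have h1 : 0 ≤ (C : ℝ) * T := by positivity
    have h2 : 0 ≤ γ * B := by positivity
    nlinarith
  have := (inv_mul_le_iff₀ (by positivity : (0 : ℝ) < 3 * (C + 1))).2 (hI.trans hCB)
  linarith
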